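/- The following statements are equivalent: (1) ZFC + "Ord is essentially faint" does not prove the scheme "Ord is essentially subtle"; (2) there exists a sentence φ in the language of set theory such that ZFC + φ is consistent and ZFC + φ proves the scheme "Ord is essentially faint"; (3) the theory ZFC + "There is a proper class of subtle cardinals" is consistent. -/

import Mathlib

namespace Paper

/-- First-order formulas in the language of set theory (one binary relation, membership),
using de Bruijn variables; `all` binds the last variable. -/
inductive SetFormula : ℕ → Type
  | mem {n : ℕ} (i j : Fin n) : SetFormula n
  | eq {n : ℕ} (i j : Fin n) : SetFormula n
  | fal {n : ℕ} : SetFormula n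
  | imp {n : ℕ} (φ ψ : SetFormula n) : SetFormula n
  | all {n : ℕ} (φ : SetFormula (n + 1)) : SetFormula n

namespace SetFormula

/-- Negation. -/
def not {n : ℕ} (φ : SetFormula n) : SetFormula n := φ.imp .fal

/-- Conjunction. -/
def and {n : ℕ} (φ ψ : SetFormula n) : SetFormula n := (φ.imp ψ.not).not

/-- Existential quantification (over the last variable). -/
def ex {n : ℕ} (φ : SetFormula (n + 1)) : SetFormula n := (SetFormula.all φ.not).not

end SetFormula

/-- Satisfaction of a set-theoretic formula in a structure `(M, E)`, where `E` interprets
the membership relation. -/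
def Realize {M : Type*} (E : M → M → Prop) : ∀ {n : ℕ}, SetFormula n → (Fin n → M) → Prop
  | _, .mem i j, v => E (v i) (v j)
  | _, .eq i j, v => v i = v j
  | _, .fal, _ => False
  | _, .imp φ ψ, v => Realize E φ v → Realize E ψ v
  | _, .all φ, v => ∀ a, Realize E φ (Fin.snoc v a)

/-- Satisfaction of a formula relativized to the subclass `S` of `M`; all quantifiers
range over `S`, and the assignment is required to take values in `S`. -/
def RealizeIn {M : Type*} (E : M → M → Prop) (S : M → Prop) {n : ℕ}
    (φ : SetFormula n) (v : Fin n → M) : Prop :=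
  ∃ h : ∀ i, S (v i),
    Realize (fun a b : {x : M // S x} => E a.1 b.1) φ fun i => ⟨v i, h i⟩

/-- `Δ₀`-formulas: formulas all of whose quantifiers are bounded. -/
inductive IsDelta0 : ∀ {n : ℕ}, SetFormula n → Prop
  | mem {n : ℕ} (i j : Fin n) : IsDelta0 (.mem i j)
  | eq {n : ℕ} (i j : Fin n) : IsDelta0 (.eq i j)
  | fal {n : ℕ} : IsDelta0 (n := n) .fal
  | imp {n : ℕ} {φ ψ : SetFormula n} : IsDelta0 φ → IsDelta0 ψ → IsDelta0 (φ.imp ψ)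
  | ball {n : ℕ} (j : Fin n) {φ : SetFormula (n + 1)} :
      IsDelta0 φ → IsDelta0 (.all ((SetFormula.mem (Fin.last n) j.castSucc).imp φ))
  | bex {n : ℕ} (j : Fin n) {φ : SetFormula (n + 1)} :
      IsDelta0 φ → IsDelta0 (SetFormula.ex ((SetFormula.mem (Fin.last n) j.castSucc).and φ))

mutual
  /-- `Σₙ`-formulas of the Lévy hierarchy. -/
  inductive IsSigma : ℕ → ∀ {n : ℕ}, SetFormula n → Prop
    | ofDelta0 {k n : ℕ} {φ : SetFormula n} : IsDelta0 φ → IsSigma k φ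
    | ofPi {k n : ℕ} {φ : SetFormula n} : IsPi k φ → IsSigma (k + 1) φ
    | ex {k n : ℕ} {φ : SetFormula (n + 1)} : IsSigma (k + 1) φ → IsSigma (k + 1) φ.ex
  /-- `Πₙ`-formulas of the Lévy hierarchy. -/
  inductive IsPi : ℕ → ∀ {n : ℕ}, SetFormula n → Prop
    | ofDelta0 {k n : ℕ} {φ : SetFormula n} : IsDelta0 φ → IsPi k φ
    | ofSigma {k n : ℕ} {φ : SetFormula n} : IsSigma k φ → IsPi (k + 1) φ
    | all {k n : ℕ} {φ : SetFormula (n + 1)} : IsPi (k + 1) φ → IsPi (k + 1) φ.all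
end

end Paper
namespace Paper

section Generic

variable {M : Type*} (E : M → M → Prop)

/-- `x` is a transitive set (relative to the membership relation `E`). -/
def TransE (x : M) : Prop := ∀ y, E y x → ∀ z, E z y → E z x

/-- `x` is an ordinal: a transitive set all of whose elements are transitive. -/
def OrdE (x : M) : Prop := TransE E x ∧ ∀ y, E y x → TransE E y

/-- `a ⊆ b`. -/
def SubE (a b : M) : Prop := ∀ z, E z a → E z b

/-- `a ≤ b` for ordinals. -/
def LeE (a b : M) : Prop := E a b ∨ a = b

/-- `x` is the empty set. -/
def EmptyE (x : M) : Prop := ∀ z, ¬ E z x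

/-- `s = y ∪ {y}`. -/
def SuccSpecE (s y : M) : Prop := ∀ z, E z s ↔ (E z y ∨ z = y)

/-- `l` is a (nonzero) limit ordinal. -/
def LimitE (l : M) : Prop := OrdE E l ∧ (∃ w, E w l) ∧ ∀ α, E α l → ∃ β, E β l ∧ E α β

/-- `w` is the first infinite ordinal `ω`. -/
def OmegaSpecE (w : M) : Prop := LimitE E w ∧ ∀ x, E x w → ¬ LimitE E x

/-- `x` is an infinite ordinal, i.e. an ordinal with `ω ≤ x`. -/
def InfiniteOrdE (x : M) : Prop := OrdE E x ∧ ∃ w, OmegaSpecE E w ∧ LeE E w x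

/-- `p = {a, b}`. -/
def UPairE (p a b : M) : Prop := ∀ z, E z p ↔ (z = a ∨ z = b)

/-- `p` is the Kuratowski ordered pair `⟨a, b⟩`. -/
def OPairE (p a b : M) : Prop :=
  ∃ s t, UPairE E s a a ∧ UPairE E t a b ∧ UPairE E p s t

/-- The ordered pair `⟨x, y⟩` is an element of `f`. -/
def PairMemE (f x y : M) : Prop := ∃ p, E p f ∧ OPairE E p x y

/-- `f` is (the graph of) a function from `a` to `b`. -/
def IsFuncE (f a b : M) : Prop :=
  (∀ p, E p f → ∃ x y, E x a ∧ E y b ∧ OPairE E p x y) ∧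
    ∀ x, E x a → (∃ y, PairMemE E f x y) ∧
      ∀ y y', PairMemE E f x y → PairMemE E f x y' → y = y'

/-- `f` is a surjection from `a` onto `b`. -/
def SurjE (f a b : M) : Prop :=
  IsFuncE E f a b ∧ ∀ y, E y b → ∃ x, E x a ∧ PairMemE E f x y

/-- `f` is an injection from `a` into `b`. -/
def InjE (f a b : M) : Prop :=
  IsFuncE E f a b ∧ ∀ x x' y, E x a → E x' a →
    PairMemE E f x y → PairMemE E f x' y → x = x'

/-- `f` is a bijection between `a` and `b`. -/
def BijE (f a b : M) : Prop := SurjE E f a b ∧ InjE E f a b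

/-- `κ` is a cardinal: an ordinal not in bijection with any of its elements. -/
def CardE (κ : M) : Prop := OrdE E κ ∧ ∀ α, E α κ → ¬ ∃ f, BijE E f α κ

/-- `κ` is an infinite cardinal. -/
def InfCardE (κ : M) : Prop := CardE E κ ∧ InfiniteOrdE E κ

/-- `b = a ∩ c`. -/
def InterSpecE (b a c : M) : Prop := ∀ z, E z b ↔ (E z a ∧ E z c)

/-- `c` is unbounded in the ordinal `κ`. -/
def UnboundedInE (c κ : M) : Prop := ∀ α, E α κ → ∃ β, E β c ∧ E α β

/-- `c` is closed in the ordinal `κ`: it contains each of its limit points below `κ`. -/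
def ClosedInE (c κ : M) : Prop :=
  ∀ l, E l κ → (∃ w, E w l) → (∀ α, E α l → ∃ β, E β c ∧ E α β ∧ E β l) → E l c

/-- `c` is a closed unbounded subset of the ordinal `κ`. -/
def ClubInE (c κ : M) : Prop := SubE E c κ ∧ UnboundedInE E c κ ∧ ClosedInE E c κ

/-- `f` is (the graph of) a sequence `⟨A_α | α < κ⟩` with `A_α ⊆ α` for all `α < κ`. -/
def SeqSpecE (f κ : M) : Prop :=
  ∀ α, E α κ → (∃ A, PairMemE E f α A ∧ SubE E A α) ∧
    ∀ A A', PairMemE E f α A → PairMemE E f α A' → A = A'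

/-- `κ` is a subtle cardinal. -/
def SubtleE (κ : M) : Prop :=
  InfCardE E κ ∧ ∀ f, SeqSpecE E f κ → ∀ c, ClubInE E c κ →
    ∃ α β, E α c ∧ E β c ∧ E α β ∧
      ∃ A B, PairMemE E f α A ∧ PairMemE E f β B ∧ InterSpecE E A B α

/-- `κ` is a regular ordinal: every function from an element of `κ` to `κ` has
bounded range. -/
def RegularE (κ : M) : Prop :=
  OrdE E κ ∧ ∀ γ f, E γ κ → IsFuncE E f γ κ →
    ∃ β, E β κ ∧ ∀ x y, PairMemE E f x y → E y β

/-- `p = 𝒫(a)`. -/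
def PowSpecE (p a : M) : Prop := ∀ z, E z p ↔ SubE E z a

/-- `κ` is a strong limit cardinal: for every `α < κ`, `2^|α| < κ`. -/
def StrongLimitE (κ : M) : Prop :=
  ∀ α, E α κ → ∀ p, PowSpecE E p α → ∃ β f, E β κ ∧ InjE E f p β

/-- `κ` is a strongly inaccessible cardinal: an uncountable regular strong limit
cardinal. -/
def InaccE (κ : M) : Prop :=
  CardE E κ ∧ (∃ w, OmegaSpecE E w ∧ E w κ) ∧ RegularE E κ ∧ StrongLimitE E κ

/-- `z` belongs to the transitive closure of `x`. -/
def TCMemE (z x : M) : Prop := ∀ t, TransE E t → SubE E x t → E z t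

/-- `x ∈ H(θ)`: the transitive closure of `x` has cardinality less than `θ`. -/
def HMemE (x θ : M) : Prop :=
  ∃ t, TransE E t ∧ SubE E x t ∧ ∃ β f, E β θ ∧ SurjE E f β t

/-- `f` is (the graph of) the cumulative-hierarchy sequence `⟨V_β | β < α⟩`,
determined by the recursion `V_β = {z | ∃ γ < β, z ⊆ V_γ}`. -/
def VHierE (f α : M) : Prop :=
  OrdE E α ∧ ∀ β, E β α →
    (∃ w, PairMemE E f β w ∧
      ∀ z, E z w ↔ ∃ γ, E γ β ∧ ∃ u, PairMemE E f γ u ∧ SubE E z u) ∧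
    ∀ w w', PairMemE E f β w → PairMemE E f β w' → w = w'

/-- `x ∈ V_α`. -/
def VMemE (x α : M) : Prop :=
  OrdE E α ∧ ∃ f, VHierE E f α ∧ ∃ β u, E β α ∧ PairMemE E f β u ∧ SubE E x u

/-- The class `S` is a `Σₙ`-elementary subclass of the class `T`. -/
def SigmaElemPairE (n : ℕ) (S T : M → Prop) : Prop :=
  (∀ x, S x → T x) ∧
    ∀ ⦃k : ℕ⦄ (φ : SetFormula k), IsSigma n φ → ∀ v : Fin k → M, (∀ i, S (v i)) →
      (RealizeIn E S φ v ↔ RealizeIn E T φ v)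

/-- The class `S` is a (fully) elementary subclass of the class `T`. -/
def ElemPairE (S T : M → Prop) : Prop :=
  (∀ x, S x → T x) ∧
    ∀ ⦃k : ℕ⦄ (φ : SetFormula k) (v : Fin k → M), (∀ i, S (v i)) →
      (RealizeIn E S φ v ↔ RealizeIn E T φ v)

/-- `j` is an elementary map from the class `S` into the class `T`. -/
def ElemMapE (S T : M → Prop) (j : M → M) : Prop :=
  (∀ x, S x → T (j x)) ∧
    ∀ ⦃k : ℕ⦄ (φ : SetFormula k) (v : Fin k → M), (∀ i, S (v i)) →
      (RealizeIn E S φ v ↔ RealizeIn E T φ fun i => j (v i))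

/-- `α ∈ C⁽ⁿ⁾`: the ordinal `α` is `Σₙ`-correct, i.e. `V_α` is a `Σₙ`-elementary
submodel of the universe. -/
def CnE (n : ℕ) (α : M) : Prop :=
  OrdE E α ∧ SigmaElemPairE E n (fun x => VMemE E x α) fun _ => True

/-- `κ` is a weakly shrewd cardinal. -/
def WeaklyShrewdE (κ : M) : Prop :=
  CardE E κ ∧ ∀ (φ : SetFormula 2) (θ z : M), CardE E θ → E κ θ → SubE E z κ →
    RealizeIn E (fun x => HMemE E x θ) φ ![z, κ] →
    ∃ κ' θ' z', CardE E κ' ∧ CardE E θ' ∧ E κ' θ' ∧ E κ' κ ∧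
      InterSpecE E z' z κ' ∧ RealizeIn E (fun x => HMemE E x θ') φ ![z', κ']

/-- `κ` is a `C⁽ⁿ⁾`-weakly shrewd cardinal. -/
def CnWeaklyShrewdE (n : ℕ) (κ : M) : Prop :=
  CardE E κ ∧ ∀ (φ : SetFormula 2) (θ z : M), CardE E θ → CnE E n θ → E κ θ →
    SubE E z κ → RealizeIn E (fun x => HMemE E x θ) φ ![z, κ] →
    ∃ κ' θ' z', CardE E κ' ∧ CardE E θ' ∧ CnE E n θ' ∧ E κ' θ' ∧ E κ' κ ∧
      InterSpecE E z' z κ' ∧ RealizeIn E (fun x => HMemE E x θ') φ ![z', κ']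

/-- Axiom of extensionality for `(M, E)`. -/
def AxExtE : Prop := ∀ x y : M, (∀ z, E z x ↔ E z y) → x = y

/-- Axiom of pairing for `(M, E)`. -/
def AxPairE : Prop := ∀ a b : M, ∃ p, UPairE E p a b

/-- Axiom of union for `(M, E)`. -/
def AxUnionE : Prop := ∀ a : M, ∃ u, ∀ z, E z u ↔ ∃ y, E y a ∧ E z y

/-- Axiom of power set for `(M, E)`. -/
def AxPowE : Prop := ∀ a : M, ∃ p, PowSpecE E p a

/-- Axiom of infinity for `(M, E)`. -/
def AxInfE : Prop :=
  ∃ I : M, (∃ e, E e I ∧ EmptyE E e) ∧ ∀ y, E y I → ∃ s, E s I ∧ SuccSpecE E s y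

/-- Axiom of foundation for `(M, E)`. -/
def AxFoundE : Prop :=
  ∀ a : M, (∃ z, E z a) → ∃ m, E m a ∧ ∀ z, E z a → ¬ E z m

/-- Separation scheme for `(M, E)`. -/
def AxSepE : Prop :=
  ∀ (k : ℕ) (φ : SetFormula (k + 1)) (p : Fin k → M) (a : M),
    ∃ s : M, ∀ z, E z s ↔ (E z a ∧ Realize E φ (Fin.cons z p))

/-- Replacement scheme for `(M, E)`. -/
def AxReplE : Prop :=
  ∀ (k : ℕ) (φ : SetFormula (k + 2)) (p : Fin k → M) (a : M),
    (∀ x, E x a → ∀ y y', Realize E φ (Fin.cons x (Fin.cons y p)) →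
      Realize E φ (Fin.cons x (Fin.cons y' p)) → y = y') →
    ∃ b : M, ∀ y, E y b ↔ ∃ x, E x a ∧ Realize E φ (Fin.cons x (Fin.cons y p))

/-- Axiom of choice for `(M, E)`. -/
def AxChoiceE : Prop :=
  ∀ a : M, (∀ x, E x a → ∃ z, E z x) →
    (∀ x y, E x a → E y a → x ≠ y → ¬ ∃ z, E z x ∧ E z y) →
    ∃ c, ∀ x, E x a → ∃ z, E z c ∧ E z x ∧ ∀ z', E z' c → E z' x → z' = z

/-- `(M, E)` is a model of `ZF⁻` (Zermelo–Fraenkel set theory without the power set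
axiom). -/
def IsZFMinusE : Prop :=
  AxExtE E ∧ AxPairE E ∧ AxUnionE E ∧ AxInfE E ∧ AxFoundE E ∧ AxSepE E ∧ AxReplE E

/-- `(M, E)` is a model of `ZFC`. -/
def IsZFCE : Prop :=
  Nonempty M ∧ IsZFMinusE E ∧ AxPowE E ∧ AxChoiceE E

/-- The set `m` is, with the induced membership relation, a transitive model
of `ZF⁻`. -/
def ZFMinusModelE (m : M) : Prop :=
  IsZFMinusE fun a b : {x : M // E x m} => E a.1 b.1

/-- `x` has cardinality `κ`. -/
def CardEqE (x κ : M) : Prop := ∃ f, BijE E f κ x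

/-- `m` is closed under sequences of length less than `κ`: `^{<κ}m ⊆ m`. -/
def SmallSeqClosedE (m κ : M) : Prop := ∀ γ f, E γ κ → IsFuncE E f γ m → E f m

/-- `κ` is a `C⁽ⁿ⁾`-strongly unfoldable cardinal. -/
def CnStronglyUnfoldableE (n : ℕ) (κ : M) : Prop :=
  InaccE E κ ∧ ∀ lam, CnE E n lam → E κ lam →
    ∀ m, TransE E m → ZFMinusModelE E m → CardEqE E m κ → E κ m →
      SmallSeqClosedE E m κ →
      ∃ N j κ', TransE E N ∧ (∀ x, VMemE E x lam → E x N) ∧ IsFuncE E j m N ∧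
        (∀ ⦃k : ℕ⦄ (φ : SetFormula k) (v w : Fin k → M), (∀ i, E (v i) m) →
          (∀ i, PairMemE E j (v i) (w i)) →
          (RealizeIn E (fun x => E x m) φ v ↔ RealizeIn E (fun x => E x N) φ w)) ∧
        (∀ α, E α κ → PairMemE E j α α) ∧ PairMemE E j κ κ' ∧ E lam κ' ∧
        SigmaElemPairE E n (fun x => VMemE E x lam) fun x => E x N ∧ VMemE E x κ'

/-- `x` is ordinal definable. -/
def IsODE (x : M) : Prop :=
  ∃ (k : ℕ) (φ : SetFormula (k + 1)) (p : Fin k → M), (∀ i, OrdE E (p i)) ∧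
    Realize E φ (Fin.cons x p) ∧ ∀ y, Realize E φ (Fin.cons y p) → y = x

/-- `x` is hereditarily ordinal definable, i.e. `x ∈ HOD`. -/
def IsHODE (x : M) : Prop := IsODE E x ∧ ∀ z, TCMemE E z x → IsODE E z

/-- The instance of the principle "`Ord` is essentially faint" for the class
sequence `⟨{A | Efam α A} | α ∈ Ord⟩`. -/
def FaintForE (Efam : M → M → Prop) : Prop :=
  (∀ α, OrdE E α → (∃ A, Efam α A) ∧ ∀ A, Efam α A → SubE E A α) →
    ∀ ξ, OrdE E ξ → ∃ α β A B, OrdE E α ∧ OrdE E β ∧ E ξ α ∧ E α β ∧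
      Efam β A ∧ InterSpecE E B A α ∧ Efam α B

/-- `C` is a closed unbounded class of ordinals. -/
def ClubClassE (C : M → Prop) : Prop :=
  (∀ x, C x → OrdE E x) ∧ (∀ α, OrdE E α → ∃ β, C β ∧ E α β) ∧
    ∀ l, OrdE E l → (∃ w, E w l) → (∀ α, E α l → ∃ β, C β ∧ E α β ∧ E β l) → C l

/-- The instance of the principle "`Ord` is essentially subtle" for the class
sequence `⟨{A | Efam α A} | α ∈ Ord⟩` and the class `C`. -/
def SubtleForE (Efam : M → M → Prop) (C : M → Prop) : Prop :=
  (∀ α, OrdE E α → (∃ A, Efam α A) ∧ ∀ A, Efam α A → SubE E A α) →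
    ClubClassE E C →
    ∃ α β A B, C α ∧ C β ∧ E α β ∧ Efam β A ∧ InterSpecE E B A α ∧ Efam α B

/-- The scheme "`Ord` is essentially faint" holds in `(M, E)`: every instance for a
definable (with parameters) class sequence holds. -/
def OrdFaintDefE : Prop :=
  ∀ (k : ℕ) (φ : SetFormula (k + 2)) (p : Fin k → M),
    FaintForE E fun α A => Realize E φ (Fin.cons α (Fin.cons A p))

/-- The scheme "`Ord` is essentially subtle" holds in `(M, E)`: every instance for
definable (with parameters) class sequences and club classes holds. -/
def OrdSubtleDefE : Prop :=
  ∀ (k k' : ℕ) (φ : SetFormula (k + 2)) (p : Fin k → M)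
    (ψ : SetFormula (k' + 1)) (q : Fin k' → M),
    SubtleForE E (fun α A => Realize E φ (Fin.cons α (Fin.cons A p)))
      fun x => Realize E ψ (Fin.cons x q)

/-- There is a proper class of subtle cardinals in `(M, E)`. -/
def ProperClassSubtleE : Prop := ∀ α, OrdE E α → ∃ κ, SubtleE E κ ∧ E α κ

/-- There are no strongly inaccessible cardinals in `(M, E)`. -/
def NoInaccE : Prop := ∀ κ, ¬ InaccE E κ

end Generic

end Paper

namespace Paper

/-- Renaming of variables in formulas. -/
def SetFormula.ren : ∀ {n m : ℕ}, (Fin n → Fin m) → SetFormula n → SetFormula m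
  | _, _, f, .mem i j => .mem (f i) (f j)
  | _, _, f, .eq i j => .eq (f i) (f j)
  | _, _, _, .fal => .fal
  | _, _, f, .imp φ ψ => .imp (φ.ren f) (ψ.ren f)
  | _, m, f, .all φ =>
      .all (φ.ren (Fin.snoc (α := fun _ => Fin (m + 1)) (fun j => (f j).castSucc) (Fin.last m)))

theorem realize_ren {M : Type} (E : M → M → Prop) {n : ℕ} (φ : SetFormula n) :
    ∀ {m : ℕ} (f : Fin n → Fin m) (v : Fin m → M),
      Realize E (φ.ren f) v ↔ Realize E φ (fun i => v (f i)) := by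
  induction φ with
  | mem i j => intros; rfl
  | eq i j => intros; rfl
  | fal => intros; rfl
  | imp φ ψ h1 h2 => intro m f v; simp only [SetFormula.ren, Realize, h1, h2]
  | all φ ih =>
    intro m f v
    simp only [SetFormula.ren, Realize, ih]
    refine forall_congr' fun a => ?_
    have : (fun i => (Fin.snoc v a : Fin (m+1) → M)
        ((Fin.snoc (α := fun _ => Fin (m + 1)) (fun j => (f j).castSucc) (Fin.last m) : _ → _) i))
        = (Fin.snoc (fun i => v (f i)) a : _ → M) := by
      funext i
      refine Fin.lastCases ?_ (fun j => ?_) i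
      · simp
      · simp
    rw [this]

/-- A model of ZFC. -/
class SetModel (M : Type) where
  E : M → M → Prop
  zfc : IsZFCE E

infix:50 "∈ₘ" => SetModel.E

set_option linter.unusedSectionVars false
set_option linter.unusedVariables false

section Dfn
variable {M : Type} [SetModel M]

/-- first variable -/
def hd (g : ℕ → M) : M := g 0
/-- remaining variables -/
def tl (g : ℕ → M) : ℕ → M := fun n => g (n + 1)
/-- push a variable -/
def psh (a : M) (g : ℕ → M) : ℕ → M := fun n => Nat.casesOn n a g

@[simp] theorem hd_psh (a : M) (g : ℕ → M) : hd (psh a g) = a := rfl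
@[simp] theorem tl_psh (a : M) (g : ℕ → M) : tl (psh a g) = g := rfl

/-- Definable (with parameters) predicates of environments. -/
class Def (P : (ℕ → M) → Prop) : Prop where
  out : ∃ (n : ℕ) (φ : SetFormula n) (ts : Fin n → M ⊕ ℕ),
    ∀ g, P g ↔ Realize SetModel.E φ (fun i => (ts i).elim id g)

theorem Def.congr {P Q : (ℕ → M) → Prop} (hP : Def P) (h : ∀ g, Q g ↔ P g) : Def Q := by
  have : Q = P := funext fun g => propext (h g)
  rw [this]; exact hP

instance defImp {P Q : (ℕ → M) → Prop} [hP : Def P] [hQ : Def Q] : Def (fun g => P g → Q g) := by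
  obtain ⟨n, φ, ts, h⟩ := hP.out
  obtain ⟨m, ψ, us, k⟩ := hQ.out
  refine ⟨n + m, .imp (φ.ren (Fin.castAdd m)) (ψ.ren (Fin.natAdd n)), Fin.append ts us, fun g => ?_⟩
  simp only [Realize, realize_ren, Fin.append_left, Fin.append_right, h, k]

instance defConst {p : Prop} : Def (M := M) (fun _ => p) := by
  by_cases h : p
  · exact ⟨0, .imp .fal .fal, Fin.elim0, fun g => by simp [Realize, h]⟩
  · exact ⟨0, .fal, Fin.elim0, fun g => by simp [Realize, h]⟩

instance defNot {P : (ℕ → M) → Prop} [Def P] : Def (fun g => ¬ P g) :=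
  (inferInstance : Def (fun g => P g → False))

instance defAnd {P Q : (ℕ → M) → Prop} [Def P] [Def Q] : Def (fun g => P g ∧ Q g) :=
  (inferInstance : Def (fun g => ¬ (P g → ¬ Q g))).congr fun g => by tauto

instance defOr {P Q : (ℕ → M) → Prop} [Def P] [Def Q] : Def (fun g => P g ∨ Q g) :=
  (inferInstance : Def (fun g => ¬ P g → Q g)).congr fun g => by tauto

instance defIff {P Q : (ℕ → M) → Prop} [Def P] [Def Q] : Def (fun g => P g ↔ Q g) :=
  (inferInstance : Def (fun g => (P g → Q g) ∧ (Q g → P g))).congr fun g => by tauto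

theorem defAll' {P : (ℕ → M) → Prop} (h : Def P) : Def (fun g => ∀ a, P (psh a g)) := by
  obtain ⟨n, φ, ts, h⟩ := h.out
  classical
  let f : Fin n → Fin (n + 1) := fun i => if ts i = .inr 0 then Fin.last n else i.castSucc
  let us : Fin n → M ⊕ ℕ := fun i => (ts i).elim .inl (fun k => .inr (k - 1))
  refine ⟨n, .all (φ.ren f), us, fun g => ?_⟩
  simp only [Realize, realize_ren, h]
  refine forall_congr' fun a => ?_
  have : (fun i => Sum.elim id (psh a g) (ts i))
      = fun i => (Fin.snoc (fun i => Sum.elim id g (us i)) a : Fin (n+1) → M) (f i) := by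
    funext i
    by_cases hi : ts i = .inr 0
    · simp [f, hi, psh]
    · simp only [f, hi, if_false, Fin.snoc_castSucc, us]
      rcases hti : ts i with c | k
      · simp
      · cases k with
        | zero => exact absurd hti hi
        | succ k => simp [psh]
  rw [this]

instance defAll {P : (ℕ → M) → M → Prop} [h : Def (fun g => P (tl g) (hd g))] :
    Def (fun g => ∀ a, P g a) := defAll' h

instance defEx {P : (ℕ → M) → M → Prop} [h : Def (fun g => P (tl g) (hd g))] :
    Def (fun g => ∃ a, P g a) :=
  (inferInstance : Def (fun g => ¬ ∀ a, ¬ P g a)).congr fun g => by push Not; rfl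

/-- substitution of variables and constants -/
theorem Def.sub {P : (ℕ → M) → Prop} (h : Def P) (f : ℕ → M ⊕ ℕ) :
    Def (fun g => P (fun i => (f i).elim id g)) := by
  obtain ⟨n, φ, ts, h⟩ := h.out
  refine ⟨n, φ, fun i => (ts i).elim .inl f, fun g => ?_⟩
  rw [h]
  have : (fun i => Sum.elim id (fun i => Sum.elim id g (f i)) (ts i)) =
      fun i => Sum.elim id g ((fun i => Sum.elim Sum.inl f (ts i)) i) := by
    funext i; rcases hti : ts i with c | k <;> simp [hti]
  rw [this]

theorem Def.mapv {P : (ℕ → M) → Prop} (h : Def P) (f : ℕ → ℕ) :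
    Def (fun g => P (fun i => g (f i))) := h.sub (fun i => .inr (f i))

/-- Definable terms. -/
class Tm (t : (ℕ → M) → M) : Prop where
  out : Def (fun g => hd g = t (tl g))

class Vr (v : (ℕ → M) → (ℕ → M)) : Prop where
  out : ∃ k, ∀ g i, v g i = g (i + k)

instance vrId : Vr (M := M) (fun g => g) := ⟨0, fun _ _ => rfl⟩
instance vrTl0 : Vr (M := M) tl := ⟨1, fun _ _ => rfl⟩
instance vrTl {v : (ℕ → M) → (ℕ → M)} [h : Vr v] : Vr (fun g => tl (v g)) := by
  obtain ⟨k, hk⟩ := h.out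
  exact ⟨k + 1, fun g i => by simp only [tl, hk]; congr 1; omega⟩

theorem defVarEq (i j : ℕ) : Def (M := M) (fun g => g i = g j) :=
  ⟨2, .eq 0 1, ![.inr i, .inr j], fun g => by simp [Realize]⟩
theorem defVarMem (i j : ℕ) : Def (M := M) (fun g => g i ∈ₘ g j) :=
  ⟨2, .mem 0 1, ![.inr i, .inr j], fun g => by simp [Realize]⟩

instance tmVar {v : (ℕ → M) → (ℕ → M)} [h : Vr v] : Tm (fun g => hd (v g)) := by
  obtain ⟨k, hk⟩ := h.out
  refine ⟨(defVarEq 0 (k + 1)).congr fun g => ?_⟩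
  simp [hd, hk, tl]

instance tmHd : Tm (M := M) (fun g => hd g) := tmVar (v := fun g => g)
instance tmHd' : Tm (M := M) hd := tmVar (v := fun g => g)

instance tmConst {c : M} : Tm (fun _ => c) :=
  ⟨1 + 1, .eq 0 1, ![.inr 0, .inl c], fun g => by simp [Realize, hd]⟩

/-- Definable unary predicates. -/
class D1 (P : M → Prop) : Prop where
  out : Def (fun g => P (hd g))
class D2 (P : M → M → Prop) : Prop where
  out : Def (fun g => P (hd g) (hd (tl g)))
class D3 (P : M → M → M → Prop) : Prop where
  out : Def (fun g => P (hd g) (hd (tl g)) (hd (tl (tl g))))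
class D4 (P : M → M → M → M → Prop) : Prop where
  out : Def (fun g => P (hd g) (hd (tl g)) (hd (tl (tl g))) (hd (tl (tl (tl g)))))
class F1 (f : M → M) : Prop where
  out : Tm (fun g => f (hd g))
class F2 (f : M → M → M) : Prop where
  out : Tm (fun g => f (hd g) (hd (tl g)))
class F3 (f : M → M → M → M) : Prop where
  out : Tm (fun g => f (hd g) (hd (tl g)) (hd (tl (tl g))))

theorem Def.ex' {P : (ℕ → M) → Prop} (h : Def P) : Def (fun g => ∃ a, P (psh a g)) := by
  have := @defEx M _ (fun g a => P (psh a g)) (by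
    refine h.congr fun g => ?_
    have : psh (hd g) (tl g) = g := by funext i; cases i <;> rfl
    rw [this])
  exact this

theorem Tm.mapv {t : (ℕ → M) → M} (h : Tm t) (f : ℕ → ℕ) :
    Tm (fun g => t (fun i => g (f i))) := by
  refine ⟨(h.out.mapv (fun i => Nat.casesOn i 0 (fun k => f k + 1))).congr fun g => ?_⟩
  rfl

instance defD1 {P : M → Prop} {t : (ℕ → M) → M} [h : D1 P] [ht : Tm t] :
    Def (fun g => P (t g)) := by
  have h1 := h.out.mapv (fun _ => 0)
  have h2 := ht.out
  have h3 : Def (fun g => hd g = t (tl g) ∧ P (hd g)) :=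
    @defAnd _ _ _ _ h2 h1
  exact h3.ex'.congr fun g => by simp

instance defD2 {P : M → M → Prop} {s t : (ℕ → M) → M} [h : D2 P] [hs : Tm s] [ht : Tm t] :
    Def (fun g => P (s g) (t g)) := by
  have : ∀ a, D1 (fun b => P a b) := fun a =>
    ⟨(h.out.sub (fun i => Nat.casesOn i (.inl a) (fun k => .inr k))).congr fun g => by rfl⟩
  have h1 := h.out
  have h3 : Def (fun g => hd (tl g) = s (tl (tl g)) ∧ hd g = t (tl (tl g)) ∧ P (hd (tl g)) (hd g)) := by
    refine @defAnd _ _ _ _ ?_ (@defAnd _ _ _ _ ?_ ?_)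
    · exact hs.out.mapv (fun i => i + 1)
    · exact ht.out.mapv (fun i => Nat.casesOn i 0 (fun k => k + 2))
    · exact h1.mapv (fun i => Nat.casesOn i 1 (fun k => 0))
  exact h3.ex'.ex'.congr fun g => by simp

instance defD3 {P : M → M → M → Prop} {s t u : (ℕ → M) → M} [h : D3 P] [hs : Tm s] [ht : Tm t]
    [hu : Tm u] : Def (fun g => P (s g) (t g) (u g)) := by
  have h3 : Def (fun g => hd (tl (tl g)) = s (tl (tl (tl g))) ∧ hd (tl g) = t (tl (tl (tl g))) ∧
      hd g = u (tl (tl (tl g))) ∧ P (hd (tl (tl g))) (hd (tl g)) (hd g)) := by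
    refine @defAnd _ _ _ _ ?_ (@defAnd _ _ _ _ ?_ (@defAnd _ _ _ _ ?_ ?_))
    · exact hs.out.mapv (fun i => i + 2)
    · exact ht.out.mapv (fun i => Nat.casesOn i 1 (fun k => k + 3))
    · exact hu.out.mapv (fun i => Nat.casesOn i 0 (fun k => k + 3))
    · exact h.out.mapv (fun i => 2 - i)
  exact h3.ex'.ex'.ex'.congr fun g => by simp

instance defD4 {P : M → M → M → M → Prop} {s t u w : (ℕ → M) → M} [h : D4 P] [hs : Tm s] [ht : Tm t]
    [hu : Tm u] [hw : Tm w] : Def (fun g => P (s g) (t g) (u g) (w g)) := by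
  have h3 : Def (fun g => hd (tl (tl (tl g))) = s (tl (tl (tl (tl g)))) ∧
      hd (tl (tl g)) = t (tl (tl (tl (tl g)))) ∧ hd (tl g) = u (tl (tl (tl (tl g)))) ∧
      hd g = w (tl (tl (tl (tl g)))) ∧
      P (hd (tl (tl (tl g)))) (hd (tl (tl g))) (hd (tl g)) (hd g)) := by
    refine @defAnd _ _ _ _ ?_ (@defAnd _ _ _ _ ?_ (@defAnd _ _ _ _ ?_ (@defAnd _ _ _ _ ?_ ?_)))
    · exact hs.out.mapv (fun i => i + 3)
    · exact ht.out.mapv (fun i => Nat.casesOn i 2 (fun k => k + 4))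
    · exact hu.out.mapv (fun i => Nat.casesOn i 1 (fun k => k + 4))
    · exact hw.out.mapv (fun i => Nat.casesOn i 0 (fun k => k + 4))
    · exact h.out.mapv (fun i => 3 - i)
  exact h3.ex'.ex'.ex'.ex'.congr fun g => by simp

instance d2Eq : D2 (M := M) (fun a b => a = b) := ⟨defVarEq 0 1⟩
instance d2Mem : D2 (M := M) SetModel.E := ⟨defVarMem 0 1⟩

instance defEq {s t : (ℕ → M) → M} [Tm s] [Tm t] : Def (fun g => s g = t g) :=
  defD2 (P := fun a b => a = b)
instance defMem {s t : (ℕ → M) → M} [Tm s] [Tm t] : Def (fun g => s g ∈ₘ t g) :=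
  defD2 (P := SetModel.E)

theorem Tm.shift {t : (ℕ → M) → M} (h : Tm t) : Tm (fun g => t (tl g)) := h.mapv (fun i => i + 1)

instance tmF1 {f : M → M} {t : (ℕ → M) → M} [h : F1 f] [ht : Tm t] : Tm (fun g => f (t g)) := by
  have hD : D2 (fun a b => a = f b) := ⟨h.out.out.congr fun g => by rfl⟩
  have := ht.shift
  exact ⟨defD2 (P := fun a b => a = f b) (s := fun g => hd g) (t := fun g => t (tl g))⟩

instance tmF2 {f : M → M → M} {s t : (ℕ → M) → M} [h : F2 f] [hs : Tm s] [ht : Tm t] :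
    Tm (fun g => f (s g) (t g)) := by
  have hD : D3 (fun a b c => a = f b c) := ⟨h.out.out.congr fun g => by rfl⟩
  have := ht.shift
  have := hs.shift
  exact ⟨defD3 (P := fun a b c => a = f b c) (s := fun g => hd g) (t := fun g => s (tl g))
    (u := fun g => t (tl g))⟩

instance tmF3 {f : M → M → M → M} {s t u : (ℕ → M) → M} [h : F3 f] [hs : Tm s] [ht : Tm t]
    [hu : Tm u] : Tm (fun g => f (s g) (t g) (u g)) := by
  have hD : D4 (fun a b c d => a = f b c d) := ⟨h.out.out.congr fun g => by rfl⟩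
  have := ht.shift
  have := hs.shift
  have := hu.shift
  exact ⟨defD4 (P := fun a b c d => a = f b c d) (s := fun g => hd g) (t := fun g => s (tl g))
    (u := fun g => t (tl g)) (w := fun g => u (tl g))⟩

instance tmIte {P : (ℕ → M) → Prop} {s t : (ℕ → M) → M} [∀ g, Decidable (P g)] [hP : Def P] [hs : Tm s] [ht : Tm t] :
    Tm (fun g => if P g then s g else t g) := by
  have h1 := hP.mapv (fun i => i + 1)
  have h3 : Def (fun g => (P (tl g) ∧ hd g = s (tl g)) ∨ (¬ P (tl g) ∧ hd g = t (tl g))) :=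
    @defOr _ _ _ _ (@defAnd _ _ _ _ h1 hs.out) (@defAnd _ _ _ _ (@defNot _ _ _ h1) ht.out)
  refine ⟨h3.congr fun g => ?_⟩
  by_cases h : P (tl g) <;> simp [h]

/-- fix the remaining variables -/
theorem Def.fix {P : (ℕ → M) → M → Prop} (h : Def (fun g => P (tl g) (hd g))) (g : ℕ → M) :
    Def (fun k : ℕ → M => P g (hd k)) :=
  (h.sub (fun i => Nat.casesOn i (.inr 0) (fun k => .inl (g k)))).congr fun k => by rfl

theorem Def.fix2 {P : (ℕ → M) → M → M → Prop} (h : Def (fun g => P (tl (tl g)) (hd (tl g)) (hd g)))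
    (g : ℕ → M) : Def (fun k : ℕ → M => P g (hd (tl k)) (hd k)) :=
  (h.sub (fun i => Nat.casesOn i (.inr 0) (fun k => Nat.casesOn k (.inr 1)
    (fun k => .inl (g k))))).congr fun k => by rfl

theorem Tm.fix {t : (ℕ → M) → M → M} (h : Tm (fun g => t (tl g) (hd g))) (g : ℕ → M) :
    Tm (fun k : ℕ → M => t g (hd k)) :=
  ⟨(h.out.sub (fun i => Nat.casesOn i (.inr 0) (fun k => Nat.casesOn k (.inr 1)
    (fun k => .inl (g k))))).congr fun k => by rfl⟩

instance d2_SubE : D2 (M := M) (SubE SetModel.E) := ⟨by unfold SubE; infer_instance⟩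
instance d1_TransE : D1 (M := M) (TransE SetModel.E) := ⟨by unfold TransE; infer_instance⟩
instance d1_OrdE : D1 (M := M) (OrdE SetModel.E) := ⟨by unfold OrdE; infer_instance⟩
instance d2_LeE : D2 (M := M) (LeE SetModel.E) := ⟨by unfold LeE; infer_instance⟩
instance d1_EmptyE : D1 (M := M) (EmptyE SetModel.E) := ⟨by unfold EmptyE; infer_instance⟩
instance d2_SuccSpecE : D2 (M := M) (SuccSpecE SetModel.E) := ⟨by unfold SuccSpecE; infer_instance⟩
instance d1_LimitE : D1 (M := M) (LimitE SetModel.E) := ⟨by unfold LimitE; infer_instance⟩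
instance d1_OmegaSpecE : D1 (M := M) (OmegaSpecE SetModel.E) := ⟨by unfold OmegaSpecE; infer_instance⟩
instance d3_UPairE : D3 (M := M) (UPairE SetModel.E) := ⟨by unfold UPairE; infer_instance⟩
instance d3_OPairE : D3 (M := M) (OPairE SetModel.E) := ⟨by unfold OPairE; infer_instance⟩
instance d3_PairMemE : D3 (M := M) (PairMemE SetModel.E) := ⟨by unfold PairMemE; infer_instance⟩
instance d3_IsFuncE : D3 (M := M) (IsFuncE SetModel.E) := ⟨by unfold IsFuncE; infer_instance⟩
instance d3_InterSpecE : D3 (M := M) (InterSpecE SetModel.E) := ⟨by unfold InterSpecE; infer_instance⟩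
instance d2_PowSpecE : D2 (M := M) (PowSpecE SetModel.E) := ⟨by unfold PowSpecE; infer_instance⟩

end Dfn
end Paper


namespace Paper
set_option linter.unusedSectionVars false
set_option linter.unusedVariables false
set_option linter.unusedSimpArgs false

notation "sb" => SubE SetModel.E
notation "Od" => OrdE SetModel.E
notation "Lm" => LimitE SetModel.E

section Basic
variable {M : Type} [SetModel M]

theorem m_ne : Nonempty M := (SetModel.zfc (M := M)).1
theorem ext {x y : M} (h : ∀ z, z ∈ₘ x ↔ z ∈ₘ y) : x = y := (SetModel.zfc (M := M)).2.1.1 x y h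

/-- an arbitrary element -/
noncomputable def em0 : M := Classical.choice m_ne

theorem Def.one {P : M → Prop} (h : Def (fun g => P (hd g))) :
    ∃ (k : ℕ) (φ : SetFormula (k + 1)) (p : Fin k → M), ∀ z, P z ↔ Realize SetModel.E φ (Fin.cons z p) := by
  obtain ⟨n, φ, ts, h⟩ := h.out
  classical
  let f : Fin n → Fin (n + 1) := fun i => if ts i = .inr 0 then 0 else i.succ
  let p : Fin n → M := fun i => (ts i).elim id (fun _ => em0)
  refine ⟨n, φ.ren f, p, fun z => ?_⟩
  have h1 := h (psh z (fun _ => em0))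
  simp only [hd_psh] at h1
  rw [h1, realize_ren]
  have : (fun i => Sum.elim id (psh z fun _ => em0) (ts i)) = fun i => (Fin.cons z p : Fin (n+1) → M) (f i) := by
    funext i
    by_cases hi : ts i = .inr 0
    · simp [f, hi, psh]
    · simp only [f, hi, if_false, Fin.cons_succ, p]
      rcases hti : ts i with c | k
      · simp
      · cases k with
        | zero => exact absurd hti hi
        | succ k => simp [psh]
  rw [this]

theorem Def.two {P : M → M → Prop} (h : Def (fun g => P (hd g) (hd (tl g)))) :
    ∃ (k : ℕ) (φ : SetFormula (k + 2)) (p : Fin k → M),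
      ∀ z w, P z w ↔ Realize SetModel.E φ (Fin.cons z (Fin.cons w p)) := by
  obtain ⟨n, φ, ts, h⟩ := h.out
  classical
  let f : Fin n → Fin (n + 2) := fun i => if ts i = .inr 0 then 0 else if ts i = .inr 1 then 1 else i.succ.succ
  let p : Fin n → M := fun i => (ts i).elim id (fun _ => em0)
  refine ⟨n, φ.ren f, p, fun z w => ?_⟩
  have h1 := h (psh z (psh w (fun _ => em0)))
  simp only [hd_psh, tl_psh] at h1
  rw [h1, realize_ren]
  have : (fun i => Sum.elim id (psh z (psh w fun _ => em0)) (ts i))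
      = fun i => (Fin.cons z (Fin.cons w p) : Fin (n+2) → M) (f i) := by
    funext i
    by_cases hi : ts i = .inr 0
    · simp [f, hi, psh]
    · by_cases hi' : ts i = .inr 1
      · simp only [f, hi', psh]
        simp
        rfl
      simp only [f, hi, hi', if_false, Fin.cons_succ, p]
      rcases hti : ts i with c | k
      · simp
      · rcases k with _ | _ | k
        · exact absurd hti hi
        · exact absurd hti hi'
        · simp [psh]
  rw [this]

theorem D2.of_realize {k : ℕ} (φ : SetFormula (k + 2)) (p : Fin k → M) :
    D2 (fun z w => Realize SetModel.E φ (Fin.cons z (Fin.cons w p))) := by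
  refine ⟨k + 2, φ, Fin.cons (.inr 0) (Fin.cons (.inr 1) fun i => .inl (p i)), fun g => ?_⟩
  have : (Fin.cons (hd g) (Fin.cons (hd (tl g)) p) : Fin (k+2) → M) =
    (fun i => Sum.elim id g ((Fin.cons (.inr 0) (Fin.cons (.inr 1) fun i => .inl (p i)) : Fin (k+2) → M ⊕ ℕ) i)) := by
    funext i
    refine Fin.cases rfl (fun i => ?_) i
    refine Fin.cases rfl (fun i => rfl) i
  rw [this]

theorem D1.of_realize {k : ℕ} (φ : SetFormula (k + 1)) (p : Fin k → M) :
    D1 (fun z => Realize SetModel.E φ (Fin.cons z p)) := by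
  refine ⟨k + 1, φ, Fin.cons (.inr 0) fun i => .inl (p i), fun g => ?_⟩
  have : (Fin.cons (hd g) p : Fin (k+1) → M) =
    (fun i => Sum.elim id g ((Fin.cons (.inr 0) fun i => .inl (p i) : Fin (k+1) → M ⊕ ℕ) i)) := by
    funext i
    refine Fin.cases rfl (fun i => rfl) i
  rw [this]

theorem Def.mapOne {P : M → Prop} (h : Def (fun g => P (hd g))) : D1 P := ⟨h⟩

open Classical in
/-- definite description -/
noncomputable def dsc (P : M → Prop) : M := if h : ∃ x, P x ∧ ∀ y, P y → y = x then h.choose else em0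

theorem dsc_spec {P : M → Prop} (h : ∃ x, P x) (h' : ∀ x y, P x → P y → x = y) : P (dsc P) := by
  obtain ⟨x, hx⟩ := h
  have H : ∃ x, P x ∧ ∀ y, P y → y = x := ⟨x, hx, fun y hy => h' y x hy hx⟩
  unfold dsc; rw [dif_pos H]; exact H.choose_spec.1

theorem dsc_eq {P : M → Prop} {x : M} (h : P x) (h' : ∀ y, P y → y = x) : dsc P = x :=
  h' _ (dsc_spec ⟨x, h⟩ fun a b ha hb => (h' a ha).trans (h' b hb).symm)

instance tmDsc {P : (ℕ → M) → M → Prop} [hP : Def (fun g => P (tl g) (hd g))] :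
    Tm (fun g => dsc (P g)) := by
  have hU : Def (fun g => P (tl g) (hd g) ∧ ∀ y, P (tl g) y → y = hd g) := by
    have : Def fun g => P (tl (tl g)) (hd g) := hP.mapv (fun i => Nat.casesOn (motive := fun _ => ℕ) i 0 (fun k => k + 2))
    infer_instance
  have h1 := hU.ex'.mapv (fun i => i + 1)
  have : Def (fun g => (P (tl g) (hd g) ∧ ∀ y, P (tl g) y → y = hd g) ∨
    ((¬ ∃ a, P (tl g) a ∧ ∀ y, P (tl g) y → y = a) ∧ hd g = em0)) :=
    @defOr _ _ _ _ hU (@defAnd _ _ _ _ (@defNot _ _ _ h1) inferInstance)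
  refine ⟨this.congr fun g => ?_⟩
  unfold dsc
  by_cases H : ∃ x, P (tl g) x ∧ ∀ y, P (tl g) y → y = x
  · rw [dif_pos H]
    simp only [H, not_true_eq_false, false_and, or_false]
    constructor
    · intro h; rw [h]; exact H.choose_spec
    · intro h; exact (h.2 _ H.choose_spec.1).symm
  · rw [dif_neg H]
    constructor
    · intro h; exact Or.inr ⟨H, h⟩
    · rintro (h | h)
      · exact absurd ⟨_, h⟩ H
      · exact h.2

theorem sep_ex (P : M → Prop) [h : Def (fun g => P (hd g))] (a : M) :
    ∃ s, ∀ z, z ∈ₘ s ↔ z ∈ₘ a ∧ P z := by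
  obtain ⟨k, φ, p, h⟩ := h.one
  obtain ⟨s, hs⟩ := (SetModel.zfc (M := M)).2.1.2.2.2.2.2.1 k φ p a
  exact ⟨s, fun z => by rw [hs, h]⟩

theorem repl_ex (f : M → M) [h : Tm (fun g => f (hd g))] (a : M) :
    ∃ s, ∀ z, z ∈ₘ s ↔ ∃ x, x ∈ₘ a ∧ z = f x := by
  have : Def (fun g => hd (tl g) = f (hd g)) :=
    h.out.mapv (fun i => 1 - i)
  obtain ⟨k, φ, p, h⟩ := this.two (P := fun x y => y = f x)
  obtain ⟨s, hs⟩ := (SetModel.zfc (M := M)).2.1.2.2.2.2.2.2 k φ p a (by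
    intro x hx y y' h1 h2
    rw [← h] at h1 h2; rw [h1, h2])
  exact ⟨s, fun z => by simp only [hs, h]⟩

/-- the set determined by membership condition -/
noncomputable def setof (P : M → Prop) : M := dsc (fun s => ∀ z, z ∈ₘ s ↔ P z)

theorem mem_setof {P : M → Prop} (h : ∃ s, ∀ z, z ∈ₘ s ↔ P z) (z : M) : z ∈ₘ setof P ↔ P z :=
  dsc_spec h (fun x y hx hy => ext fun z => (hx z).trans (hy z).symm) z

instance tmSetof {P : (ℕ → M) → M → Prop} [hP : Def (fun g => P (tl g) (hd g))] :
    Tm (fun g => setof (P g)) := by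
  have : Def fun g => P (tl (tl g)) (hd g) := hP.mapv (fun i => Nat.casesOn (motive := fun _ => ℕ) i 0 (fun k => k + 2))
  unfold setof; infer_instance

/-- separation -/
noncomputable def sep (a : M) (P : M → Prop) : M := setof (fun z => z ∈ₘ a ∧ P z)
instance tmSep {a : (ℕ → M) → M} {P : (ℕ → M) → M → Prop} [ha : Tm a] [hP : Def (fun g => P (tl g) (hd g))] :
    Tm (fun g => sep (a g) (P g)) := by
  have := ha.shift
  unfold sep; infer_instance
@[simp] theorem mem_sep {a : M} {P : M → Prop} [Def (fun g => P (hd g))] {z : M} :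
    z ∈ₘ sep a P ↔ z ∈ₘ a ∧ P z := mem_setof (sep_ex P a) z

/-- image -/
noncomputable def img (a : M) (f : M → M) : M := setof (fun z => ∃ x, x ∈ₘ a ∧ z = f x)
instance tmImg {a : (ℕ → M) → M} {f : (ℕ → M) → M → M} [ha : Tm a] [hP : Tm (fun g => f (tl g) (hd g))] :
    Tm (fun g => img (a g) (f g)) := by
  have := ha.shift.shift
  have : Tm (fun g => f (tl (tl g)) (hd g)) := hP.mapv (fun i => Nat.casesOn (motive := fun _ => ℕ) i 0 (fun k => k + 2))
  unfold img; infer_instance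
@[simp] theorem mem_img {a : M} {f : M → M} [Tm (fun g => f (hd g))] {z : M} :
    z ∈ₘ img a f ↔ ∃ x, x ∈ₘ a ∧ z = f x := mem_setof (repl_ex f a) z

noncomputable def emp : M := setof (fun _ => False)
@[simp] theorem mem_emp {z : M} : ¬ z ∈ₘ emp := by
  have : z ∈ₘ emp ↔ False := mem_setof (P := fun _ => False) (by
    obtain ⟨s, hs⟩ := sep_ex (M := M) (fun _ => False) em0
    exact ⟨s, fun z => by simp [hs]⟩) z
  simp [this]

noncomputable def upair (a b : M) : M := setof (fun z => z = a ∨ z = b)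
instance f2_upair : F2 (M := M) upair := ⟨by unfold upair; infer_instance⟩
@[simp] theorem mem_upair {a b z : M} : z ∈ₘ upair a b ↔ z = a ∨ z = b :=
  mem_setof ((SetModel.zfc (M := M)).2.1.2.1 a b) z
theorem upair_spec (a b : M) : UPairE SetModel.E (upair a b) a b := fun z => mem_upair
theorem upair_of {p a b : M} (h : UPairE SetModel.E p a b) : p = upair a b :=
  ext fun z => by rw [h z, mem_upair]

/-- union -/
noncomputable def Un (a : M) : M := setof (fun z => ∃ y, y ∈ₘ a ∧ z ∈ₘ y)
instance f1_Un : F1 (M := M) Un := ⟨by unfold Un; infer_instance⟩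
@[simp] theorem mem_Un {a z : M} : z ∈ₘ Un a ↔ ∃ y, y ∈ₘ a ∧ z ∈ₘ y :=
  mem_setof ((SetModel.zfc (M := M)).2.1.2.2.1 a) z

/-- power set -/
noncomputable def pw (a : M) : M := setof (fun z => SubE SetModel.E z a)
instance f1_pw : F1 (M := M) pw := ⟨by unfold pw; infer_instance⟩
@[simp] theorem mem_pw {a z : M} : z ∈ₘ pw a ↔ SubE SetModel.E z a :=
  mem_setof ((SetModel.zfc (M := M)).2.2.1 a) z

/-- binary union -/
noncomputable def un (a b : M) : M := Un (upair a b)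
instance f2_un : F2 (M := M) un := ⟨by unfold un; infer_instance⟩
@[simp] theorem mem_un {a b z : M} : z ∈ₘ un a b ↔ z ∈ₘ a ∨ z ∈ₘ b := by
  simp [un]

noncomputable def sing (a : M) : M := upair a a
instance f1_sing : F1 (M := M) sing := ⟨by unfold sing; infer_instance⟩
@[simp] theorem mem_sing {a z : M} : z ∈ₘ sing a ↔ z = a := by simp [sing]

/-- x ∪ {y} -/
noncomputable def adj (x y : M) : M := un x (sing y)
instance f2_adj : F2 (M := M) adj := ⟨by unfold adj; infer_instance⟩
@[simp] theorem mem_adj {x y z : M} : z ∈ₘ adj x y ↔ z ∈ₘ x ∨ z = y := by simp [adj]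

noncomputable def suc (x : M) : M := adj x x
instance f1_suc : F1 (M := M) suc := ⟨by unfold suc; infer_instance⟩
@[simp] theorem mem_suc {x z : M} : z ∈ₘ suc x ↔ z ∈ₘ x ∨ z = x := by simp [suc]
theorem suc_of {s y : M} (h : SuccSpecE SetModel.E s y) : s = suc y :=
  ext fun z => by rw [h z, mem_suc]

noncomputable def inter (x y : M) : M := sep x (fun z => z ∈ₘ y)
instance f2_inter : F2 (M := M) inter := ⟨by unfold inter; infer_instance⟩
@[simp] theorem mem_inter {x y z : M} : z ∈ₘ inter x y ↔ z ∈ₘ x ∧ z ∈ₘ y := by simp [inter]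
theorem inter_spec {x y z : M} : InterSpecE SetModel.E z x y ↔ z = inter x y :=
  ⟨fun h => ext fun w => by rw [h w, mem_inter], fun h w => by rw [h, mem_inter]⟩

/-- ordered pair -/
noncomputable def op (a b : M) : M := upair (sing a) (upair a b)
instance f2_op : F2 (M := M) op := ⟨by unfold op; infer_instance⟩

theorem upair_inj {a b c d : M} (h : upair a b = upair c d) : (a = c ∧ b = d) ∨ (a = d ∧ b = c) := by
  have key : ∀ z : M, (z = a ∨ z = b) ↔ (z = c ∨ z = d) := fun z => by
    rw [← mem_upair, ← mem_upair, h]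
  have h1 := (key a).1 (Or.inl rfl)
  have h2 := (key b).1 (Or.inr rfl)
  have h3 := (key c).2 (Or.inl rfl)
  have h4 := (key d).2 (Or.inr rfl)
  grind

theorem sing_inj {a b : M} (h : sing a = sing b) : a = b := by
  rcases upair_inj h with h | h <;> exact h.1

theorem sing_upair {a c d : M} (h : sing a = upair c d) : c = a ∧ d = a := by
  rcases upair_inj h with h | h <;> exact ⟨by grind, by grind⟩

theorem op_inj {a b c d : M} (h : op a b = op c d) : a = c ∧ b = d := by
  rcases upair_inj h with ⟨h1, h2⟩ | ⟨h1, h2⟩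
  · have := sing_inj h1
    subst this
    rcases upair_inj h2 with h | h
    · exact h
    · exact ⟨rfl, h.2.trans h.1⟩
  · have h3 := sing_upair h1
    have h4 := sing_upair h2.symm
    refine ⟨h4.1, ?_⟩
    rw [h4.2, h3.2, h4.1]
@[simp] theorem op_eq {a b c d : M} : op a b = op c d ↔ a = c ∧ b = d :=
  ⟨op_inj, fun h => by rw [h.1, h.2]⟩

theorem opair_iff {p a b : M} : OPairE SetModel.E p a b ↔ p = op a b := by
  constructor
  · rintro ⟨s, t, hs, ht, hp⟩
    rw [upair_of hs, upair_of ht] at hp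
    exact upair_of hp
  · rintro rfl
    exact ⟨_, _, upair_spec a a, upair_spec a b, upair_spec _ _⟩

theorem pairMem_iff {f a b : M} : PairMemE SetModel.E f a b ↔ op a b ∈ₘ f := by
  constructor
  · rintro ⟨p, hp, h⟩; rw [opair_iff] at h; rwa [← h]
  · intro h; exact ⟨_, h, opair_iff.2 rfl⟩

theorem found {a z : M} (h : z ∈ₘ a) : ∃ m, m ∈ₘ a ∧ ∀ z, z ∈ₘ a → ¬ z ∈ₘ m :=
  (SetModel.zfc (M := M)).2.1.2.2.2.2.1 a ⟨z, h⟩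

theorem mem_irr (a : M) : ¬ a ∈ₘ a := fun h => by
  obtain ⟨m, hm, hz⟩ := found (a := sing a) (z := a) (by simp)
  simp at hm; subst hm; exact hz m (by simp) h

theorem mem_asymm {a b : M} (h : a ∈ₘ b) : ¬ b ∈ₘ a := fun h' => by
  obtain ⟨m, hm, hz⟩ := found (a := upair a b) (z := a) (by simp)
  simp at hm; rcases hm with rfl | rfl
  · exact hz b (by simp) h'
  · exact hz a (by simp) h

/-- cartesian product -/
noncomputable def prd (a b : M) : M := Un (img a (fun x => img b (fun y => op x y)))
instance f2_prd : F2 (M := M) prd := ⟨by unfold prd; infer_instance⟩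
theorem mem_prd {a b z : M} : z ∈ₘ prd a b ↔ ∃ x y, x ∈ₘ a ∧ y ∈ₘ b ∧ z = op x y := by
  simp only [prd, mem_Un, mem_img]
  constructor
  · rintro ⟨_, ⟨x, hx, rfl⟩, h⟩
    rw [mem_img] at h
    obtain ⟨y, hy, rfl⟩ := h
    exact ⟨x, y, hx, hy, rfl⟩
  · rintro ⟨x, y, hx, hy, rfl⟩
    exact ⟨_, ⟨x, hx, rfl⟩, mem_img.2 ⟨y, hy, rfl⟩⟩
@[simp] theorem op_mem_prd {a b x y : M} : op x y ∈ₘ prd a b ↔ x ∈ₘ a ∧ y ∈ₘ b := by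
  rw [mem_prd]
  constructor
  · rintro ⟨x', y', h1, h2, h⟩
    rw [op_eq] at h; rw [h.1, h.2]; exact ⟨h1, h2⟩
  · rintro ⟨h1, h2⟩; exact ⟨x, y, h1, h2, rfl⟩

/-- function application -/
noncomputable def ap (f x : M) : M := dsc (fun y => op x y ∈ₘ f)
instance f2_ap : F2 (M := M) ap := ⟨by unfold ap; infer_instance⟩

/-- graph of a function restricted to a set -/
noncomputable def gr (a : M) (f : M → M) : M := img a (fun x => op x (f x))
instance tmGr {a : (ℕ → M) → M} {f : (ℕ → M) → M → M} [ha : Tm a] [hP : Tm (fun g => f (tl g) (hd g))] :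
    Tm (fun g => gr (a g) (f g)) := by
  unfold gr; infer_instance
theorem mem_gr {a : M} {f : M → M} [Tm (fun g => f (hd g))] {z : M} :
    z ∈ₘ gr a f ↔ ∃ x, x ∈ₘ a ∧ z = op x (f x) := mem_img
@[simp] theorem op_mem_gr {a : M} {f : M → M} [Tm (fun g => f (hd g))] {x y : M} :
    op x y ∈ₘ gr a f ↔ x ∈ₘ a ∧ y = f x := by
  rw [mem_gr]
  constructor
  · rintro ⟨x', h1, h⟩
    rw [op_eq] at h; rw [h.1, h.2]; exact ⟨h1, rfl⟩
  · rintro ⟨h1, rfl⟩; exact ⟨x, h1, rfl⟩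
theorem ap_gr {a : M} {f : M → M} [Tm (fun g => f (hd g))] {x : M} (h : x ∈ₘ a) :
    ap (gr a f) x = f x :=
  dsc_eq (op_mem_gr.2 ⟨h, rfl⟩) fun y hy => (op_mem_gr.1 hy).2

theorem gr_congr {a : M} {f f' : M → M} [Tm (fun g => f (hd g))] [Tm (fun g => f' (hd g))]
    (h : ∀ x, x ∈ₘ a → f x = f' x) : gr a f = gr a f' := ext fun z => by
  rw [mem_gr, mem_gr]
  exact exists_congr fun x => and_congr_right fun hx => by rw [h x hx]

theorem gr_isFunc {a b : M} {f : M → M} [Tm (fun g => f (hd g))] (h : ∀ x, x ∈ₘ a → f x ∈ₘ b) :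
    IsFuncE SetModel.E (gr a f) a b := by
  simp only [IsFuncE, opair_iff, pairMem_iff, op_mem_gr]
  refine ⟨?_, fun x hx => ⟨⟨f x, hx, rfl⟩, fun y y' h1 h2 => h1.2.trans h2.2.symm⟩⟩
  intro p hp
  obtain ⟨x, hx, rfl⟩ := mem_gr.1 hp
  exact ⟨x, f x, hx, h x hx, rfl⟩

theorem isFunc_iff {f a b : M} : IsFuncE SetModel.E f a b ↔
    (∀ p, p ∈ₘ f → ∃ x y, x ∈ₘ a ∧ y ∈ₘ b ∧ p = op x y) ∧
    ∀ x, x ∈ₘ a → op x (ap f x) ∈ₘ f ∧ ap f x ∈ₘ b ∧ ∀ y, op x y ∈ₘ f → y = ap f x := by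
  simp only [IsFuncE, opair_iff, pairMem_iff]
  refine and_congr_right fun h1 => forall_congr' fun x => forall_congr' fun hx => ?_
  constructor
  · rintro ⟨h2, h3⟩
    have h4 : op x (ap f x) ∈ₘ f := dsc_spec (P := fun y => op x y ∈ₘ f) h2 h3
    refine ⟨h4, ?_, fun y hy => h3 _ _ hy h4⟩
    obtain ⟨x', y', _, h5, h6⟩ := h1 _ h4
    rw [op_eq] at h6; rw [h6.2]; exact h5
  · rintro ⟨h2, _, h3⟩
    exact ⟨⟨_, h2⟩, fun y y' h4 h5 => (h3 y h4).trans (h3 y' h5).symm⟩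

theorem isFunc_op {f a b x y : M} (h : IsFuncE SetModel.E f a b) (hx : op x y ∈ₘ f) :
    x ∈ₘ a ∧ y ∈ₘ b ∧ y = ap f x := by
  rw [isFunc_iff] at h
  obtain ⟨x', y', h1, h2, h3⟩ := h.1 _ hx
  rw [op_eq] at h3; obtain ⟨rfl, rfl⟩ := h3
  exact ⟨h1, h2, (h.2 x h1).2.2 y hx⟩

theorem sb_antisymm {a b : M} (h : sb a b) (h' : sb b a) : a = b := ext fun z => ⟨h z, h' z⟩
theorem sb_refl (a : M) : sb a a := fun _ h => h
theorem sep_sb {a : M} {P : M → Prop} [Def (fun g => P (hd g))] : sb (sep a P) a :=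
  fun _ h => (mem_sep.1 h).1

end Basic
end Paper


namespace Paper
set_option linter.unusedSectionVars false
set_option linter.unusedVariables false
set_option linter.unusedSimpArgs false

section Ords
variable {M : Type} [SetModel M]

theorem od_mem {a b : M} (ha : Od a) (h : b ∈ₘ a) : Od b :=
  ⟨ha.2 b h, fun y hy => ha.2 y (ha.1 b h y hy)⟩
theorem od_tr {a b c : M} (ha : Od a) (h : b ∈ₘ a) (h' : c ∈ₘ b) : c ∈ₘ a := ha.1 b h c h'
theorem od_sb {a b : M} (ha : Od a) (h : b ∈ₘ a) : sb b a := ha.1 b h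

theorem od_least {P : M → Prop} [Def (fun g => P (hd g))] {a : M} (ha : Od a) (h : P a) :
    ∃ b, Od b ∧ P b ∧ ∀ c, c ∈ₘ b → ¬ P c := by
  by_cases hc : ∃ c, c ∈ₘ a ∧ P c
  · obtain ⟨c, hc, hP⟩ := hc
    obtain ⟨m, hm, hz⟩ := found (a := sep a P) (z := c) (mem_sep.2 ⟨hc, hP⟩)
    rw [mem_sep] at hm
    exact ⟨m, od_mem ha hm.1, hm.2, fun c hc hPc => hz c (mem_sep.2 ⟨od_tr ha hm.1 hc, hPc⟩) hc⟩
  · push Not at hc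
    exact ⟨a, ha, h, hc⟩

theorem od_ind {P : M → Prop} [hP : Def (fun g => P (hd g))]
    (h : ∀ a, Od a → (∀ b, b ∈ₘ a → P b) → P a) : ∀ a, Od a → P a := by
  intro a ha
  by_contra hn
  obtain ⟨b, hb, hPb, hc⟩ := od_least (P := fun x => ¬ P x) ha hn
  exact hPb (h b hb fun c hcb => not_not.1 (hc c hcb))

theorem od_tri {a b : M} (ha : Od a) (hb : Od b) : a ∈ₘ b ∨ a = b ∨ b ∈ₘ a := by
  refine od_ind (P := fun a : M => ∀ b, Od b → a ∈ₘ b ∨ a = b ∨ b ∈ₘ a) ?_ a ha b hb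
  clear ha hb a b
  intro a ha iha
  refine od_ind (P := fun b => a ∈ₘ b ∨ a = b ∨ b ∈ₘ a) ?_
  intro b hb ihb
  by_cases h1 : a ∈ₘ b
  · exact Or.inl h1
  by_cases h2 : b ∈ₘ a
  · exact Or.inr (Or.inr h2)
  right; left
  apply ext
  intro z
  constructor
  · intro hz
    rcases iha z hz b hb with h | h | h
    · exact h
    · subst h; exact absurd hz h2
    · exact absurd (od_tr ha hz h) h2
  · intro hz
    rcases ihb z hz with h | h | h
    · exact absurd (od_tr hb hz h) h1
    · subst h; exact absurd hz h1
    · exact h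

theorem od_le_iff {a b : M} (ha : Od a) (hb : Od b) : sb a b ↔ (a ∈ₘ b ∨ a = b) := by
  constructor
  · intro h
    rcases od_tri ha hb with h1 | h1 | h1
    · exact Or.inl h1
    · exact Or.inr h1
    · exact absurd (h b h1) (mem_irr b)
  · rintro (h | rfl)
    · exact od_sb hb h
    · exact sb_refl a

theorem od_not_lt {a b : M} (ha : Od a) (hb : Od b) : ¬ a ∈ₘ b ↔ sb b a := by
  rw [od_le_iff hb ha]
  constructor
  · intro h; rcases od_tri ha hb with h1 | h1 | h1
    · exact absurd h1 h
    · exact Or.inr h1.symm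
    · exact Or.inl h1
  · rintro (h | rfl) h'
    · exact mem_asymm h h'
    · exact mem_irr _ h'

theorem od_lt_of_le_of_lt {a b c : M} (hc : Od c) (ha : Od a) (h : sb a b) (h' : b ∈ₘ c) : a ∈ₘ c := by
  rcases (od_le_iff ha (od_mem hc h')).1 h with h | rfl
  · exact od_tr hc h' h
  · exact h'

theorem od_suc {a : M} (ha : Od a) : Od (suc a) := by
  constructor
  · intro y hy z hz
    rw [mem_suc] at *
    rcases hy with hy | rfl
    · exact Or.inl (od_tr ha hy hz)
    · exact Or.inl hz
  · intro y hy
    rw [mem_suc] at hy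
    rcases hy with hy | rfl
    · exact (od_mem ha hy).1
    · exact ha.1

theorem od_emp : Od (emp : M) := ⟨fun y hy => absurd hy mem_emp, fun y hy => absurd hy mem_emp⟩

theorem od_of {a : M} (h : ∀ x, x ∈ₘ a → Od x) (h' : ∀ x y, x ∈ₘ a → y ∈ₘ x → y ∈ₘ a) : Od a :=
  ⟨fun y hy z hz => h' y z hy hz, fun y hy => (h y hy).1⟩

theorem od_Un {a : M} (h : ∀ x, x ∈ₘ a → Od x) : Od (Un a) := by
  apply od_of
  · intro x hx; obtain ⟨y, hy, hx⟩ := mem_Un.1 hx; exact od_mem (h y hy) hx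
  · intro x y hx hxy
    obtain ⟨w, hw, hx⟩ := mem_Un.1 hx
    exact mem_Un.2 ⟨w, hw, od_tr (h w hw) hx hxy⟩

theorem od_un {a b : M} (ha : Od a) (hb : Od b) : Od (un a b) := by
  apply od_Un; intro x hx; rcases mem_upair.1 hx with rfl | rfl <;> assumption

theorem suc_le {a b : M} (hb : Od b) (h : a ∈ₘ b) : suc a ∈ₘ b ∨ suc a = b := by
  rw [← od_le_iff (od_suc (od_mem hb h)) hb]
  intro z hz
  rcases mem_suc.1 hz with hz | rfl
  · exact od_tr hb h hz
  · exact h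

theorem self_suc (a : M) : a ∈ₘ suc a := mem_suc.2 (Or.inr rfl)

theorem suc_inj {a b : M} (h : suc a = suc b) : a = b := by
  have h1 : a ∈ₘ suc b := h ▸ self_suc a
  have h2 : b ∈ₘ suc a := h ▸ self_suc b
  rw [mem_suc] at *
  rcases h1 with h1 | h1
  · rcases h2 with h2 | h2
    · exact absurd h1 (mem_asymm h2)
    · exact h2.symm
  · exact h1

theorem suc_lt {a b : M} (hb : Od b) (h : a ∈ₘ b) : suc a ∈ₘ suc b := by
  rw [mem_suc]; exact suc_le hb h

theorem lm_suc {l a : M} (hl : Lm l) (h : a ∈ₘ l) : suc a ∈ₘ l := by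
  obtain ⟨b, hb, hab⟩ := hl.2.2 a h
  rcases suc_le (od_mem hl.1 hb) hab with h | h
  · exact od_tr hl.1 hb h
  · rw [h]; exact hb

theorem od_emp_le {a : M} (h : Od a) : emp ∈ₘ a ∨ emp = a :=
  (od_le_iff od_emp h).1 fun z hz => absurd hz mem_emp

theorem emp_lt {a b : M} (h : Od a) (hb : b ∈ₘ a) : emp ∈ₘ a := by
  rcases od_emp_le h with h | rfl
  · exact h
  · exact absurd hb mem_emp

theorem lm_emp {l : M} (hl : Lm l) : emp ∈ₘ l := by
  obtain ⟨w, hw⟩ := hl.2.1; exact emp_lt hl.1 hw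

theorem lm_of {l : M} (h : Od l) {w : M} (hw : w ∈ₘ l) (h2 : ∀ a, a ∈ₘ l → suc a ∈ₘ l) : Lm l :=
  ⟨h, ⟨w, hw⟩, fun a ha => ⟨_, h2 a ha, self_suc a⟩⟩

theorem od_cases {a : M} (h : Od a) : a = emp ∨ (∃ b, Od b ∧ a = suc b) ∨ Lm a := by
  by_cases h0 : ∃ w, w ∈ₘ a
  · right
    by_cases h1 : ∀ b, b ∈ₘ a → ∃ c, c ∈ₘ a ∧ b ∈ₘ c
    · exact Or.inr ⟨h, h0, h1⟩
    · left
      push Not at h1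
      obtain ⟨b, hb, hc⟩ := h1
      refine ⟨b, od_mem h hb, ?_⟩
      rcases suc_le h hb with h2 | h2
      · exact absurd (self_suc b) (hc _ h2)
      · exact h2.symm
  · left; push Not at h0
    exact ext fun z => ⟨fun hz => absurd hz (h0 z), fun hz => absurd hz mem_emp⟩

theorem not_lm_suc {b : M} : ¬ Lm (suc b) := fun h => by
  have := lm_suc h (self_suc b)
  exact mem_irr _ this

theorem not_lm_emp : ¬ Lm (emp : M) := fun h => mem_emp (lm_emp h)

theorem od_not_set (a : M) : ∃ b, Od b ∧ ¬ b ∈ₘ a := by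
  by_contra h
  push Not at h
  have : Od (sep a Od) := by
    apply od_of
    · intro x hx; exact (mem_sep.1 hx).2
    · intro x y hx hy
      have := od_mem (mem_sep.1 hx).2 hy
      exact mem_sep.2 ⟨h y this, this⟩
  exact mem_irr _ (mem_sep.2 ⟨h _ this, this⟩)

theorem lm_ex : ∃ l : M, Lm l := by
  by_contra hn
  push Not at hn
  obtain ⟨I, ⟨e, he, hee⟩, hs⟩ := (SetModel.zfc (M := M)).2.1.2.2.2.1
  obtain ⟨b, hb, hbI⟩ := od_not_set I
  refine hbI (od_ind (P := fun b => b ∈ₘ I) ?_ b hb)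
  intro a ha ih
  rcases od_cases ha with h | ⟨c, hc, h⟩ | h
  · have : e = a := ext fun z => ⟨fun hz => absurd hz (hee z), fun hz => by rw [h] at hz; exact absurd hz mem_emp⟩
    rw [← this]; exact he
  · obtain ⟨s, hsI, hs⟩ := hs c (ih c (by rw [h]; exact self_suc c))
    rw [h, ← suc_of hs]; exact hsI
  · exact absurd h (hn a)

/-- least ordinal -/
noncomputable def lst (P : M → Prop) : M := dsc (fun x => Od x ∧ P x ∧ ∀ y, y ∈ₘ x → ¬ P y)
instance tmLst {P : (ℕ → M) → M → Prop} [hP : Def (fun g => P (tl g) (hd g))] :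
    Tm (fun g => lst (P g)) := by
  have : Def fun g => P (tl (tl g)) (hd g) :=
    hP.mapv (fun i => Nat.casesOn (motive := fun _ => ℕ) i 0 (fun k => k + 2))
  unfold lst; infer_instance

theorem lst_spec {P : M → Prop} [Def (fun g => P (hd g))] {a : M} (ha : Od a) (h : P a) :
    Od (lst P) ∧ P (lst P) ∧ ∀ y, y ∈ₘ lst P → ¬ P y := by
  refine dsc_spec (P := fun x => Od x ∧ P x ∧ ∀ y, y ∈ₘ x → ¬ P y) (od_least ha h) ?_
  rintro x y ⟨h1, h2, h3⟩ ⟨h4, h5, h6⟩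
  rcases od_tri h1 h4 with h | h | h
  · exact absurd h2 (h6 x h)
  · exact h
  · exact absurd h5 (h3 y h)

theorem lst_le {P : M → Prop} [Def (fun g => P (hd g))] {a : M} (ha : Od a) (h : P a) : sb (lst P) a := by
  obtain ⟨h1, h2, h3⟩ := lst_spec ha h
  rw [← od_not_lt ha h1]
  intro h'; exact h3 a h' h

theorem lst_congr {P Q : M → Prop} (h : ∀ x, P x ↔ Q x) : lst P = lst Q := by
  have : P = Q := funext fun x => propext (h x)
  rw [this]

noncomputable def om : M := lst (fun x => Lm x)
theorem om_spec : OmegaSpecE SetModel.E (om : M) := by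
  obtain ⟨l, hl⟩ := lm_ex (M := M)
  exact (lst_spec (P := fun x => Lm x) hl.1 hl).2
theorem om_lm : Lm (om : M) := om_spec.1
theorem om_od : Od (om : M) := om_lm.1
theorem om_eq {w : M} (h : OmegaSpecE SetModel.E w) : w = om := by
  rcases od_tri h.1.1 om_od with h1 | h1 | h1
  · exact absurd h.1 (om_spec.2 w h1)
  · exact h1
  · exact absurd om_lm (h.2 om h1)
theorem om_le_lm {l : M} (h : Lm l) : sb om l := by
  rw [← od_not_lt h.1 om_od]; exact fun h' => om_spec.2 l h' h

/-- strict supremum -/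
noncomputable def ssup (a : M) : M := Un (img (sep a Od) suc)
instance f1_ssup : F1 (M := M) ssup := ⟨by unfold ssup; infer_instance⟩
theorem ssup_od (a : M) : Od (ssup a) := by
  apply od_Un; intro x hx
  obtain ⟨y, hy, rfl⟩ := mem_img.1 hx
  exact od_suc (mem_sep.1 hy).2
theorem mem_ssup {a x : M} (h : x ∈ₘ a) (h' : Od x) : x ∈ₘ ssup a :=
  mem_Un.2 ⟨suc x, mem_img.2 ⟨x, mem_sep.2 ⟨h, h'⟩, rfl⟩, self_suc x⟩

theorem img_congr {a : M} {f f' : M → M} (h : ∀ x, x ∈ₘ a → f x = f' x) : img a f = img a f' := by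
  unfold img
  congr 1; funext z
  refine propext (exists_congr fun x => and_congr_right fun hx => by rw [h x hx])

theorem sep_congr {a : M} {P Q : M → Prop} (h : ∀ x, x ∈ₘ a → (P x ↔ Q x)) : sep a P = sep a Q := by
  unfold sep
  congr 1; funext z
  exact propext (and_congr_right fun hx => h z hx)

/-! ### recursion -/

noncomputable def rs (f x : M) : M := sep f (fun z => ∃ y w, y ∈ₘ x ∧ z = op y w)
instance f2_rs : F2 (M := M) rs := ⟨by unfold rs; infer_instance⟩

theorem rs_gr {a x : M} {f : M → M} [Tm (fun g => f (hd g))] (h : sb x a) : rs (gr a f) x = gr x f := by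
  apply ext; intro z
  rw [rs, mem_sep, mem_gr, mem_gr]
  constructor
  · rintro ⟨⟨y, hy, rfl⟩, y', w, h1, h2⟩
    rw [op_eq] at h2
    exact ⟨y, h2.1 ▸ h1, rfl⟩
  · rintro ⟨y, hy, rfl⟩
    exact ⟨⟨y, h y hy, rfl⟩, y, _, hy, rfl⟩

theorem Tm.subst2 {G : (ℕ → M) → M → M → M} (h : Tm (fun g => G (tl (tl g)) (hd (tl g)) (hd g)))
    {v : (ℕ → M) → ℕ → M} (hv : Vr v) {s t : (ℕ → M) → M} (hs : Tm s) (ht : Tm t) :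
    Tm (fun g => G (v g) (s g) (t g)) := by
  obtain ⟨k, hk⟩ := hv.out
  have h1 : Def (fun g => hd (tl (tl g)) = G (v (tl (tl (tl g)))) (hd (tl g)) (hd g)) := by
    refine (h.out.mapv (fun i => Nat.casesOn (motive := fun _ => ℕ) i 2 (fun i =>
      Nat.casesOn (motive := fun _ => ℕ) i 0 (fun i => Nat.casesOn (motive := fun _ => ℕ) i 1
      (fun i => i + k + 3))))).congr fun g => ?_
    have : v (tl (tl (tl g))) = fun i => g (i + k + 3) := by
      funext i; rw [hk]; rfl
    rw [this]; rfl
  have := ht.shift.shift.shift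
  have := hs.shift.shift.shift
  have h3 : Def (fun g => ∃ a b, a = s (tl g) ∧ b = t (tl g) ∧ hd g = G (v (tl g)) a b) :=
    inferInstance
  exact ⟨h3.congr fun g => by simp⟩

/-- approximation -/
noncomputable def apx (G : M → M → M) (x : M) : M := dsc (fun f => f = gr x (fun y => G y (rs f y)))
/-- recursion on ordinals -/
noncomputable def rec (G : M → M → M) (x : M) : M := G x (apx G x)

instance tmApx {G : (ℕ → M) → M → M → M} {a : (ℕ → M) → M}
    [h : Tm (fun g => G (tl (tl g)) (hd (tl g)) (hd g))] [ha : Tm a] : Tm (fun g => apx (G g) (a g)) := by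
  have := Tm.subst2 h (v := fun g => tl (tl g)) inferInstance (s := fun g => hd g)
    (t := fun g => rs (hd (tl g)) (hd g)) inferInstance inferInstance
  have := ha.shift
  unfold apx
  infer_instance

instance tmRec {G : (ℕ → M) → M → M → M} {a : (ℕ → M) → M}
    [h : Tm (fun g => G (tl (tl g)) (hd (tl g)) (hd g))] [ha : Tm a] : Tm (fun g => rec (G g) (a g)) :=
  Tm.subst2 h (v := fun g => g) inferInstance (s := a)
    (t := fun g => apx (G g) (a g)) inferInstance inferInstance

theorem rec_aux {G : M → M → M} [h : Tm (fun g => G (hd (tl g)) (hd g))] :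
    ∀ a, Od a → (∀ f f', f = gr a (fun y => G y (rs f y)) → f' = gr a (fun y => G y (rs f' y)) → f = f') ∧
      (apx G a = gr a (fun y => G y (rs (apx G a) y))) ∧
      ∀ f, f = gr a (fun y => G y (rs f y)) → ∀ x, x ∈ₘ a → rs f x = apx G x := by
  have hF2 : F2 G := ⟨h.mapv (fun i => Nat.casesOn (motive := fun _ => ℕ) i 1 (fun _ => 0))⟩
  have tG : ∀ f : M, Tm (fun g => G (hd g) (rs f (hd g))) := fun f => inferInstance
  refine od_ind (P := fun a : M => (∀ f f', f = gr a (fun y => G y (rs f y)) → f' = gr a (fun y => G y (rs f' y)) → f = f') ∧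
      (apx G a = gr a (fun y => G y (rs (apx G a) y))) ∧
      ∀ f, f = gr a (fun y => G y (rs f y)) → ∀ x, x ∈ₘ a → rs f x = apx G x) ?_
  intro a ha ih
  have key : ∀ f, f = gr a (fun y => G y (rs f y)) → ∀ x, x ∈ₘ a → rs f x = apx G x := by
    intro f hf x hx
    refine (ih x hx).1 _ _ ?_ (ih x hx).2.1
    have hf1 : rs f x = gr x (fun y => G y (rs f y)) := by
      conv_lhs => rw [hf]
      exact rs_gr (od_sb ha hx)
    have : ∀ y, y ∈ₘ x → rs (rs f x) y = rs f y := by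
      intro y hy
      apply ext; intro z
      simp only [rs, mem_sep]
      constructor
      · rintro ⟨⟨h1, _⟩, h2⟩; exact ⟨h1, h2⟩
      · rintro ⟨h1, y', w, h2, rfl⟩
        exact ⟨⟨h1, y', w, od_tr (od_mem ha hx) hy h2, rfl⟩, y', w, h2, rfl⟩
    rw [hf1]
    refine gr_congr fun y hy => ?_
    rw [← hf1, this y hy]
  have huniq : ∀ f f', f = gr a (fun y => G y (rs f y)) → f' = gr a (fun y => G y (rs f' y)) → f = f' := by
    intro f f' hf hf'
    rw [hf, hf']
    refine gr_congr fun y hy => ?_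
    rw [key f hf y hy, key f' hf' y hy]
  refine ⟨huniq, ?_, key⟩
  refine dsc_spec (P := fun f => f = gr a (fun y => G y (rs f y))) ?_ (fun f f' => huniq f f')
  have hT : Tm (fun g => G (hd g) (apx G (hd g))) := inferInstance
  refine ⟨gr a (fun y => G y (apx G y)), gr_congr fun x hx => ?_⟩
  rw [rs_gr (od_sb ha hx)]
  congr 1
  rw [(ih x hx).2.1]
  refine gr_congr fun y hy => ?_
  rw [(ih x hx).2.2 _ (ih x hx).2.1 y hy]

theorem apx_eq {G : M → M → M} [h : Tm (fun g => G (hd (tl g)) (hd g))] {a : M} (ha : Od a) :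
    apx G a = gr a (rec G) := by
  have hF2 : F2 G := ⟨h.mapv (fun i => Nat.casesOn (motive := fun _ => ℕ) i 1 (fun _ => 0))⟩
  have h1 := rec_aux (G := G) a ha
  rw [h1.2.1]
  refine gr_congr (f' := rec G) fun x hx => ?_
  rw [h1.2.2 _ h1.2.1 x hx]; rfl

theorem rec_eq {G : M → M → M} [h : Tm (fun g => G (hd (tl g)) (hd g))] {a : M} (ha : Od a) :
    rec G a = G a (gr a (rec G)) := by
  rw [← apx_eq ha]; rfl

end Ords
end Paper


namespace Paper
set_option linter.unusedSectionVars false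
set_option linter.unusedVariables false
set_option linter.unusedSimpArgs false

section Hier
variable {M : Type} [SetModel M]

/-- iterated unions, for transitive closures -/
noncomputable def tcs (x α : M) : M := rec (fun α f => un x (Un (img α (fun β => Un (ap f β))))) α
instance f2_tcs : F2 (M := M) tcs := ⟨by unfold tcs; infer_instance⟩
theorem tcs_eq {x α : M} (h : Od α) : tcs x α = un x (Un (img α (fun β => Un (tcs x β)))) := by
  unfold tcs
  rw [rec_eq h]
  congr 2
  exact img_congr fun β hβ => by rw [ap_gr hβ]

/-- a transitive set containing x as a subset -/
noncomputable def tc (x : M) : M := tcs x om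
instance f1_tc : F1 (M := M) tc := ⟨by unfold tc; infer_instance⟩
theorem mem_tcs {x α z : M} (h : Od α) : z ∈ₘ tcs x α ↔ z ∈ₘ x ∨ ∃ β, β ∈ₘ α ∧ ∃ y, y ∈ₘ tcs x β ∧ z ∈ₘ y := by
  rw [tcs_eq h, mem_un, mem_Un]
  refine or_congr_right ?_
  constructor
  · rintro ⟨_, h1, h2⟩
    obtain ⟨β, hβ, rfl⟩ := mem_img.1 h1
    exact ⟨β, hβ, mem_Un.1 h2⟩
  · rintro ⟨β, hβ, h2⟩
    exact ⟨_, mem_img.2 ⟨β, hβ, rfl⟩, mem_Un.2 h2⟩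
theorem sb_tc (x : M) : sb x (tc x) := fun z hz => (mem_tcs om_od).2 (Or.inl hz)
theorem trans_tc (x : M) : TransE SetModel.E (tc x) := by
  intro y hy z hz
  unfold tc at *
  rw [mem_tcs om_od] at *
  rcases hy with hy | ⟨β, hβ, w, hw, hy⟩
  · exact Or.inr ⟨emp, lm_emp om_lm, y, (mem_tcs od_emp).2 (Or.inl hy), hz⟩
  · refine Or.inr ⟨suc β, lm_suc om_lm hβ, y, ?_, hz⟩
    exact (mem_tcs (od_suc (od_mem om_od hβ))).2 (Or.inr ⟨β, self_suc β, w, hw, hy⟩)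

theorem set_ind {P : M → Prop} [hP : Def (fun g => P (hd g))]
    (h : ∀ a, (∀ b, b ∈ₘ a → P b) → P a) : ∀ a, P a := by
  intro a
  by_contra hn
  obtain ⟨m, hm, hz⟩ := found (a := sep (tc (sing a)) (fun x => ¬ P x)) (z := a)
    (mem_sep.2 ⟨sb_tc _ _ (mem_sing.2 rfl), hn⟩)
  rw [mem_sep] at hm
  refine hm.2 (h m fun b hb => ?_)
  by_contra hb'
  exact hz b (mem_sep.2 ⟨trans_tc _ m hm.1 b hb, hb'⟩) hb

/-- cumulative hierarchy -/
noncomputable def Vf (α : M) : M := rec (fun α f => Un (img α (fun β => pw (ap f β)))) α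
instance f1_Vf : F1 (M := M) Vf := ⟨by unfold Vf; infer_instance⟩
theorem Vf_eq {α : M} (h : Od α) : Vf α = Un (img α (fun β => pw (Vf β))) := by
  unfold Vf
  rw [rec_eq h]
  congr 1
  exact img_congr fun β hβ => by rw [ap_gr hβ]
theorem mem_Vf {α z : M} (h : Od α) : z ∈ₘ Vf α ↔ ∃ β, β ∈ₘ α ∧ sb z (Vf β) := by
  rw [Vf_eq h, mem_Un]
  constructor
  · rintro ⟨_, h1, h2⟩
    obtain ⟨β, hβ, rfl⟩ := mem_img.1 h1
    exact ⟨β, hβ, mem_pw.1 h2⟩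
  · rintro ⟨β, hβ, h2⟩
    exact ⟨_, mem_img.2 ⟨β, hβ, rfl⟩, mem_pw.2 h2⟩
theorem Vf_mono {α β : M} (h : Od α) (hb : Od β) (h' : sb β α) : sb (Vf β) (Vf α) := by
  intro z hz
  rw [mem_Vf hb] at hz
  rw [mem_Vf h]
  obtain ⟨γ, hγ, hz⟩ := hz
  exact ⟨γ, h' γ hγ, hz⟩
theorem Vf_trans : ∀ α : M, Od α → TransE SetModel.E (Vf α) := by
  refine od_ind (P := fun α : M => TransE SetModel.E (Vf α)) fun α h ih => ?_
  intro y hy z hz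
  obtain ⟨β, hβ, hy⟩ := (mem_Vf h).1 hy
  have := hy z hz
  exact Vf_mono h (od_mem h hβ) (od_sb h hβ) z this
theorem Vf_all : ∀ x : M, ∃ α, Od α ∧ x ∈ₘ Vf α := by
  refine set_ind (P := fun x : M => ∃ α, Od α ∧ x ∈ₘ Vf α) fun x ih => ?_
  let r : M → M := fun y => lst (fun α => y ∈ₘ Vf α)
  have hr : ∀ y, y ∈ₘ x → Od (r y) ∧ y ∈ₘ Vf (r y) := fun y hy => by
    obtain ⟨α, h1, h2⟩ := ih y hy
    have := lst_spec (P := fun α => y ∈ₘ Vf α) h1 h2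
    exact ⟨this.1, this.2.1⟩
  have hT : Tm (fun g => r (hd g)) := inferInstance
  refine ⟨suc (ssup (img x r)), od_suc (ssup_od _), (mem_Vf (od_suc (ssup_od _))).2 ⟨_, self_suc _, fun y hy => ?_⟩⟩
  refine Vf_mono (ssup_od _) (hr y hy).1 (od_sb (ssup_od _) ?_) y (hr y hy).2
  exact mem_ssup (mem_img.2 ⟨y, hy, rfl⟩) (hr y hy).1

theorem coll {R : M → M → Prop} [hR : Def (fun g => R (hd g) (hd (tl g)))] {a : M}
    (h : ∀ x, x ∈ₘ a → ∃ y, R x y) : ∃ b, ∀ x, x ∈ₘ a → ∃ y, y ∈ₘ b ∧ R x y := by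
  have : D2 R := ⟨hR⟩
  let r : M → M := fun x => lst (fun α => ∃ y, y ∈ₘ Vf α ∧ R x y)
  have hr : ∀ x, x ∈ₘ a → ∃ y, y ∈ₘ Vf (r x) ∧ R x y := fun x hx => by
    obtain ⟨y, hy⟩ := h x hx
    obtain ⟨α, h1, h2⟩ := Vf_all y
    exact (lst_spec (P := fun α => ∃ y, y ∈ₘ Vf α ∧ R x y) h1 ⟨y, h2, hy⟩).2.1
  have hT : Tm (fun g => Vf (r (hd g))) := inferInstance
  refine ⟨Un (img a (fun x => Vf (r x))), fun x hx => ?_⟩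
  obtain ⟨y, hy, hxy⟩ := hr x hx
  exact ⟨y, mem_Un.2 ⟨_, mem_img.2 ⟨x, hx, rfl⟩, hy⟩, hxy⟩

theorem ac_fun {R : M → M → Prop} [hR : Def (fun g => R (hd g) (hd (tl g)))] {a : M}
    (h : ∀ x, x ∈ₘ a → ∃ y, R x y) : ∃ f b, IsFuncE SetModel.E f a b ∧ ∀ x, x ∈ₘ a → R x (ap f x) := by
  have : D2 R := ⟨hR⟩
  obtain ⟨b, hb⟩ := coll h
  let H : M → M := fun x => sep (prd a b) (fun z => ∃ y, z = op x y ∧ R x y)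
  have hT : Tm (fun g => H (hd g)) := inferInstance
  have hH : ∀ x z, z ∈ₘ H x ↔ (z ∈ₘ prd a b ∧ ∃ y, z = op x y ∧ R x y) := fun x z => mem_sep
  obtain ⟨c, hc⟩ := (SetModel.zfc (M := M)).2.2.2 (img a H) (by
    intro x hx
    obtain ⟨x', hx', rfl⟩ := mem_img.1 hx
    obtain ⟨y, hy, hxy⟩ := hb x' hx'
    exact ⟨op x' y, (hH _ _).2 ⟨op_mem_prd.2 ⟨hx', hy⟩, y, rfl, hxy⟩⟩) (by
    intro x y hx hy hne
    obtain ⟨x', hx', rfl⟩ := mem_img.1 hx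
    obtain ⟨y', hy', rfl⟩ := mem_img.1 hy
    rintro ⟨z, hz1, hz2⟩
    obtain ⟨_, w, h1, _⟩ := (hH _ _).1 hz1
    obtain ⟨_, w', h2, _⟩ := (hH _ _).1 hz2
    rw [h1, op_eq] at h2
    exact hne (by rw [h2.1]))
  let f := sep c (fun z => ∃ x, x ∈ₘ a ∧ z ∈ₘ H x)
  have hf : ∀ z, z ∈ₘ f ↔ z ∈ₘ c ∧ ∃ x, x ∈ₘ a ∧ z ∈ₘ H x := fun z => mem_sep
  have key : ∀ x y, op x y ∈ₘ f → op x y ∈ₘ H x := by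
    intro x y h1
    obtain ⟨h1, x', _, h2⟩ := (hf _).1 h1
    have h3 := h2
    obtain ⟨_, y', h4, _⟩ := (hH _ _).1 h2
    rw [op_eq] at h4; rw [h4.1] at h3 ⊢; exact h3
  have hfun : IsFuncE SetModel.E f a b := by
    simp only [IsFuncE, opair_iff, pairMem_iff]
    constructor
    · intro p hp
      obtain ⟨h1, x, hx, h2⟩ := (hf _).1 hp
      obtain ⟨x, y, h3, h4, h5⟩ := mem_prd.1 ((hH _ _).1 h2).1
      exact ⟨x, y, h3, h4, h5⟩
    · intro x hx
      obtain ⟨z, hz, hz', hu⟩ := hc (H x) (mem_img.2 ⟨x, hx, rfl⟩)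
      obtain ⟨_, y, rfl, hxy⟩ := (hH _ _).1 hz'
      refine ⟨⟨y, (hf _).2 ⟨hz, x, hx, hz'⟩⟩, ?_⟩
      intro y1 y2 h1 h2
      have e1 := hu _ ((hf _).1 h1).1 (key _ _ h1)
      have e2 := hu _ ((hf _).1 h2).1 (key _ _ h2)
      rw [op_eq] at e1 e2; rw [e1.2, e2.2]
  refine ⟨f, b, hfun, fun x hx => ?_⟩
  have h1 := ((isFunc_iff.1 hfun).2 x hx).1
  obtain ⟨_, y, h2, h3⟩ := (hH _ _).1 (key _ _ h1)
  rw [op_eq] at h2; rw [h2.2]; exact h3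

/-- well-ordering theorem -/
theorem wo (X : M) : ∃ α f, Od α ∧ ∀ x, x ∈ₘ X → ∃ ζ, ζ ∈ₘ α ∧ ap f ζ = x := by
  obtain ⟨c, b, hc, hc'⟩ := ac_fun (R := fun s y => y ∈ₘ s) (a := sep (pw X) (fun s => ∃ y, y ∈ₘ s))
    (fun x hx => (mem_sep.1 hx).2)
  let F : M → M := rec (fun α f => ap c (sep X (fun x => ¬ ∃ β, β ∈ₘ α ∧ x = ap f β)))
  have hT : Tm (fun g => F (hd g)) := inferInstance
  have hF : ∀ α, Od α → F α = ap c (sep X (fun x => ¬ ∃ β, β ∈ₘ α ∧ x = F β)) := by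
    intro α hα
    have : F α = ap c (sep X (fun x => ¬ ∃ β, β ∈ₘ α ∧ x = ap (gr α F) β)) := rec_eq hα
    rw [this]
    congr 1
    refine sep_congr fun x hx => not_congr (exists_congr fun β => and_congr_right fun hβ => ?_)
    rw [ap_gr hβ]
  by_cases h : ∃ α, Od α ∧ ∀ x, x ∈ₘ X → ∃ β, β ∈ₘ α ∧ x = F β
  · obtain ⟨α, hα, h⟩ := h
    refine ⟨α, gr α F, hα, fun x hx => ?_⟩
    obtain ⟨β, hβ, rfl⟩ := h x hx
    exact ⟨β, hβ, ap_gr hβ⟩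
  · exfalso
    have h1 : ∀ α, Od α → F α ∈ₘ X ∧ ∀ β, β ∈ₘ α → F α ≠ F β := by
      intro α hα
      have : F α ∈ₘ sep X (fun x => ¬ ∃ β, β ∈ₘ α ∧ x = F β) := by
        rw [hF α hα]
        refine hc' _ (mem_sep.2 ⟨mem_pw.2 sep_sb, ?_⟩)
        by_contra hn
        refine h ⟨α, hα, fun x hx => ?_⟩
        by_contra hx'
        exact hn ⟨x, mem_sep.2 ⟨hx, hx'⟩⟩
      rw [mem_sep] at this
      exact ⟨this.1, fun β hβ he => this.2 ⟨β, hβ, he⟩⟩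
    obtain ⟨α, hα, hn⟩ := od_not_set (img X (fun x => lst (fun α => F α = x)))
    refine hn (mem_img.2 ⟨F α, (h1 α hα).1, ?_⟩)
    have h2 := lst_spec (P := fun β => F β = F α) hα rfl
    rcases od_tri hα h2.1 with h3 | h3 | h3
    · exact absurd rfl (h2.2.2 α h3)
    · exact h3
    · exact absurd h2.2.1.symm ((h1 α hα).2 _ h3)

theorem Un_suc {a : M} (h : Od a) : Un (suc a) = a := by
  apply ext; intro z
  rw [mem_Un]
  constructor
  · rintro ⟨y, hy, hz⟩
    rcases mem_suc.1 hy with hy | rfl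
    · exact od_tr h hy hz
    · exact hz
  · intro hz; exact ⟨a, self_suc a, hz⟩

theorem not_card_suc {δ : M} (hδ : Od δ) (ho : sb om δ) : ∃ f, BijE SetModel.E f δ (suc δ) := by
  classical
  let g : M → M := fun x => if x = emp then δ else if x ∈ₘ om then Un x else x
  have hT : Tm (fun e => g (hd e)) := inferInstance
  have g0 : g emp = δ := by simp [g]
  have g1 : ∀ n, n ∈ₘ om → g (suc n) = n := by
    intro n hn
    have h1 : suc n ≠ emp := fun h => mem_emp (z := n) (h ▸ self_suc n)
    have h2 := lm_suc om_lm hn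
    simp only [g, h1, h2, if_true, if_false]
    exact Un_suc (od_mem om_od hn)
  have g2 : ∀ x, ¬ x ∈ₘ om → g x = x := by
    intro x hx
    have h1 : x ≠ emp := fun h => hx (h ▸ lm_emp om_lm)
    simp only [g, h1, hx, if_false]
  have cs : ∀ x : M, x ∈ₘ om → x = emp ∨ ∃ n, n ∈ₘ om ∧ x = suc n := by
    intro x hx
    rcases od_cases (od_mem om_od hx) with h | ⟨n, _, h⟩ | h
    · exact Or.inl h
    · exact Or.inr ⟨n, od_tr om_od hx (h ▸ self_suc n), h⟩
    · exact absurd h (om_spec.2 x hx)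
  have cs' : ∀ x : M, x = emp ∨ (∃ n, n ∈ₘ om ∧ x = suc n) ∨ ¬ x ∈ₘ om := by
    intro x
    by_cases hx : x ∈ₘ om
    · rcases cs x hx with h | h
      · exact Or.inl h
      · exact Or.inr (Or.inl h)
    · exact Or.inr (Or.inr hx)
  have hfun : IsFuncE SetModel.E (gr δ g) δ (suc δ) := gr_isFunc fun x hx => by
    rcases cs' x with rfl | ⟨n, hn, rfl⟩ | h
    · rw [g0]; exact self_suc δ
    · rw [g1 n hn]; exact mem_suc.2 (Or.inl (ho n hn))
    · rw [g2 x h]; exact mem_suc.2 (Or.inl hx)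
  refine ⟨gr δ g, ⟨hfun, fun y hy => ?_⟩, hfun, fun x x' y hx hx' h1 h2 => ?_⟩
  · simp only [pairMem_iff, op_mem_gr]
    by_cases h1 : y ∈ₘ om
    · exact ⟨suc y, ho _ (lm_suc om_lm h1), ho _ (lm_suc om_lm h1), (g1 y h1).symm⟩
    · rcases mem_suc.1 hy with hy | rfl
      · exact ⟨y, hy, hy, (g2 y h1).symm⟩
      · exact ⟨emp, ho _ (lm_emp om_lm), ho _ (lm_emp om_lm), g0.symm⟩
  · rw [pairMem_iff, op_mem_gr] at h1 h2
    have h3 : g x = g x' := h1.2.symm.trans h2.2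
    have hn : ∀ n, n ∈ₘ om → n ≠ δ := fun n hn h => mem_irr n (ho n hn |> fun h' => by rw [← h] at h'; exact h')
    rcases cs' x with rfl | ⟨n, hn1, rfl⟩ | h <;> rcases cs' x' with rfl | ⟨m, hm1, rfl⟩ | h'
    · rfl
    · rw [g0, g1 m hm1] at h3; exact absurd h3.symm (hn m hm1)
    · rw [g0, g2 _ h'] at h3; rw [← h3] at hx'; exact absurd hx' (mem_irr _)
    · rw [g0, g1 n hn1] at h3; exact absurd h3 (hn n hn1)
    · rw [g1 n hn1, g1 m hm1] at h3; rw [h3]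
    · rw [g1 n hn1, g2 _ h'] at h3; rw [h3] at hn1; exact absurd hn1 h'
    · rw [g0, g2 _ h] at h3; rw [h3] at hx; exact absurd hx (mem_irr _)
    · rw [g1 m hm1, g2 _ h] at h3; rw [← h3] at hm1; exact absurd hm1 h
    · rwa [g2 _ h, g2 _ h'] at h3

theorem infCard_lm {κ : M} (h : InfCardE SetModel.E κ) : Lm κ := by
  obtain ⟨⟨h1, h2⟩, _, w, hw, hle⟩ := h
  rw [om_eq hw] at hle
  rcases hle with hle | rfl
  · rcases od_cases h1 with rfl | ⟨δ, hδ, rfl⟩ | h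
    · exact absurd hle mem_emp
    · exfalso
      refine h2 δ (self_suc δ) (not_card_suc hδ ?_)
      rw [od_le_iff om_od hδ]; exact mem_suc.1 hle
    · exact h
  · exact om_lm

theorem od_max {a b : M} (ha : Od a) (hb : Od b) : un a b = a ∨ un a b = b := by
  rcases od_tri ha hb with h | h | h
  · right; apply ext; intro z; rw [mem_un]
    exact ⟨fun h' => h'.elim (fun h' => od_tr hb h h') id, Or.inr⟩
  · left; rw [h]; apply ext; intro z; simp
  · left; apply ext; intro z; rw [mem_un]
    exact ⟨fun h' => h'.elim id (fun h' => od_tr ha h h'), Or.inl⟩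

theorem mem_suc_un {a b : M} (ha : Od a) (hb : Od b) : a ∈ₘ suc (un a b) ∧ b ∈ₘ suc (un a b) := by
  have := od_un ha hb
  constructor
  · rw [mem_suc, ← od_le_iff ha this]; intro z hz; exact mem_un.2 (Or.inl hz)
  · rw [mem_suc, ← od_le_iff hb this]; intro z hz; exact mem_un.2 (Or.inr hz)

theorem faint_of_pcs (h : ProperClassSubtleE (SetModel.E (M := M))) (Efam : M → M → Prop) [D2 Efam] :
    FaintForE SetModel.E Efam := by
  intro hE ξ hξ
  obtain ⟨κ, ⟨hκ, hs⟩, hξκ⟩ := h ξ hξ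
  have hl := infCard_lm hκ
  obtain ⟨f, b, hf, hf'⟩ := ac_fun (R := Efam) (a := κ) fun α hα => (hE α (od_mem hl.1 hα)).1
  have hf0 := (isFunc_iff.1 hf).2
  obtain ⟨α, β, hα, hβ, hαβ, A, B, hA, hB, hAB⟩ := hs f (by
      intro α hα
      simp only [pairMem_iff]
      exact ⟨⟨_, (hf0 α hα).1, (hE α (od_mem hl.1 hα)).2 _ (hf' α hα)⟩,
        fun A A' h1 h2 => ((hf0 α hα).2.2 A h1).trans ((hf0 α hα).2.2 A' h2).symm⟩)
    (sep κ (fun α => ξ ∈ₘ α)) (by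
      refine ⟨sep_sb, fun α hα => ?_, fun l hl' hw h => ?_⟩
      · have ho := od_mem hl.1 hα
        refine ⟨suc (un α ξ), mem_sep.2 ⟨lm_suc hl ?_, (mem_suc_un ho hξ).2⟩, (mem_suc_un ho hξ).1⟩
        rcases od_max ho hξ with h | h <;> rw [h] <;> assumption
      · refine mem_sep.2 ⟨hl', ?_⟩
        obtain ⟨w, hw⟩ := hw
        obtain ⟨β, h1, _, h3⟩ := h w hw
        exact od_tr (od_mem hl.1 hl') h3 (mem_sep.1 h1).2)
  rw [pairMem_iff] at hA hB
  obtain ⟨hα1, hα2⟩ := mem_sep.1 hα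
  obtain ⟨hβ1, hβ2⟩ := mem_sep.1 hβ
  refine ⟨α, β, B, A, od_mem hl.1 hα1, od_mem hl.1 hβ1, hα2, hαβ, ?_, hAB, ?_⟩
  · rw [(isFunc_op hf hB).2.2]; exact hf' β hβ1
  · rw [(isFunc_op hf hA).2.2]; exact hf' α hα1

end Hier
end Paper


namespace Paper
set_option linter.unusedSectionVars false
set_option linter.unusedVariables false
set_option linter.unusedSimpArgs false

section Coding
variable {M : Type} [SetModel M]

instance defNe {s t : (ℕ → M) → M} [Tm s] [Tm t] : Def (fun g => s g ≠ t g) :=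
  (inferInstance : Def (fun g => ¬ s g = t g))

/-- iteration of a function along the ordinals, starting at `δ` -/
noncomputable def itr (H : M → M) (δ a : M) : M :=
  rec (fun a f => un δ (Un (img a (fun b => H (ap f b))))) a
instance f2_itr {H : M → M} [F1 H] : F2 (itr H) := ⟨by unfold itr; infer_instance⟩

section itr
variable {H : M → M} [hH : F1 H]

theorem itr_eq {δ a : M} (h : Od a) : itr H δ a = un δ (Un (img a (fun b => H (itr H δ b)))) := by
  unfold itr
  rw [rec_eq h]
  congr 2
  exact img_congr fun x hx => by rw [ap_gr hx]

theorem mem_itr {δ a z : M} (h : Od a) : z ∈ₘ itr H δ a ↔ z ∈ₘ δ ∨ ∃ b, b ∈ₘ a ∧ z ∈ₘ H (itr H δ b) := by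
  rw [itr_eq h, mem_un, mem_Un]
  refine or_congr Iff.rfl ?_
  constructor
  · rintro ⟨y, hy, hz⟩
    obtain ⟨b, hb, rfl⟩ := mem_img.1 hy
    exact ⟨b, hb, hz⟩
  · rintro ⟨b, hb, hz⟩
    exact ⟨_, mem_img.2 ⟨b, hb, rfl⟩, hz⟩

theorem itr_od (h1 : ∀ y, Od y → Od (H y)) {δ : M} (hδ : Od δ) : ∀ a : M, Od a → Od (itr H δ a) := by
  refine od_ind (P := fun a : M => Od (itr H δ a)) ?_
  intro a ha ih
  rw [itr_eq ha]
  refine od_un hδ (od_Un fun x hx => ?_)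
  obtain ⟨b, hb, rfl⟩ := mem_img.1 hx
  exact h1 _ (ih b hb)

theorem itr_H {δ a b : M} (h : Od a) (hb : b ∈ₘ a) : sb (H (itr H δ b)) (itr H δ a) :=
  fun z hz => (mem_itr h).2 (Or.inr ⟨b, hb, hz⟩)

theorem itr_base {δ a : M} (h : Od a) : sb δ (itr H δ a) := fun z hz => (mem_itr h).2 (Or.inl hz)

theorem itr_lt (h1 : ∀ y, Od y → Od (H y)) (h2 : ∀ y, Od y → y ∈ₘ H y) {δ : M} (hδ : Od δ) {a b : M}
    (h : Od a) (hb : b ∈ₘ a) : itr H δ b ∈ₘ itr H δ a :=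
  itr_H h hb _ (h2 _ (itr_od h1 hδ b (od_mem h hb)))

theorem itr_ge (h1 : ∀ y, Od y → Od (H y)) (h2 : ∀ y, Od y → y ∈ₘ H y) {δ : M} (hδ : Od δ) :
    ∀ a : M, Od a → sb a (itr H δ a) := by
  refine od_ind (P := fun a : M => sb a (itr H δ a)) ?_
  intro a ha ih z hz
  have hz' := itr_od h1 hδ z (od_mem ha hz)
  exact od_lt_of_le_of_lt (itr_od h1 hδ a ha) (od_mem ha hz) (ih z hz) (itr_lt h1 h2 hδ ha hz)

theorem itr_inj (h1 : ∀ y, Od y → Od (H y)) (h2 : ∀ y, Od y → y ∈ₘ H y) {δ : M} (hδ : Od δ) {a b : M}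
    (h : Od a) (hb : Od b) (he : itr H δ a = itr H δ b) : a = b := by
  rcases od_tri h hb with h3 | h3 | h3
  · have := itr_lt h1 h2 hδ hb h3; rw [he] at this; exact absurd this (mem_irr _)
  · exact h3
  · have := itr_lt h1 h2 hδ h h3; rw [he] at this; exact absurd this (mem_irr _)

theorem itr_lm {δ a z : M} (h : Lm a) (hz : z ∈ₘ itr H δ a) : ∃ b, b ∈ₘ a ∧ z ∈ₘ itr H δ b := by
  rcases (mem_itr h.1).1 hz with h' | ⟨b, hb, h'⟩
  · exact ⟨emp, lm_emp h, itr_base od_emp _ h'⟩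
  · exact ⟨suc b, lm_suc h hb, itr_H (od_suc (od_mem h.1 hb)) (self_suc b) _ h'⟩

end itr

noncomputable def ss (x : M) : M := suc (suc x)
instance f1_ss : F1 (M := M) ss := ⟨by unfold ss; infer_instance⟩

theorem ss_od : ∀ y : M, Od y → Od (ss y) := fun y h => od_suc (od_suc h)
theorem ss_lt : ∀ y : M, Od y → y ∈ₘ ss y := fun y h => mem_suc.2 (Or.inl (self_suc y))

/-- the spreading function on ordinals -/
noncomputable def dd (a : M) : M := itr ss (suc emp) a
instance f1_dd : F1 (M := M) dd := ⟨by unfold dd; infer_instance⟩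

theorem dd_od {a : M} (h : Od a) : Od (dd a) := itr_od ss_od (od_suc od_emp) a h
theorem dd_lt {a b : M} (h : Od a) (hb : b ∈ₘ a) : dd b ∈ₘ dd a := itr_lt ss_od ss_lt (od_suc od_emp) h hb
theorem dd_suc_lt {a b : M} (h : Od a) (hb : b ∈ₘ a) : suc (dd b) ∈ₘ dd a :=
  itr_H h hb _ (self_suc _)
theorem dd_inj {a b : M} (h : Od a) (hb : Od b) (he : dd a = dd b) : a = b :=
  itr_inj ss_od ss_lt (od_suc od_emp) h hb he
theorem dd_pos {a : M} (h : Od a) : emp ∈ₘ dd a := itr_base h _ (self_suc _)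
theorem dd_ne_suc {a b : M} (h : Od a) (hb : Od b) : dd a ≠ suc (dd b) := by
  intro he
  rcases od_tri h hb with h3 | h3 | h3
  · have := dd_lt hb h3; rw [he] at this; exact mem_asymm this (self_suc _)
  · rw [h3] at he; exact mem_irr (dd b) (by conv_rhs => rw [he]
                                            exact self_suc _)
  · have := dd_suc_lt h h3; rw [he] at this; exact mem_irr _ this

theorem dd_lm : ∀ a : M, Od a → ∀ l, Lm l → a ∈ₘ l → dd a ∈ₘ l := by
  refine od_ind (P := fun a : M => ∀ l, Lm l → a ∈ₘ l → dd a ∈ₘ l) ?_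
  intro a ha ih l hl hal
  have key : ∀ m, Od m → m ∈ₘ l → sb (suc emp) m → (∀ b, b ∈ₘ a → sb (ss (dd b)) m) → dd a ∈ₘ l := by
    intro m hm hml h1 h2
    refine od_lt_of_le_of_lt hl.1 (dd_od ha) (fun z hz => ?_) hml
    rcases (mem_itr ha).1 hz with h | ⟨b, hb, h⟩
    · exact h1 _ h
    · exact h2 b hb _ h
  rcases od_cases ha with rfl | ⟨c, hc, rfl⟩ | h
  · exact key (suc emp) (od_suc od_emp) (lm_suc hl (lm_emp hl)) (sb_refl _) (fun b hb => absurd hb mem_emp)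
  · have hcl : c ∈ₘ l := od_tr hl.1 hal (self_suc c)
    have hcd := ih c (self_suc c) l hl hcl
    refine key (ss (dd c)) (ss_od _ (dd_od hc)) (lm_suc hl (lm_suc hl hcd)) ?_ ?_
    · intro z hz
      rcases mem_suc.1 hz with hz | rfl
      · exact absurd hz mem_emp
      · exact od_tr (ss_od _ (dd_od hc)) (ss_lt _ (dd_od hc)) (dd_pos hc)
    · intro b hb
      rcases mem_suc.1 hb with hb | rfl
      · have h3 := suc_lt (od_suc (dd_od hc)) (suc_lt (dd_od hc) (dd_lt hc hb))
        exact od_sb (ss_od _ (dd_od hc)) h3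
      · exact sb_refl _
  · refine key a ha hal ?_ ?_
    · exact od_sb ha (lm_suc h (lm_emp h))
    · intro b hb
      have := ih b hb a h hb
      exact od_sb ha (lm_suc h (lm_suc h this))

noncomputable def code (A L : M) : M := un (img A dd) (img L (fun x => suc (dd x)))
instance f2_code : F2 (M := M) code := ⟨by unfold code; infer_instance⟩

theorem mem_code {A L z : M} : z ∈ₘ code A L ↔ (∃ a, a ∈ₘ A ∧ z = dd a) ∨ ∃ a, a ∈ₘ L ∧ z = suc (dd a) := by
  unfold code; rw [mem_un, mem_img, mem_img]

theorem code_sb {A L α : M} (h : Lm α) (hA : sb A α) (hL : sb L α) : sb (code A L) α := by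
  intro z hz
  rcases mem_code.1 hz with ⟨a, ha, rfl⟩ | ⟨a, ha, rfl⟩
  · exact dd_lm a (od_mem h.1 (hA a ha)) α h (hA a ha)
  · exact lm_suc h (dd_lm a (od_mem h.1 (hL a ha)) α h (hL a ha))

theorem code_zero {A L α : M} (h : Od α) (hA : sb A α) (hL : sb L α) : ¬ emp ∈ₘ code A L := by
  intro hz
  rcases mem_code.1 hz with ⟨a, ha, h1⟩ | ⟨a, ha, h1⟩
  · have := dd_pos (od_mem h (hA a ha)); rw [← h1] at this; exact mem_emp this
  · have := self_suc (dd a); rw [← h1] at this; exact mem_emp this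

theorem dd_mem_code {A L α a : M} (h : Od α) (hA : sb A α) (hL : sb L α) (ha : Od a) :
    dd a ∈ₘ code A L ↔ a ∈ₘ A := by
  rw [mem_code]
  constructor
  · rintro (⟨b, hb, h1⟩ | ⟨b, hb, h1⟩)
    · rw [dd_inj ha (od_mem h (hA b hb)) h1]; exact hb
    · exact absurd h1 (dd_ne_suc ha (od_mem h (hL b hb)))
  · intro h; exact Or.inl ⟨a, h, rfl⟩

theorem sdd_mem_code {A L α a : M} (h : Od α) (hA : sb A α) (hL : sb L α) (ha : Od a) :
    suc (dd a) ∈ₘ code A L ↔ a ∈ₘ L := by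
  rw [mem_code]
  constructor
  · rintro (⟨b, hb, h1⟩ | ⟨b, hb, h1⟩)
    · exact absurd h1.symm (dd_ne_suc (od_mem h (hA b hb)) ha)
    · rw [dd_inj ha (od_mem h (hL b hb)) (suc_inj h1)]; exact hb
  · intro h; exact Or.inr ⟨a, h, rfl⟩

theorem code_inter {A L B K α β : M} (hα : Lm α) (hβ : Od β) (hA : sb A β) (hL : sb L β)
    (hB : sb B α) (hK : sb K α) (h : code B K = inter (code A L) α) :
    B = inter A α ∧ ∀ a, a ∈ₘ α → (a ∈ₘ K ↔ a ∈ₘ L) := by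
  constructor
  · apply ext; intro a
    rw [mem_inter]
    constructor
    · intro ha
      have ho := od_mem hα.1 (hB a ha)
      have := (dd_mem_code hα.1 hB hK ho).2 ha
      rw [h, mem_inter] at this
      exact ⟨(dd_mem_code hβ hA hL ho).1 this.1, hB a ha⟩
    · rintro ⟨h1, h2⟩
      have ho := od_mem hα.1 h2
      have := (dd_mem_code hβ hA hL ho).2 h1
      refine (dd_mem_code hα.1 hB hK ho).1 ?_
      rw [h, mem_inter]
      exact ⟨this, dd_lm a ho α hα h2⟩
  · intro a h2
    have ho := od_mem hα.1 h2
    rw [← sdd_mem_code hα.1 hB hK ho, ← sdd_mem_code hβ hA hL ho, h, mem_inter]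
    exact ⟨fun h => h.1, fun h => ⟨h, lm_suc hα (dd_lm a ho α hα h2)⟩⟩

/-- the combined family -/
def comb (U : M → Prop) (lab : M → M) (T : M → M → Prop) (Sf : M → M → M → Prop) (α B : M) : Prop :=
  (U α ∧ ∃ A, T α A ∧ B = code A emp) ∨
    (¬ U α ∧ ∃ A, Sf (lab α) α A ∧ B = code A (upair emp (suc (lab α))))

instance d2_comb {U : M → Prop} {lab : M → M} {T : M → M → Prop} {Sf : M → M → M → Prop}
    [D1 U] [F1 lab] [D2 T] [D3 Sf] : D2 (comb U lab T Sf) := ⟨by unfold comb; infer_instance⟩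

theorem emp_sb (a : M) : sb emp a := fun z hz => absurd hz mem_emp
theorem lab_sb {α l : M} (h : Lm α) (hl : l ∈ₘ α) : sb (upair emp (suc l)) α := by
  intro z hz
  rcases mem_upair.1 hz with rfl | rfl
  · exact lm_emp h
  · exact lm_suc h hl

theorem comb_form {U : M → Prop} {lab : M → M} {T : M → M → Prop} {Sf : M → M → M → Prop} {α B : M}
    (hα : Lm α) (h1 : U α → ∀ A, T α A → sb A α)
    (h2 : ¬ U α → lab α ∈ₘ α ∧ ∀ A, Sf (lab α) α A → sb A α) (h : comb U lab T Sf α B) :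
    ∃ A L, B = code A L ∧ sb A α ∧ sb L α := by
  rcases h with ⟨hU, A, hT, rfl⟩ | ⟨hU, A, hT, rfl⟩
  · exact ⟨A, emp, rfl, h1 hU A hT, emp_sb _⟩
  · exact ⟨A, _, rfl, (h2 hU).2 A hT, lab_sb hα (h2 hU).1⟩

theorem comb_no {U : M → Prop} {lab : M → M} {T : M → M → Prop} {Sf : M → M → M → Prop} {α β A B : M}
    (hα : Lm α) (hβ : Lm β) (hαβ : α ∈ₘ β)
    (h1 : ∀ γ, γ = α ∨ γ = β → U γ → ∀ A, T γ A → sb A γ)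
    (h2 : ∀ γ, γ = α ∨ γ = β → ¬ U γ → lab γ ∈ₘ γ ∧ ∀ A, Sf (lab γ) γ A → sb A γ)
    (h3 : U α → U β → ∀ A B, T β A → T α B → B ≠ inter A α)
    (h4 : ¬ U α → ¬ U β → lab α = lab β → ∀ A B, Sf (lab α) β A → Sf (lab α) α B → B ≠ inter A α)
    (hA : comb U lab T Sf β A) (hB : comb U lab T Sf α B) : B ≠ inter A α := by
  intro he
  have i1 := h1 α (Or.inl rfl)
  have i2 := h2 α (Or.inl rfl)
  have j1 := h1 β (Or.inr rfl)
  have j2 := h2 β (Or.inr rfl)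
  rcases hA with ⟨hUb, A, hA, rfl⟩ | ⟨hUb, A, hA, rfl⟩ <;>
  rcases hB with ⟨hUa, B, hB, rfl⟩ | ⟨hUa, B, hB, rfl⟩
  · exact h3 hUa hUb A B hA hB (code_inter hα hβ.1 (j1 hUb A hA) (emp_sb _) (i1 hUa B hB) (emp_sb _) he).1
  · have := (code_inter hα hβ.1 (j1 hUb A hA) (emp_sb _) ((i2 hUa).2 B hB) (lab_sb hα (i2 hUa).1) he).2
      emp (lm_emp hα)
    exact mem_emp (this.1 (mem_upair.2 (Or.inl rfl)))
  · have := (code_inter hα hβ.1 ((j2 hUb).2 A hA) (lab_sb hβ (j2 hUb).1) (i1 hUa B hB) (emp_sb _) he).2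
      emp (lm_emp hα)
    exact mem_emp (this.2 (mem_upair.2 (Or.inl rfl)))
  · obtain ⟨k1, k2⟩ := code_inter hα hβ.1 ((j2 hUb).2 A hA) (lab_sb hβ (j2 hUb).1)
      ((i2 hUa).2 B hB) (lab_sb hα (i2 hUa).1) he
    have h5 := (k2 _ (lm_suc hα (i2 hUa).1)).1 (mem_upair.2 (Or.inr rfl))
    rcases mem_upair.1 h5 with h5 | h5
    · exact mem_emp (h5 ▸ self_suc (lab α) : lab α ∈ₘ emp)
    · have h6 := suc_inj h5
      rw [← h6] at hA
      exact h4 hUa hUb h6 A B hA hB k1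

/-- `s` codes a family on the limit ordinals between `ξ` and `θ` without coincidences -/
def Good (s ξ θ : M) : Prop :=
  (∀ α, α ∈ₘ θ → ξ ∈ₘ α → Lm α → ∃ A, op α A ∈ₘ s) ∧ (∀ α A, op α A ∈ₘ s → sb A α) ∧
  ∀ α β A B, α ∈ₘ β → β ∈ₘ θ → ξ ∈ₘ α → Lm α → Lm β → op β A ∈ₘ s → op α B ∈ₘ s → B ≠ inter A α
set_option synthInstance.maxSize 1000 in
set_option synthInstance.maxHeartbeats 400000 in
instance d3_Good : D3 (M := M) Good := ⟨by unfold Good; infer_instance⟩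

theorem good_of {ξ θ : M} (R : M → M → Prop) [D2 R] (hθ : Od θ)
    (h1 : ∀ α, α ∈ₘ θ → ξ ∈ₘ α → Lm α → ∃ A, R α A)
    (h2 : ∀ α, α ∈ₘ θ → ξ ∈ₘ α → Lm α → ∀ A, R α A → sb A α)
    (h3 : ∀ α β A B, α ∈ₘ β → β ∈ₘ θ → ξ ∈ₘ α → Lm α → Lm β → R β A → R α B → B ≠ inter A α) :
    ∃ s, Good s ξ θ := by
  let s := sep (prd θ (pw θ)) (fun z => ∃ α B, z = op α B ∧ ξ ∈ₘ α ∧ Lm α ∧ R α B)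
  have hs : ∀ α B, op α B ∈ₘ s ↔ (α ∈ₘ θ ∧ sb B θ) ∧ ξ ∈ₘ α ∧ Lm α ∧ R α B := by
    intro α B
    rw [mem_sep, op_mem_prd, mem_pw]
    refine and_congr Iff.rfl ?_
    constructor
    · rintro ⟨a, b, h, h'⟩
      obtain ⟨rfl, rfl⟩ := op_inj h
      exact h'
    · intro h; exact ⟨α, B, rfl, h⟩
  refine ⟨s, fun α hα hξ hl => ?_, fun α A h => ?_, fun α β A B h4 h5 h6 h7 h8 h9 h10 => ?_⟩
  · obtain ⟨A, hA⟩ := h1 α hα hξ hl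
    exact ⟨A, (hs _ _).2 ⟨⟨hα, fun z hz => od_tr hθ hα (h2 α hα hξ hl A hA z hz)⟩, hξ, hl, hA⟩⟩
  · obtain ⟨⟨h4, _⟩, h5, h6, h7⟩ := (hs _ _).1 h
    exact h2 α h4 h5 h6 A h7
  · exact h3 α β A B h4 h5 h6 h7 h8 ((hs _ _).1 h9).2.2.2 ((hs _ _).1 h10).2.2.2

theorem comb_good {ξ θ : M} (hθ : Od θ) (U : M → Prop) (lab : M → M) (T : M → M → Prop)
    (Sf : M → M → M → Prop) [hU : Def (fun g => U (hd g))] [hlab : Tm (fun g => lab (hd g))]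
    [hT : Def (fun g => T (hd g) (hd (tl g)))] [hSf : Def (fun g => Sf (hd g) (hd (tl g)) (hd (tl (tl g))))]
    (h1 : ∀ α, α ∈ₘ θ → ξ ∈ₘ α → Lm α → U α → (∃ A, T α A) ∧ ∀ A, T α A → sb A α)
    (h2 : ∀ α, α ∈ₘ θ → ξ ∈ₘ α → Lm α → ¬ U α → lab α ∈ₘ α ∧ (∃ A, Sf (lab α) α A) ∧ ∀ A, Sf (lab α) α A → sb A α)
    (h3 : ∀ α β, α ∈ₘ β → β ∈ₘ θ → ξ ∈ₘ α → Lm α → Lm β → U α → U β → ∀ A B, T β A → T α B → B ≠ inter A α)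
    (h4 : ∀ α β, α ∈ₘ β → β ∈ₘ θ → ξ ∈ₘ α → Lm α → Lm β → ¬ U α → ¬ U β → lab α = lab β →
      ∀ A B, Sf (lab α) β A → Sf (lab α) α B → B ≠ inter A α) :
    ∃ s, Good s ξ θ := by
  have : D1 U := ⟨hU⟩
  have : F1 lab := ⟨hlab⟩
  have : D2 T := ⟨hT⟩
  have : D3 Sf := ⟨hSf⟩
  refine good_of (comb U lab T Sf) hθ ?_ ?_ ?_
  · intro α hα hξ hl
    by_cases hU : U α
    · obtain ⟨⟨A, hA⟩, _⟩ := h1 α hα hξ hl hU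
      exact ⟨_, Or.inl ⟨hU, A, hA, rfl⟩⟩
    · obtain ⟨_, ⟨A, hA⟩, _⟩ := h2 α hα hξ hl hU
      exact ⟨_, Or.inr ⟨hU, A, hA, rfl⟩⟩
  · intro α hα hξ hl A hA
    obtain ⟨A, L, rfl, h5, h6⟩ := comb_form hl (fun hU => (h1 α hα hξ hl hU).2)
      (fun hU => ⟨(h2 α hα hξ hl hU).1, (h2 α hα hξ hl hU).2.2⟩) hA
    exact code_sb hl h5 h6
  · intro α β A B h5 h6 h7 h8 h9 h10 h11
    have hαθ := od_tr hθ h6 h5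
    have hξβ := od_tr (od_mem hθ h6) h5 h7
    refine comb_no h8 h9 h5 ?_ ?_ (h3 α β h5 h6 h7 h8 h9) (h4 α β h5 h6 h7 h8 h9) h10 h11
    · rintro γ (rfl | rfl) hU
      · exact (h1 _ hαθ h7 h8 hU).2
      · exact (h1 _ h6 hξβ h9 hU).2
    · rintro γ (rfl | rfl) hU
      · exact ⟨(h2 _ hαθ h7 h8 hU).1, (h2 _ hαθ h7 h8 hU).2.2⟩
      · exact ⟨(h2 _ h6 hξβ h9 hU).1, (h2 _ h6 hξβ h9 hU).2.2⟩

end Coding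
end Paper


namespace Paper
set_option linter.unusedSectionVars false
set_option linter.unusedVariables false
set_option linter.unusedSimpArgs false

section GoodEx
variable {M : Type} [SetModel M]

set_option synthInstance.maxSize 1000
set_option synthInstance.maxHeartbeats 400000

theorem Good.mono {s ξ θ θ' : M} (h : Good s ξ θ) (h' : sb θ' θ) : Good s ξ θ' :=
  ⟨fun α hα => h.1 α (h' α hα), h.2.1, fun α β A B h1 h2 => h.2.2 α β A B h1 (h' β h2)⟩

theorem good_suc {ξ δ : M} (hδ : Od δ) (h : ∃ s, Good s ξ δ) : ∃ s, Good s ξ (suc δ) := by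
  obtain ⟨s, hs⟩ := h
  refine comb_good (od_suc hδ) (fun α => α = δ) (fun _ => emp) (fun _ A => A = emp) (fun _ α A => op α A ∈ₘ s) ?_ ?_ ?_ ?_
  · intro α _ _ _ _
    exact ⟨⟨emp, rfl⟩, by rintro A rfl; exact emp_sb _⟩
  · intro α h1 h2 h3 h4
    have h5 : α ∈ₘ δ := (mem_suc.1 h1).resolve_right h4
    exact ⟨lm_emp h3, hs.1 α h5 h2 h3, fun A hA => hs.2.1 _ _ hA⟩
  · rintro α β h1 h2 h3 h4 h5 rfl rfl
    exact absurd h1 (mem_irr _)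
  · intro α β h1 h2 h3 h4 h5 h6 h7 _ A B hA hB
    exact hs.2.2 α β A B h1 ((mem_suc.1 h2).resolve_right h7) h3 h4 h5 hA hB

theorem good_sing {ξ θ γ g : M} (hθ : Lm θ) (hγ : γ ∈ₘ θ) (hg : IsFuncE SetModel.E g γ θ)
    (hcf : ∀ β, β ∈ₘ θ → ∃ ζ, ζ ∈ₘ γ ∧ sb β (ap g ζ)) (ih : ∀ b, b ∈ₘ θ → ∃ s, Good s ξ b) :
    ∃ s, Good s ξ θ := by
  have hg' := (isFunc_iff.1 hg).2
  obtain ⟨s, hs⟩ := ih _ (lm_suc hθ hγ)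
  obtain ⟨F, b, _, hF⟩ := ac_fun (R := fun ζ s => Good s ξ (ap g ζ)) (a := γ)
    fun ζ hζ => ih _ (hg' ζ hζ).2.1
  have oγ := od_mem hθ.1 hγ
  let lab : M → M := fun α => lst (fun ζ => ζ ∈ₘ γ ∧ α ∈ₘ ap g ζ)
  have hlab : F1 lab := ⟨inferInstance⟩
  have hl : ∀ α, α ∈ₘ θ → lab α ∈ₘ γ ∧ α ∈ₘ ap g (lab α) := by
    intro α hα
    obtain ⟨ζ, h1, h2⟩ := hcf _ (lm_suc hθ hα)
    exact (lst_spec (P := fun ζ => ζ ∈ₘ γ ∧ α ∈ₘ ap g ζ) (od_mem oγ h1) ⟨h1, h2 _ (self_suc α)⟩).2.1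
  refine comb_good hθ.1 (fun α => α ∈ₘ suc γ) lab (fun α A => op α A ∈ₘ s) (fun l α A => op α A ∈ₘ ap F l) ?_ ?_ ?_ ?_
  · intro α h1 h2 h3 h4
    exact ⟨hs.1 α h4 h2 h3, hs.2.1 α⟩
  · intro α h1 h2 h3 h4
    obtain ⟨h5, h6⟩ := hl α h1
    have hG := hF _ h5
    refine ⟨?_, hG.1 α h6 h2 h3, hG.2.1 α⟩
    have := (od_not_lt h3.1 (od_suc oγ)).1 h4
    exact this _ (mem_suc.2 (Or.inl h5))
  · intro α β h1 h2 h3 h4 h5 h6 h7 A B hA hB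
    exact hs.2.2 α β A B h1 h7 h3 h4 h5 hA hB
  · intro α β h1 h2 h3 h4 h5 h6 h7 h8 A B hA hB
    obtain ⟨h9, h10⟩ := hl β h2
    rw [← h8] at h9 h10
    exact (hF _ h9).2.2 α β A B h1 h10 h3 h4 h5 hA hB

/-- the club analysis shared by the set version and the class version -/
theorem club_lab {C : M → Prop} [D1 C] {α : M} (hα : Lm α) (hC : ∀ x, C x → Od x)
    (hcl : (∀ a, a ∈ₘ α → ∃ β, C β ∧ a ∈ₘ β ∧ β ∈ₘ α) → C α) (hn : ¬ C α) :
    Un (sep α C) ∈ₘ α ∧ ∀ e, C e → Un (sep α C) ∈ₘ e → α ∈ₘ e := by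
  have ho : Od (Un (sep α C)) := od_Un fun x hx => hC x (mem_sep.1 hx).2
  constructor
  · by_contra hcon
    refine hn (hcl fun a ha => ?_)
    by_contra hno
    have : sb (Un (sep α C)) a := by
      intro z hz
      obtain ⟨y, hy, hzy⟩ := mem_Un.1 hz
      obtain ⟨hy1, hy2⟩ := mem_sep.1 hy
      have : ¬ a ∈ₘ y := fun h => hno ⟨y, hy2, h, hy1⟩
      exact (od_not_lt (od_mem hα.1 ha) (hC y hy2)).1 this _ hzy
    exact hcon (od_lt_of_le_of_lt hα.1 ho this ha)
  · intro e he h1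
    rcases od_tri hα.1 (hC e he) with h | h | h
    · exact h
    · subst h; exact absurd he hn
    · exfalso
      have : sb e (Un (sep α C)) := fun z hz => mem_Un.2 ⟨e, mem_sep.2 ⟨h, he⟩, hz⟩
      exact mem_irr _ (this _ h1)

theorem good_reg {ξ θ f c : M} (hθ : Lm θ) (hf : SeqSpecE SetModel.E f θ) (hc : ClubInE SetModel.E c θ)
    (hno : ¬ ∃ α β, α ∈ₘ c ∧ β ∈ₘ c ∧ α ∈ₘ β ∧
      ∃ A B, PairMemE SetModel.E f α A ∧ PairMemE SetModel.E f β B ∧ InterSpecE SetModel.E A B α)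
    (ih : ∀ b, b ∈ₘ θ → ∃ s, Good s ξ b) : ∃ s, Good s ξ θ := by
  simp only [pairMem_iff, inter_spec] at hno
  simp only [SeqSpecE, pairMem_iff] at hf
  obtain ⟨hc1, hc2, hc3⟩ := hc
  have hcO : ∀ x, x ∈ₘ c → Od x := fun x hx => od_mem hθ.1 (hc1 x hx)
  let η : M → M := fun l => lst (fun e => e ∈ₘ c ∧ l ∈ₘ e)
  have hη' : F1 η := ⟨inferInstance⟩
  have hη : ∀ l, l ∈ₘ θ → η l ∈ₘ c ∧ l ∈ₘ η l := by
    intro l hl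
    obtain ⟨e, h1, h2⟩ := hc2 l hl
    exact (lst_spec (P := fun e => e ∈ₘ c ∧ l ∈ₘ e) (hcO e h1) ⟨h1, h2⟩).2.1
  obtain ⟨F, b, _, hF⟩ := ac_fun (R := fun l s => Good s ξ (η l)) (a := θ)
    fun l hl => ih _ (hc1 _ (hη l hl).1)
  have key : ∀ α, α ∈ₘ θ → Lm α → ¬ α ∈ₘ c → Un (sep α (fun x => x ∈ₘ c)) ∈ₘ α ∧
      α ∈ₘ η (Un (sep α (fun x => x ∈ₘ c))) := by
    intro α hα hl hn
    have : D1 (fun x : M => x ∈ₘ c) := ⟨inferInstance⟩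
    obtain ⟨h1, h2⟩ := club_lab (C := fun x => x ∈ₘ c) hl hcO (fun h => hc3 α hα hl.2.1 h) hn
    obtain ⟨h3, h4⟩ := hη _ (od_tr hθ.1 hα h1)
    exact ⟨h1, h2 _ h3 h4⟩
  have hF1 : F1 (fun α : M => Un (sep α (fun x => x ∈ₘ c))) := ⟨inferInstance⟩
  refine comb_good hθ.1 (fun α => α ∈ₘ c) (fun α => Un (sep α (fun x => x ∈ₘ c)))
    (fun α A => op α A ∈ₘ f) (fun l α A => op α A ∈ₘ ap F l) ?_ ?_ ?_ ?_
  · intro α h1 h2 h3 h4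
    obtain ⟨⟨A, h5, h6⟩, h7⟩ := hf α h1
    exact ⟨⟨A, h5⟩, fun A' h8 => h7 A A' h5 h8 ▸ h6⟩
  · intro α h1 h2 h3 h4
    obtain ⟨h5, h6⟩ := key α h1 h3 h4
    have hG := hF _ (od_tr hθ.1 h1 h5)
    exact ⟨h5, hG.1 α h6 h2 h3, hG.2.1 α⟩
  · intro α β h1 h2 h3 h4 h5 h6 h7 A B hA hB he
    exact hno ⟨α, β, h6, h7, h1, B, A, hB, hA, he⟩
  · intro α β h1 h2 h3 h4 h5 h6 h7 h8 A B hA hB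
    obtain ⟨h9, h10⟩ := key β h2 h5 h7
    rw [← h8] at h9 h10
    exact (hF _ (od_tr hθ.1 h2 h9)).2.2 α β A B h1 h10 h3 h4 h5 hA hB

theorem good_ex {ξ : M} (hξ : Od ξ) (hns : ∀ κ, ξ ∈ₘ κ → ¬ SubtleE SetModel.E κ) :
    ∀ θ : M, Od θ → ∃ s, Good s ξ θ := by
  refine od_ind (P := fun θ : M => ∃ s, Good s ξ θ) ?_
  intro θ hθ ih
  rcases od_cases hθ with rfl | ⟨δ, hδ, rfl⟩ | hl
  · exact ⟨emp, fun α h => absurd h mem_emp, fun α A h => absurd h mem_emp,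
      fun α β A B _ h => absurd h mem_emp⟩
  · exact good_suc hδ (ih δ (self_suc δ))
  · by_cases hξθ : ξ ∈ₘ θ
    · by_cases hs : ∃ γ g, γ ∈ₘ θ ∧ IsFuncE SetModel.E g γ θ ∧ ∀ β, β ∈ₘ θ → ∃ ζ, ζ ∈ₘ γ ∧ sb β (ap g ζ)
      · obtain ⟨γ, g, h1, h2, h3⟩ := hs
        exact good_sing hl h1 h2 h3 ih
      · have hcard : InfCardE SetModel.E θ := by
          refine ⟨⟨hθ, ?_⟩, hθ, om, om_spec, ?_⟩
          · rintro α hα ⟨f, hf⟩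
            refine hs ⟨α, f, hα, hf.1.1, fun β hβ => ?_⟩
            obtain ⟨x, hx, hxy⟩ := hf.1.2 β hβ
            rw [pairMem_iff] at hxy
            refine ⟨x, hx, ?_⟩
            rw [← (isFunc_op hf.1.1 hxy).2.2]; exact sb_refl β
          · exact (od_le_iff om_od hθ).1 (om_le_lm hl)
        have := hns θ hξθ
        unfold SubtleE at this
        push Not at this
        obtain ⟨f, hf, c, hc, hno⟩ := this hcard
        refine good_reg hl hf hc ?_ ih
        rintro ⟨α, β, h1, h2, h3, A, B, h4, h5, h6⟩
        exact hno α β h1 h2 h3 A B h4 h5 h6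
    · refine ⟨emp, fun α h h' => absurd (od_tr hθ h h') hξθ, fun α A h => absurd h mem_emp,
      fun α β A B _ _ _ _ _ h => absurd h mem_emp⟩

end GoodEx
end Paper


namespace Paper
set_option linter.unusedSectionVars false
set_option linter.unusedVariables false
set_option linter.unusedSimpArgs false

section Inner
variable {M : Type} [SetModel M]

set_option synthInstance.maxSize 1000
set_option synthInstance.maxHeartbeats 400000

/-- ordinal addition -/
noncomputable def oad (δ x : M) : M := itr suc δ x
instance f2_oad : F2 (M := M) oad := ⟨by unfold oad; infer_instance⟩

theorem sucl : ∀ y : M, Od y → y ∈ₘ suc y := fun y _ => self_suc y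
theorem sucod : ∀ y : M, Od y → Od (suc y) := fun _ h => od_suc h
theorem oad_od {δ x : M} (h : Od δ) (hx : Od x) : Od (oad δ x) := itr_od sucod h x hx
theorem oad_lt {δ x y : M} (h : Od δ) (hx : Od x) (hy : y ∈ₘ x) : oad δ y ∈ₘ oad δ x := itr_lt sucod sucl h hx hy
theorem oad_base {δ x : M} (hx : Od x) : sb δ (oad δ x) := itr_base hx
theorem oad_inj {δ x y : M} (h : Od δ) (hx : Od x) (hy : Od y) (he : oad δ x = oad δ y) : x = y :=
  itr_inj sucod sucl h hx hy he

noncomputable def stp (y : M) : M := oad y (ss (dd y))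
instance f1_stp : F1 (M := M) stp := ⟨by unfold stp; infer_instance⟩
theorem stp_od : ∀ y : M, Od y → Od (stp y) := fun y h => oad_od h (ss_od _ (dd_od h))
theorem stp_lt : ∀ y : M, Od y → y ∈ₘ stp y := fun y h => by
  have h1 := ss_od _ (dd_od h)
  have h2 : emp ∈ₘ ss (dd y) := od_tr h1 (ss_lt _ (dd_od h)) (dd_pos h)
  exact od_lt_of_le_of_lt (stp_od y h) h (oad_base od_emp) (oad_lt h h1 h2)

noncomputable def blk (m : M) : M := itr stp emp m
instance f1_blk : F1 (M := M) blk := ⟨by unfold blk; infer_instance⟩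
theorem blk_od {m : M} (h : Od m) : Od (blk m) := itr_od stp_od od_emp m h
theorem blk_ge {m : M} (h : Od m) : sb m (blk m) := itr_ge stp_od stp_lt od_emp m h
theorem blk_stp {m m' : M} (h : Od m') (hm : m ∈ₘ m') : sb (stp (blk m)) (blk m') := itr_H h hm

theorem blk_inj {m m' x x' : M} (hm : Od m) (hm' : Od m') (hx : x ∈ₘ ss (dd (blk m))) (hx' : x' ∈ₘ ss (dd (blk m')))
    (he : oad (blk m) x = oad (blk m') x') : m = m' ∧ x = x' := by
  have aux : ∀ {m m' x x' : M}, Od m → Od m' → x ∈ₘ ss (dd (blk m)) → x' ∈ₘ ss (dd (blk m')) →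
      oad (blk m) x = oad (blk m') x' → ¬ m ∈ₘ m' := by
    intro m m' x x' hm hm' hx hx' he h
    have h1 : oad (blk m) x ∈ₘ stp (blk m) := oad_lt (blk_od hm) (ss_od _ (dd_od (blk_od hm))) hx
    have h2 := blk_stp hm' h _ h1
    have h3 := oad_base (δ := blk m') (od_mem (ss_od _ (dd_od (blk_od hm'))) hx') _ h2
    rw [he] at h3
    exact mem_irr _ h3
  have : m = m' := by
    rcases od_tri hm hm' with h | h | h
    · exact absurd h (aux hm hm' hx hx' he)
    · exact h
    · exact absurd h (aux hm' hm hx' hx he.symm)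
  subst this
  exact ⟨rfl, oad_inj (blk_od hm) (od_mem (ss_od _ (dd_od (blk_od hm))) hx) (od_mem (ss_od _ (dd_od (blk_od hm))) hx') he⟩

open Classical in
noncomputable def J0 (b c : M) : M := if sb b c then oad (blk c) (dd b) else oad (blk b) (suc (dd c))
instance f2_J0 : F2 (M := M) J0 := ⟨by unfold J0; infer_instance⟩
/-- a definable injective pairing function on the ordinals -/
noncomputable def J (b c : M) : M := suc (J0 b c)
instance f2_J : F2 (M := M) J := ⟨by unfold J; infer_instance⟩

theorem dd_le {a b : M} (ha : Od a) (hb : Od b) (h : sb a b) : sb (dd a) (dd b) := by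
  rcases (od_le_iff ha hb).1 h with h | rfl
  · exact od_sb (dd_od hb) (dd_lt hb h)
  · exact sb_refl _

theorem blk_m1 {b m : M} (hb : Od b) (hm : Od m) (h : sb b m) : dd b ∈ₘ ss (dd (blk m)) := by
  have h1 : sb (dd b) (dd (blk m)) := dd_le hb (blk_od hm) (fun z hz => blk_ge hm z (h z hz))
  exact od_lt_of_le_of_lt (ss_od _ (dd_od (blk_od hm))) (dd_od hb) h1 (ss_lt _ (dd_od (blk_od hm)))
theorem blk_m2 {b m : M} (hb : Od b) (hm : Od m) (h : sb b m) : suc (dd b) ∈ₘ ss (dd (blk m)) := by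
  have h1 : sb (dd b) (dd (blk m)) := dd_le hb (blk_od hm) (fun z hz => blk_ge hm z (h z hz))
  exact suc_lt (od_suc (dd_od (blk_od hm))) (od_lt_of_le_of_lt (od_suc (dd_od (blk_od hm))) (dd_od hb) h1 (self_suc _))

theorem J0_inj {b c b' c' : M} (hb : Od b) (hc : Od c) (hb' : Od b') (hc' : Od c') (he : J0 b c = J0 b' c') :
    b = b' ∧ c = c' := by
  unfold J0 at he
  have nle : ∀ {x y : M}, Od x → Od y → ¬ sb x y → sb y x := by
    intro x y hx hy h
    rcases od_tri hx hy with h1 | rfl | h1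
    · exact absurd (od_sb hy h1) h
    · exact sb_refl _
    · exact od_sb hx h1
  split_ifs at he with h1 h2 h2
  · obtain ⟨h3, h4⟩ := blk_inj hc hc' (blk_m1 hb hc h1) (blk_m1 hb' hc' h2) he
    exact ⟨dd_inj hb hb' h4, h3⟩
  · obtain ⟨h3, h4⟩ := blk_inj hc hb' (blk_m1 hb hc h1) (blk_m2 hc' hb' (nle hb' hc' h2)) he
    exact absurd h4 (dd_ne_suc hb hc')
  · obtain ⟨h3, h4⟩ := blk_inj hb hc' (blk_m2 hc hb (nle hb hc h1)) (blk_m1 hb' hc' h2) he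
    exact absurd h4.symm (dd_ne_suc hb' hc)
  · obtain ⟨h3, h4⟩ := blk_inj hb hb' (blk_m2 hc hb (nle hb hc h1)) (blk_m2 hc' hb' (nle hb' hc' h2)) he
    exact ⟨h3, dd_inj hc hc' (suc_inj h4)⟩

theorem J_inj {b c b' c' : M} (hb : Od b) (hc : Od c) (hb' : Od b') (hc' : Od c') (he : J b c = J b' c') :
    b = b' ∧ c = c' := J0_inj hb hc hb' hc' (suc_inj he)

theorem J0_od {b c : M} (hb : Od b) (hc : Od c) : Od (J0 b c) := by
  unfold J0; split_ifs
  · exact oad_od (blk_od hc) (dd_od hb)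
  · exact oad_od (blk_od hb) (od_suc (dd_od hc))
theorem J_od {b c : M} (hb : Od b) (hc : Od c) : Od (J b c) := od_suc (J0_od hb hc)

theorem J_lt {b c : M} (hb : Od b) (hc : Od c) : b ∈ₘ J b c ∧ c ∈ₘ J b c := by
  have : sb b (J0 b c) ∧ sb c (J0 b c) := by
    unfold J0; split_ifs with h
    · have : sb c (oad (blk c) (dd b)) := fun z hz => oad_base (dd_od hb) _ (blk_ge hc z hz)
      exact ⟨fun z hz => this z (h z hz), this⟩
    · have h' : sb c b := by
        rcases od_tri hb hc with h1 | rfl | h1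
        · exact absurd (od_sb hc h1) h
        · exact sb_refl _
        · exact od_sb hb h1
      have : sb b (oad (blk b) (suc (dd c))) := fun z hz => oad_base (od_suc (dd_od hc)) _ (blk_ge hb z hz)
      exact ⟨this, fun z hz => this z (h' z hz)⟩
  exact ⟨mem_suc.2 ((od_le_iff hb (J0_od hb hc)).1 this.1), mem_suc.2 ((od_le_iff hc (J0_od hb hc)).1 this.2)⟩

/-- Zermelo numerals -/
noncomputable def num : ℕ → M
  | 0 => emp
  | i + 1 => sing (num i)

theorem num_inj : ∀ {i j : ℕ}, (num i : M) = num j → i = j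
  | 0, 0, _ => rfl
  | 0, j + 1, h => by
    have : num j ∈ₘ (num (j+1) : M) := mem_sing.2 rfl
    rw [← h] at this; exact absurd this mem_emp
  | i + 1, 0, h => by
    have : num i ∈ₘ (num (i+1) : M) := mem_sing.2 rfl
    rw [h] at this; exact absurd this mem_emp
  | i + 1, j + 1, h => by rw [num_inj (sing_inj h)]

/-- the basic operations -/
def Phi (f z Y : M) : Prop :=
  (∃ p Q, Y = op (num 0) (op p Q) ∧ ¬ z ∈ₘ Q) ∨
  (∃ p Q, Y = op (num 1) (op p Q) ∧ ∃ u, adj z (op p u) ∈ₘ Q) ∨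
  (∃ p Q, Y = op (num 2) (op p Q) ∧ ∃ u v, op p u ∈ₘ z ∧ op Q v ∈ₘ z ∧ u ∈ₘ v) ∨
  (∃ p Q, Y = op (num 3) (op p Q) ∧ ∃ u, op p u ∈ₘ z ∧ op Q u ∈ₘ z) ∨
  (∃ p Q, Y = op (num 4) (op p Q) ∧ ∃ t k, p = op t k ∧ adj t (op k z) ∈ₘ Q) ∨
  (∃ p Q, Y = op (num 5) (op p Q) ∧ ∃ x, x ∈ₘ Q ∧ z ∈ₘ x ∧ ∃ ζ, Od ζ ∧ ap f ζ = z ∧ ∀ η, η ∈ₘ ζ → ¬ ap f η ∈ₘ x) ∨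
  (∃ p Q, Y = op (num 6) (op p Q) ∧ Od z) ∨
  (∃ p Q, Y = op (num 7) (op p Q) ∧ sb z Q) ∨
  (∃ p Q, Y = op (num 8) (op p Q) ∧ ∃ y, y ∈ₘ Q ∧ z ∈ₘ y)

instance d3_Phi : D3 (M := M) Phi := by
  constructor
  unfold Phi
  repeat' (first | apply defOr)

def GF (α f z : M) : Prop :=
  (∃ δ, Od δ ∧ α = J emp δ) ∨
  (∃ β γ, Od β ∧ Od γ ∧ α = J (suc emp) (J β γ) ∧ (z ∈ₘ ap f β ∨ z = ap f γ)) ∨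
  (∃ β γ, Od β ∧ Od γ ∧ α = J (suc (suc emp)) (J β γ) ∧ z ∈ₘ ap f β ∧ Phi f z (ap f γ))
instance d3_GF : D3 (M := M) GF := by
  constructor
  unfold GF
  repeat' (first | apply defOr)

/-- the enumeration of the inner model -/
noncomputable def FF (α : M) : M := rec (fun α f => sep (img α (ap f)) (GF α f)) α
instance f1_FF : F1 (M := M) FF := ⟨by unfold FF; infer_instance⟩

theorem FF_eq {α : M} (h : Od α) : FF α = sep (img α FF) (GF α (gr α FF)) := by
  have h1 := rec_eq (G := fun α f : M => sep (img α (ap f)) (GF α f)) h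
  have h2 : img α (ap (gr α FF)) = img α FF := img_congr fun x hx => ap_gr hx
  rw [← h2]
  exact h1

theorem mem_FF {α z : M} (h : Od α) : z ∈ₘ FF α ↔ (∃ β, β ∈ₘ α ∧ z = FF β) ∧ GF α (gr α FF) z := by
  rw [FF_eq h, mem_sep, mem_img]

/-- the inner model -/
def WW (x : M) : Prop := ∃ α, Od α ∧ FF α = x
instance d1_WW : D1 (M := M) WW := ⟨by unfold WW; infer_instance⟩

theorem WW_FF {α : M} (h : Od α) : WW (FF α) := ⟨α, h, rfl⟩

theorem WW_trans {x z : M} (h : WW x) (hz : z ∈ₘ x) : WW z := by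
  obtain ⟨α, hα, rfl⟩ := h
  obtain ⟨⟨β, hβ, rfl⟩, _⟩ := (mem_FF hα).1 hz
  exact WW_FF (od_mem hα hβ)

theorem one_ne : (suc emp : M) ≠ emp := by
  intro h
  have h2 := self_suc (emp : M)
  have h3 : ∀ x : M, x = emp → ¬ (emp : M) ∈ₘ x := fun x hx hm => mem_emp (hx ▸ hm)
  exact h3 _ h h2
theorem two_ne : (suc (suc emp) : M) ≠ emp := by
  intro h
  have h2 := self_suc (suc emp : M)
  have h3 : ∀ x : M, x = emp → ¬ (suc emp : M) ∈ₘ x := fun x hx hm => mem_emp (hx ▸ hm)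
  exact h3 _ h h2
theorem two_ne_one : (suc (suc emp) : M) ≠ suc emp := fun h => one_ne (suc_inj h)
theorem od1 : Od (suc emp : M) := od_suc od_emp
theorem od2 : Od (suc (suc emp) : M) := od_suc od1

theorem FF_zero {δ : M} (h : Od δ) : FF (J emp δ) = img (J emp δ) FF := by
  apply ext; intro z
  rw [mem_FF (J_od od_emp h), mem_img]
  exact ⟨fun h => h.1, fun h' => ⟨h', Or.inl ⟨δ, h, rfl⟩⟩⟩

theorem WW_bound {b : M} (h : ∀ x, x ∈ₘ b → WW x) : ∃ a, WW a ∧ sb b a ∧ TransE SetModel.E a := by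
  have hspec : ∀ x, x ∈ₘ b → Od (lst (fun α => FF α = x)) ∧ FF (lst (fun α => FF α = x)) = x := by
    intro x hx
    obtain ⟨α, h1, h2⟩ := h x hx
    have := lst_spec (P := fun α => FF α = x) h1 h2
    exact ⟨this.1, this.2.1⟩
  let δ := ssup (img b (fun x => lst (fun α => FF α = x)))
  have hδ : Od δ := ssup_od _
  refine ⟨FF (J emp δ), WW_FF (J_od od_emp hδ), fun x hx => ?_, ?_⟩
  · rw [FF_zero hδ, mem_img]
    obtain ⟨h1, h2⟩ := hspec x hx
    refine ⟨_, ?_, h2.symm⟩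
    exact od_tr (J_od od_emp hδ) (J_lt od_emp hδ).2 (mem_ssup (mem_img.2 ⟨x, hx, rfl⟩) h1)
  · rw [FF_zero hδ]
    intro y hy z hz
    obtain ⟨β, hβ, rfl⟩ := mem_img.1 hy
    have ho := J_od od_emp hδ
    obtain ⟨⟨γ, hγ, rfl⟩, _⟩ := (mem_FF (od_mem ho hβ)).1 hz
    exact mem_img.2 ⟨γ, od_tr ho hβ hγ, rfl⟩

theorem J_lt2 {i β γ : M} (hi : Od i) (hβ : Od β) (hγ : Od γ) : β ∈ₘ J i (J β γ) ∧ γ ∈ₘ J i (J β γ) := by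
  have h1 := J_od hβ hγ
  have h2 := J_od hi h1
  have h3 := (J_lt hi h1).2
  exact ⟨od_tr h2 h3 (J_lt hβ hγ).1, od_tr h2 h3 (J_lt hβ hγ).2⟩

theorem WW_adj {x y : M} (hx : WW x) (hy : WW y) : WW (adj x y) := by
  obtain ⟨β, hβ, rfl⟩ := hx
  obtain ⟨γ, hγ, rfl⟩ := hy
  have ho := J_od od1 (J_od hβ hγ)
  obtain ⟨l1, l2⟩ := J_lt2 od1 hβ hγ
  refine ⟨J (suc emp) (J β γ), ho, ?_⟩
  apply ext; intro z
  rw [mem_FF ho, mem_adj]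
  constructor
  · rintro ⟨_, ⟨δ, h1, h2⟩ | ⟨β', γ', h1, h2, h3, h4⟩ | ⟨β', γ', h1, h2, h3, h4⟩⟩
    · exact absurd (J_inj od1 (J_od hβ hγ) od_emp h1 h2).1 one_ne
    · obtain ⟨_, h5⟩ := J_inj od1 (J_od hβ hγ) od1 (J_od h1 h2) h3
      obtain ⟨rfl, rfl⟩ := J_inj hβ hγ h1 h2 h5
      rw [ap_gr l1, ap_gr l2] at h4
      exact h4
    · exact absurd (J_inj od1 (J_od hβ hγ) od2 (J_od h1 h2) h3).1.symm two_ne_one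
  · intro h
    refine ⟨?_, Or.inr (Or.inl ⟨β, γ, hβ, hγ, rfl, by rwa [ap_gr l1, ap_gr l2]⟩)⟩
    rcases h with h | rfl
    · obtain ⟨⟨δ, h1, h2⟩, _⟩ := (mem_FF hβ).1 h
      exact ⟨δ, od_tr ho l1 h1, h2⟩
    · exact ⟨γ, l2, rfl⟩

theorem WW_op {a Y : M} (ha : WW a) (hY : WW Y) : ∃ b α, WW b ∧ Od α ∧ (∀ z, z ∈ₘ a → ∃ β, β ∈ₘ α ∧ z = FF β) ∧
    ∀ z, z ∈ₘ b ↔ z ∈ₘ a ∧ Phi (gr α FF) z Y := by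
  obtain ⟨β, hβ, rfl⟩ := ha
  obtain ⟨γ, hγ, rfl⟩ := hY
  have ho := J_od od2 (J_od hβ hγ)
  obtain ⟨l1, l2⟩ := J_lt2 od2 hβ hγ
  have hin : ∀ z, z ∈ₘ FF β → ∃ δ, δ ∈ₘ J (suc (suc emp)) (J β γ) ∧ z = FF δ := by
    intro z h
    obtain ⟨⟨δ, h1, h2⟩, _⟩ := (mem_FF hβ).1 h
    exact ⟨δ, od_tr ho l1 h1, h2⟩
  refine ⟨FF (J (suc (suc emp)) (J β γ)), _, WW_FF ho, ho, hin, ?_⟩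
  intro z
  rw [mem_FF ho]
  constructor
  · rintro ⟨_, ⟨δ, h1, h2⟩ | ⟨β', γ', h1, h2, h3, h4⟩ | ⟨β', γ', h1, h2, h3, h4⟩⟩
    · exact absurd (J_inj od2 (J_od hβ hγ) od_emp h1 h2).1 two_ne
    · exact absurd (J_inj od2 (J_od hβ hγ) od1 (J_od h1 h2) h3).1 two_ne_one
    · obtain ⟨_, h5⟩ := J_inj od2 (J_od hβ hγ) od2 (J_od h1 h2) h3
      obtain ⟨rfl, rfl⟩ := J_inj hβ hγ h1 h2 h5
      rw [ap_gr l1, ap_gr l2] at h4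
      exact h4
  · intro h
    exact ⟨hin z h.1, Or.inr (Or.inr ⟨β, γ, hβ, hγ, rfl, by rwa [ap_gr l1, ap_gr l2]⟩)⟩

theorem WW_emp : WW (emp : M) := by
  refine ⟨emp, od_emp, ext fun z => ?_⟩
  rw [mem_FF od_emp]
  simp

theorem upair_adj (a b : M) : upair a b = adj (adj emp a) b := by
  apply ext; intro z; simp [mem_upair, mem_adj]
theorem WW_upair {a b : M} (ha : WW a) (hb : WW b) : WW (upair a b) := by
  rw [upair_adj]; exact WW_adj (WW_adj WW_emp ha) hb
theorem WW_pair {a b : M} (ha : WW a) (hb : WW b) : WW (op a b) :=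
  WW_upair (WW_upair ha ha) (WW_upair ha hb)
theorem WW_num : ∀ i, WW (num i : M)
  | 0 => WW_emp
  | i + 1 => WW_upair (WW_num i) (WW_num i)
theorem WW_of_op {a b : M} (h : WW (op a b)) : WW a ∧ WW b := by
  have h1 : WW (upair a b) := WW_trans h (mem_upair.2 (Or.inr rfl))
  exact ⟨WW_trans h1 (mem_upair.2 (Or.inl rfl)), WW_trans h1 (mem_upair.2 (Or.inr rfl))⟩

end Inner
end Paper


namespace Paper
set_option linter.unusedSectionVars false
set_option linter.unusedVariables false
set_option linter.unusedSimpArgs false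


section Gen
variable {M : Type} [SetModel M]

set_option synthInstance.maxSize 1000
set_option synthInstance.maxHeartbeats 400000

/-- relativized satisfaction -/
def RS (S : M → Prop) : ∀ {n : ℕ}, SetFormula n → (Fin n → M) → Prop
  | _, .mem i j, v => v i ∈ₘ v j
  | _, .eq i j, v => v i = v j
  | _, .fal, _ => False
  | _, .imp φ ψ, v => RS S φ v → RS S ψ v
  | _, .all φ, v => ∀ a, S a → RS S φ (Fin.snoc v a)

/-- the membership relation on a class -/
def ES (S : M → Prop) : {x : M // S x} → {x : M // S x} → Prop := fun a b => a.1 ∈ₘ b.1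

theorem RS_realize (S : M → Prop) {n : ℕ} (φ : SetFormula n) :
    ∀ v : Fin n → {x : M // S x}, Realize (ES S) φ v ↔ RS S φ (fun i => (v i).1) := by
  induction φ with
  | mem i j => intro v; rfl
  | eq i j => intro v; exact Subtype.ext_iff
  | fal => intro v; rfl
  | imp φ ψ h1 h2 => intro v; simp only [Realize, RS, h1, h2]
  | all φ ih =>
    intro v
    simp only [Realize, RS, ih]
    have : ∀ a : {x : M // S x}, (fun i => ((Fin.snoc v a : Fin _ → {x : M // S x}) i).1) =
        (Fin.snoc (fun i => (v i).1) a.1 : Fin _ → M) := by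
      intro a
      funext i
      refine Fin.lastCases ?_ (fun j => ?_) i <;> simp
    simp only [this]
    exact ⟨fun h a ha => h ⟨a, ha⟩, fun h a => h a.1 a.2⟩

theorem RS_top {n : ℕ} (φ : SetFormula n) : ∀ v : Fin n → M,
    RS (fun _ => True) φ v ↔ Realize SetModel.E φ v := by
  induction φ with
  | mem i j => intro v; rfl
  | eq i j => intro v; rfl
  | fal => intro v; rfl
  | imp φ ψ h1 h2 => intro v; simp only [Realize, RS, h1, h2]
  | all φ ih => intro v; simp only [Realize, RS, ih]; simp

theorem RS_congr {S S' : M → Prop} (h : ∀ x, S x ↔ S' x) {n : ℕ} (φ : SetFormula n) (v : Fin n → M) :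
    RS S φ v ↔ RS S' φ v := by
  have : S = S' := funext fun x => propext (h x)
  rw [this]

theorem RS_ren (S : M → Prop) {n m : ℕ} (φ : SetFormula n) (f : Fin n → Fin m) (v : Fin m → M)
    (hv : ∀ i, S (v i)) : RS S (φ.ren f) v ↔ RS S φ (fun i => v (f i)) := by
  have h1 := RS_realize S (φ.ren f) (fun i => ⟨v i, hv i⟩)
  have h2 := RS_realize S φ (fun i => ⟨v (f i), hv (f i)⟩)
  rw [← h1, ← h2, realize_ren]

theorem def_RS {n : ℕ} (φ : SetFormula n) : ∀ (S : (ℕ → M) → M → Prop) (ts : Fin n → (ℕ → M) → M),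
    Def (fun g => S (tl g) (hd g)) → (∀ i, Tm (ts i)) → Def (fun g => RS (S g) φ (fun i => ts i g)) := by
  induction φ with
  | mem i j => 
    intro S ts hS ht
    have h1 := ht i
    have h2 := ht j
    exact defMem (s := ts i) (t := ts j)
  | eq i j => 
    intro S ts hS ht
    have h1 := ht i
    have h2 := ht j
    exact defEq (s := ts i) (t := ts j)
  | fal => intro S ts hS ht; exact defConst
  | imp φ ψ h1 h2 =>
    intro S ts hS ht
    exact @defImp _ _ _ _ (h1 S ts hS ht) (h2 S ts hS ht)
  | all φ ih =>
    intro S ts hS ht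
    have h1 : Def (fun g => S (tl (tl g)) (hd g)) :=
      (hS.mapv (fun i => (Nat.casesOn i 0 (fun k => k + 2) : ℕ))).congr fun g => by rfl
    have h2 := ih (fun g => S (tl g)) (Fin.snoc (α := fun _ => (ℕ → M) → M) (fun i g => ts i (tl g)) hd) h1 (by
      intro i
      refine Fin.lastCases ?_ (fun j => ?_) i
      · simp only [Fin.snoc_last]; infer_instance
      · simp only [Fin.snoc_castSucc]; exact (ht j).shift)
    have h3 : Def (fun g => RS (S (tl g)) φ (Fin.snoc (fun i => ts i (tl g)) (hd g))) := by
      refine h2.congr fun g => ?_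
      have : (Fin.snoc (fun i => ts i (tl g)) (hd g) : Fin _ → M) =
        fun i => (Fin.snoc (α := fun _ => (ℕ → M) → M) (fun i g => ts i (tl g)) hd : Fin _ → _) i g := by
        funext i
        refine Fin.lastCases ?_ (fun j => ?_) i <;> simp
      rw [this]
    exact @defAll _ _ (fun g a => S g a → RS (S g) φ (Fin.snoc (fun i => ts i g) a)) (@defImp _ _ _ _ hS h3)

theorem repl_of_sep {S : M → Prop} [hS : D1 S] (he : S emp)
    (hsep : ∀ (k : ℕ) (φ : SetFormula (k + 1)) (p : Fin k → M) (a : M), (∀ i, S (p i)) → S a →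
      ∃ s, S s ∧ ∀ z, S z → (z ∈ₘ s ↔ (z ∈ₘ a ∧ RS S φ (Fin.cons z p))))
    (hcoll : ∀ (f : M → M), Tm (fun g => f (hd g)) → ∀ a, S a → (∀ x, x ∈ₘ a → S (f x)) →
      ∃ b, S b ∧ ∀ x, x ∈ₘ a → f x ∈ₘ b)
    (k : ℕ) (φ : SetFormula (k + 2)) (p : Fin k → M) (a : M) (hp : ∀ i, S (p i)) (ha : S a)
    (htr : ∀ x, x ∈ₘ a → S x)
    (hf : ∀ x, x ∈ₘ a → ∀ y y', S y → S y' → RS S φ (Fin.cons x (Fin.cons y p)) →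
      RS S φ (Fin.cons x (Fin.cons y' p)) → y = y') :
    ∃ b, S b ∧ ∀ y, S y → (y ∈ₘ b ↔ ∃ x, x ∈ₘ a ∧ RS S φ (Fin.cons x (Fin.cons y p))) := by
  classical
  let R : M → M → Prop := fun x y => S y ∧ RS S φ (Fin.cons x (Fin.cons y p))
  have hR : D2 R := by
    refine ⟨@defAnd _ _ _ _ inferInstance ((def_RS φ (fun _ => S)
      (Fin.cons (α := fun _ => (ℕ → M) → M) hd (Fin.cons (α := fun _ => (ℕ → M) → M) (fun g => hd (tl g)) (fun i _ => p i))) inferInstance ?_).congr fun g => ?_)⟩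
    · intro i
      refine Fin.cases ?_ (fun i => ?_) i
      · simp only [Fin.cons_zero]; infer_instance
      · refine Fin.cases ?_ (fun i => ?_) i
        · simp only [Fin.cons_succ, Fin.cons_zero]; infer_instance
        · simp only [Fin.cons_succ]; infer_instance
    · have : (Fin.cons (hd g) (Fin.cons (hd (tl g)) p) : Fin (k+2) → M) =
        fun i => (Fin.cons (α := fun _ => (ℕ → M) → M) hd (Fin.cons (α := fun _ => (ℕ → M) → M) (fun g => hd (tl g)) (fun i _ => p i)) : Fin (k+2) → _) i g := by
        funext i
        refine Fin.cases rfl (fun i => ?_) i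
        refine Fin.cases rfl (fun i => rfl) i
      rw [this]
  let f : M → M := fun x => if ∃ y, R x y then dsc (fun y => R x y) else emp
  have hfT : Tm (fun g => f (hd g)) := inferInstance
  have huniq : ∀ x, x ∈ₘ a → ∀ y, R x y → f x = y := fun x hx y hy => by
    have h1 : f x = dsc (fun y => R x y) := if_pos ⟨y, hy⟩
    rw [h1]
    exact dsc_eq hy fun y' hy' => hf x hx y' y hy'.1 hy.1 hy'.2 hy.2
  obtain ⟨b, hb, hb2⟩ := hcoll f hfT a ha (fun x hx => by
    by_cases h : ∃ y, R x y
    · obtain ⟨y, hy⟩ := h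
      rw [huniq x hx y hy]; exact hy.1
    · have h1 : f x = emp := if_neg h
      rw [h1]; exact he)
  let ψ : SetFormula (k + 1 + 1) := SetFormula.ex (SetFormula.and
    (.mem (Fin.last (k+2)) (Fin.castSucc 1))
    (φ.ren (Fin.cons (Fin.last (k+2)) (Fin.cons 0 (fun i => (i.succ.succ).castSucc)))))
  obtain ⟨s, hs, hs2⟩ := hsep (k + 1) ψ (Fin.cons a p) b (by
    intro i; refine Fin.cases ?_ (fun i => ?_) i
    · exact ha
    · exact hp i) hb
  refine ⟨s, hs, fun y hy => ?_⟩
  rw [hs2 y hy]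
  have key : RS S ψ (Fin.cons y (Fin.cons a p)) ↔ ∃ x, x ∈ₘ a ∧ RS S φ (Fin.cons x (Fin.cons y p)) := by
    have h1 : RS S ψ (Fin.cons y (Fin.cons a p)) ↔ ∃ x, S x ∧ x ∈ₘ a ∧ RS S φ (Fin.cons x (Fin.cons y p)) := by
      simp only [ψ, SetFormula.ex, SetFormula.and, SetFormula.not, RS]
      have h2 : ∀ x, S x → (RS S (φ.ren (Fin.cons (Fin.last (k+2)) (Fin.cons 0 (fun i => (i.succ.succ).castSucc))))
          (Fin.snoc (Fin.cons y (Fin.cons a p) : Fin (k+2) → M) x) ↔ RS S φ (Fin.cons x (Fin.cons y p))) := by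
        intro x hx
        rw [RS_ren]
        · have : (fun i => (Fin.snoc (Fin.cons y (Fin.cons a p) : Fin (k+2) → M) x : Fin (k+3) → M)
            ((Fin.cons (Fin.last (k+2)) (Fin.cons 0 (fun i : Fin k => (i.succ.succ).castSucc)) : Fin (k+2) → Fin (k+3)) i)) =
            (Fin.cons x (Fin.cons y p) : Fin (k+2) → M) := by
            funext i
            refine Fin.cases ?_ (fun i => ?_) i
            · simp
            · refine Fin.cases ?_ (fun i => ?_) i
              · simp only [Fin.cons_succ, Fin.cons_zero]
                exact Fin.snoc_castSucc (α := fun _ => M) (i := (0 : Fin (k+2))) ..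
              · simp only [Fin.cons_succ, Fin.snoc_castSucc]
          rw [this]
        · intro i
          refine Fin.lastCases ?_ (fun i => ?_) i
          · simpa using hx
          · simp only [Fin.snoc_castSucc]
            refine Fin.cases ?_ (fun i => ?_) i
            · exact hy
            · refine Fin.cases ?_ (fun i => ?_) i
              · exact ha
              · exact hp i
      have h3 : ∀ x, (Fin.snoc (Fin.cons y (Fin.cons a p) : Fin (k+2) → M) x : Fin (k+3) → M) (Fin.castSucc 1) = a := by
        intro x
        rw [Fin.snoc_castSucc]; rfl
      simp only [Fin.snoc_last, h3]
      constructor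
      · intro h
        by_contra hc
        push Not at hc
        exact h fun x hx h4 => h4 fun h5 h6 => hc x hx h5 ((h2 x hx).1 h6)
      · rintro ⟨x, hx, h4, h5⟩ h
        exact h x hx fun h6 => h6 h4 ((h2 x hx).2 h5)
    rw [h1]
    exact ⟨fun ⟨x, _, h⟩ => ⟨x, h⟩, fun ⟨x, h⟩ => ⟨x, htr x h.1, h⟩⟩
  rw [key]
  constructor
  · exact fun h => h.2
  · rintro ⟨x, hx, h⟩
    refine ⟨?_, x, hx, h⟩
    rw [← huniq x hx y ⟨hy, h⟩]
    exact hb2 x hx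

theorem sub_od {S : M → Prop} (htr : ∀ x y, S x → y ∈ₘ x → S y) (a : {x : M // S x}) :
    OrdE (ES S) a ↔ Od a.1 := by
  have ht : ∀ a : {x : M // S x}, TransE (ES S) a ↔ TransE SetModel.E a.1 := fun a =>
    ⟨fun h y hy z hz => h ⟨y, htr _ _ a.2 hy⟩ hy ⟨z, htr _ _ (htr _ _ a.2 hy) hz⟩ hz,
      fun h y hy z hz => h y.1 hy z.1 hz⟩
  exact ⟨fun h => ⟨(ht a).1 h.1, fun y hy => (ht ⟨y, htr _ _ a.2 hy⟩).1 (h.2 ⟨y, htr _ _ a.2 hy⟩ hy)⟩,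
    fun h => ⟨(ht a).2 h.1, fun y hy => (ht y).2 (h.2 y.1 hy)⟩⟩

theorem zfc_of {S : M → Prop} [hS : D1 S] (htr : ∀ x y, S x → y ∈ₘ x → S y)
    (hom : S om) (hpair : ∀ a b, S a → S b → S (upair a b)) (hun : ∀ a, S a → S (Un a))
    (hpw : ∀ a, S a → ∃ p, S p ∧ ∀ z, S z → (z ∈ₘ p ↔ sb z a))
    (hac : ∀ a, S a → (∀ x, x ∈ₘ a → ∃ z, z ∈ₘ x) →
      (∀ x y, x ∈ₘ a → y ∈ₘ a → x ≠ y → ¬ ∃ z, z ∈ₘ x ∧ z ∈ₘ y) →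
      ∃ c, S c ∧ ∀ x, x ∈ₘ a → ∃ z, z ∈ₘ c ∧ z ∈ₘ x ∧ ∀ z', z' ∈ₘ c → z' ∈ₘ x → z' = z)
    (hsep : ∀ (k : ℕ) (φ : SetFormula (k + 1)) (p : Fin k → M) (a : M), (∀ i, S (p i)) → S a →
      ∃ s, S s ∧ ∀ z, S z → (z ∈ₘ s ↔ (z ∈ₘ a ∧ RS S φ (Fin.cons z p))))
    (hcoll : ∀ (f : M → M), Tm (fun g => f (hd g)) → ∀ a, S a → (∀ x, x ∈ₘ a → S (f x)) →
      ∃ b, S b ∧ ∀ x, x ∈ₘ a → f x ∈ₘ b) : IsZFCE (ES S) := by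
  have he : S emp := htr _ _ hom (lm_emp om_lm)
  have hcons : ∀ {n : ℕ} (x : {x : M // S x}) (p : Fin n → {x : M // S x}),
      (fun i => ((Fin.cons x p : Fin (n+1) → {x : M // S x}) i).1) = (Fin.cons x.1 (fun i => (p i).1) : Fin (n+1) → M) := by
    intro n x p
    funext i
    exact Fin.cases rfl (fun i => rfl) i
  refine ⟨⟨⟨om, hom⟩⟩, ⟨?_, ?_, ?_, ?_, ?_, ?_, ?_⟩, ?_, ?_⟩
  · intro x y h
    exact Subtype.ext (ext fun z => ⟨fun hz => (h ⟨z, htr _ _ x.2 hz⟩).1 hz, fun hz => (h ⟨z, htr _ _ y.2 hz⟩).2 hz⟩)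
  · intro a b
    refine ⟨⟨upair a.1 b.1, hpair _ _ a.2 b.2⟩, fun z => ?_⟩
    rw [Subtype.ext_iff, Subtype.ext_iff]
    exact mem_upair
  · intro a
    refine ⟨⟨Un a.1, hun _ a.2⟩, fun z => ?_⟩
    refine mem_Un.trans ⟨fun ⟨y, hy, h⟩ => ⟨⟨y, htr _ _ a.2 hy⟩, hy, h⟩, fun ⟨y, hy, h⟩ => ⟨y.1, hy, h⟩⟩
  · refine ⟨⟨om, hom⟩, ⟨⟨emp, he⟩, lm_emp om_lm, fun z hz => mem_emp hz⟩, fun y hy => ?_⟩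
    refine ⟨⟨suc y.1, htr _ _ hom (lm_suc om_lm hy)⟩, lm_suc om_lm hy, fun z => ?_⟩
    rw [Subtype.ext_iff]
    exact mem_suc
  · rintro a ⟨z, hz⟩
    obtain ⟨m, hm, h⟩ := found (a := a.1) (z := z.1) hz
    exact ⟨⟨m, htr _ _ a.2 hm⟩, hm, fun z hz => h z.1 hz⟩
  · intro k φ p a
    obtain ⟨s, hs, h⟩ := hsep k φ (fun i => (p i).1) a.1 (fun i => (p i).2) a.2
    refine ⟨⟨s, hs⟩, fun z => ?_⟩
    rw [RS_realize, hcons]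
    exact h z.1 z.2
  · intro k φ p a hf
    simp only [RS_realize, hcons] at hf ⊢
    obtain ⟨b, hb, h⟩ := repl_of_sep he hsep hcoll k φ (fun i => (p i).1) a.1 (fun i => (p i).2) a.2
      (fun x => htr _ _ a.2)
      (fun x hx y y' hy hy' h1 h2 => congrArg Subtype.val (hf ⟨x, htr _ _ a.2 hx⟩ hx ⟨y, hy⟩ ⟨y', hy'⟩ h1 h2))
    refine ⟨⟨b, hb⟩, fun y => (h y.1 y.2).trans ?_⟩
    exact ⟨fun ⟨x, hx, h⟩ => ⟨⟨x, htr _ _ a.2 hx⟩, hx, h⟩, fun ⟨x, hx, h⟩ => ⟨x.1, hx, h⟩⟩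
  · intro a
    obtain ⟨p, hp, h⟩ := hpw a.1 a.2
    refine ⟨⟨p, hp⟩, fun z => (h z.1 z.2).trans ?_⟩
    exact ⟨fun h y hy => h y.1 hy, fun h y hy => h ⟨y, htr _ _ z.2 hy⟩ hy⟩
  · intro a h1 h2
    obtain ⟨c, hc, h⟩ := hac a.1 a.2 (fun x hx => by
      obtain ⟨z, hz⟩ := h1 ⟨x, htr _ _ a.2 hx⟩ hx
      exact ⟨z.1, hz⟩) (fun x y hx hy hne ⟨z, hz1, hz2⟩ =>
        h2 ⟨x, htr _ _ a.2 hx⟩ ⟨y, htr _ _ a.2 hy⟩ hx hy (fun h => hne (congrArg Subtype.val h))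
          ⟨⟨z, htr _ _ (htr _ _ a.2 hx) hz1⟩, hz1, hz2⟩)
    refine ⟨⟨c, hc⟩, fun x hx => ?_⟩
    obtain ⟨z, h3, h4, h5⟩ := h x.1 hx
    exact ⟨⟨z, htr _ _ hc h3⟩, h3, h4, fun z' h6 h7 => Subtype.ext (h5 z'.1 h6 h7)⟩

end Gen
end Paper


namespace Paper
set_option linter.unusedSectionVars false
set_option linter.unusedVariables false
set_option linter.unusedSimpArgs false


section InnerZfc
variable {M : Type} [SetModel M]

set_option synthInstance.maxSize 1000
set_option synthInstance.maxHeartbeats 400000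

theorem num_eq {i j : ℕ} : (num i : M) = num j ↔ i = j := ⟨num_inj, fun h => by rw [h]⟩

theorem WW_arg {p Q : M} (i : ℕ) (hp : WW p) (hQ : WW Q) : WW (op (num i) (op p Q)) :=
  WW_pair (WW_num i) (WW_pair hp hQ)

theorem op0 {a p Q : M} (ha : WW a) (hQ : WW Q) :
    ∃ b, WW b ∧ ∀ z, z ∈ₘ b ↔ z ∈ₘ a ∧ ¬ z ∈ₘ Q := by
  obtain ⟨b, α, hb, -, -, h⟩ := WW_op ha (WW_arg 0 WW_emp hQ)
  refine ⟨b, hb, fun z => (h z).trans (and_congr_right fun _ => ?_)⟩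
  unfold Phi; simp [num_eq]

theorem op1 {a p Q : M} (ha : WW a) (hp : WW p) (hQ : WW Q) :
    ∃ b, WW b ∧ ∀ z, z ∈ₘ b ↔ z ∈ₘ a ∧ ∃ u, adj z (op p u) ∈ₘ Q := by
  obtain ⟨b, α, hb, -, -, h⟩ := WW_op ha (WW_arg 1 hp hQ)
  refine ⟨b, hb, fun z => (h z).trans (and_congr_right fun _ => ?_)⟩
  unfold Phi; simp [num_eq]

theorem op2 {a p Q : M} (ha : WW a) (hp : WW p) (hQ : WW Q) :
    ∃ b, WW b ∧ ∀ z, z ∈ₘ b ↔ z ∈ₘ a ∧ ∃ u v, op p u ∈ₘ z ∧ op Q v ∈ₘ z ∧ u ∈ₘ v := by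
  obtain ⟨b, α, hb, -, -, h⟩ := WW_op ha (WW_arg 2 hp hQ)
  refine ⟨b, hb, fun z => (h z).trans (and_congr_right fun _ => ?_)⟩
  unfold Phi; simp [num_eq]

theorem op3 {a p Q : M} (ha : WW a) (hp : WW p) (hQ : WW Q) :
    ∃ b, WW b ∧ ∀ z, z ∈ₘ b ↔ z ∈ₘ a ∧ ∃ u, op p u ∈ₘ z ∧ op Q u ∈ₘ z := by
  obtain ⟨b, α, hb, -, -, h⟩ := WW_op ha (WW_arg 3 hp hQ)
  refine ⟨b, hb, fun z => (h z).trans (and_congr_right fun _ => ?_)⟩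
  unfold Phi; simp [num_eq]

theorem op4 {a t k Q : M} (ha : WW a) (ht : WW t) (hk : WW k) (hQ : WW Q) :
    ∃ b, WW b ∧ ∀ z, z ∈ₘ b ↔ z ∈ₘ a ∧ adj t (op k z) ∈ₘ Q := by
  obtain ⟨b, α, hb, -, -, h⟩ := WW_op ha (WW_arg 4 (WW_pair ht hk) hQ)
  refine ⟨b, hb, fun z => (h z).trans (and_congr_right fun _ => ?_)⟩
  unfold Phi; simp [num_eq]

theorem op5 {a Q : M} (ha : WW a) (hQ : WW Q) :
    ∃ b α, WW b ∧ Od α ∧ (∀ z, z ∈ₘ a → ∃ β, β ∈ₘ α ∧ z = FF β) ∧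
    ∀ z, z ∈ₘ b ↔ z ∈ₘ a ∧ ∃ x, x ∈ₘ Q ∧ z ∈ₘ x ∧ ∃ ζ, Od ζ ∧ ap (gr α FF) ζ = z ∧ ∀ η, η ∈ₘ ζ → ¬ ap (gr α FF) η ∈ₘ x := by
  obtain ⟨b, α, hb, h1, h2, h⟩ := WW_op ha (WW_arg 5 WW_emp hQ)
  refine ⟨b, α, hb, h1, h2, fun z => (h z).trans (and_congr_right fun _ => ?_)⟩
  unfold Phi; simp [num_eq]

theorem op6 {a : M} (ha : WW a) : ∃ b, WW b ∧ ∀ z, z ∈ₘ b ↔ z ∈ₘ a ∧ Od z := by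
  obtain ⟨b, α, hb, -, -, h⟩ := WW_op ha (WW_arg 6 WW_emp WW_emp)
  refine ⟨b, hb, fun z => (h z).trans (and_congr_right fun _ => ?_)⟩
  unfold Phi; simp [num_eq]

theorem op7 {a Q : M} (ha : WW a) (hQ : WW Q) : ∃ b, WW b ∧ ∀ z, z ∈ₘ b ↔ z ∈ₘ a ∧ sb z Q := by
  obtain ⟨b, α, hb, -, -, h⟩ := WW_op ha (WW_arg 7 WW_emp hQ)
  refine ⟨b, hb, fun z => (h z).trans (and_congr_right fun _ => ?_)⟩
  unfold Phi; simp [num_eq]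

theorem op8 {a Q : M} (ha : WW a) (hQ : WW Q) : ∃ b, WW b ∧ ∀ z, z ∈ₘ b ↔ z ∈ₘ a ∧ ∃ y, y ∈ₘ Q ∧ z ∈ₘ y := by
  obtain ⟨b, α, hb, -, -, h⟩ := WW_op ha (WW_arg 8 WW_emp hQ)
  refine ⟨b, hb, fun z => (h z).trans (and_congr_right fun _ => ?_)⟩
  unfold Phi; simp [num_eq]

theorem WW_od : ∀ α : M, Od α → WW α := by
  refine od_ind (P := fun α : M => WW α) ?_
  intro α hα ih
  obtain ⟨a, ha, h1, h2⟩ := WW_bound (b := α) ih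
  obtain ⟨b, hb, hb2⟩ := op6 ha
  have hbo : Od b := od_of (fun x hx => ((hb2 x).1 hx).2) (fun x y hx hy =>
    (hb2 y).2 ⟨h2 x ((hb2 x).1 hx).1 y hy, od_mem ((hb2 x).1 hx).2 hy⟩)
  have hs : sb α b := fun x hx => (hb2 x).2 ⟨h1 x hx, od_mem hα hx⟩
  rcases (od_le_iff hα hbo).1 hs with h | rfl
  · exact WW_trans hb h
  · exact hb

/-- coding of tuples -/
noncomputable def tup : ∀ {n : ℕ}, (Fin n → M) → M
  | 0, _ => emp
  | n + 1, v => adj (tup (fun i => v i.castSucc)) (op (num n) (v (Fin.last n)))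

theorem tup_snoc {n : ℕ} (v : Fin n → M) (a : M) : tup (Fin.snoc v a : Fin (n+1) → M) = adj (tup v) (op (num n) a) := by
  simp [tup]

theorem mem_tup : ∀ {n : ℕ} (v : Fin n → M) (z : M), z ∈ₘ tup v ↔ ∃ i : Fin n, z = op (num i) (v i)
  | 0, v, z => by simp [tup]
  | n + 1, v, z => by
    simp only [tup, mem_adj, mem_tup]
    constructor
    · rintro (⟨i, rfl⟩ | rfl)
      · exact ⟨i.castSucc, rfl⟩
      · exact ⟨Fin.last n, rfl⟩
    · rintro ⟨i, rfl⟩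
      revert i
      refine Fin.lastCases (Or.inr rfl) (fun i => Or.inl ⟨i, rfl⟩)

theorem op_mem_tup {n : ℕ} (v : Fin n → M) (i : Fin n) (u : M) : op (num i) u ∈ₘ tup v ↔ u = v i := by
  rw [mem_tup]
  constructor
  · rintro ⟨j, h⟩
    rw [op_eq, num_eq] at h
    rw [h.2, Fin.ext h.1]
  · rintro rfl; exact ⟨i, rfl⟩

theorem ap_tup {n : ℕ} (v : Fin n → M) (i : Fin n) : ap (tup v) (num i) = v i :=
  dsc_eq ((op_mem_tup v i _).2 rfl) fun y hy => (op_mem_tup v i y).1 hy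

theorem WW_tup : ∀ {n : ℕ} (v : Fin n → M), (∀ i, WW (v i)) → WW (tup v)
  | 0, v, _ => WW_emp
  | n + 1, v, h => WW_adj (WW_tup _ fun i => h _) (WW_pair (WW_num n) (h _))

theorem WW_adj_inv {t k u a : M} (ha : WW a) (h : adj t (op k u) ∈ₘ a) : WW u :=
  (WW_of_op (WW_trans (WW_trans ha h) (mem_adj.2 (Or.inr rfl)))).2

theorem WW_sep {n : ℕ} (φ : SetFormula n) : ∀ a : M, WW a → ∃ b, WW b ∧ sb b a ∧
    ∀ v : Fin n → M, (∀ i, WW (v i)) → (tup v ∈ₘ b ↔ tup v ∈ₘ a ∧ RS WW φ v) := by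
  induction φ with
  | mem i j =>
    intro a ha
    obtain ⟨b, hb, h⟩ := op2 (p := num i) (Q := num j) ha (WW_num i) (WW_num j)
    refine ⟨b, hb, fun z hz => ((h z).1 hz).1, fun v hv => (h _).trans (and_congr_right fun _ => ?_)⟩
    simp only [op_mem_tup, RS]
    exact ⟨fun ⟨u, w, h1, h2, h3⟩ => h1 ▸ h2 ▸ h3, fun h => ⟨_, _, rfl, rfl, h⟩⟩
  | eq i j =>
    intro a ha
    obtain ⟨b, hb, h⟩ := op3 (p := num i) (Q := num j) ha (WW_num i) (WW_num j)
    refine ⟨b, hb, fun z hz => ((h z).1 hz).1, fun v hv => (h _).trans (and_congr_right fun _ => ?_)⟩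
    simp only [op_mem_tup, RS]
    exact ⟨fun ⟨u, h1, h2⟩ => h1 ▸ h2, fun h => ⟨_, rfl, h⟩⟩
  | fal =>
    intro a ha
    exact ⟨emp, WW_emp, fun z hz => absurd hz mem_emp, fun v hv => ⟨fun h => absurd h mem_emp, fun h => h.2.elim⟩⟩
  | imp φ ψ h1 h2 =>
    intro a ha
    obtain ⟨b, hb, hba, h3⟩ := h1 a ha
    obtain ⟨c, hc, hca, h4⟩ := h2 a ha
    obtain ⟨d, hd, h5⟩ := op0 (p := emp) hb hc
    obtain ⟨e, he, h6⟩ := op0 (p := emp) ha hd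
    refine ⟨e, he, fun z hz => ((h6 z).1 hz).1, fun v hv => ?_⟩
    rw [h6, h5, h3 v hv, h4 v hv]
    simp only [RS]; tauto
  | @all n φ ih =>
    intro a ha
    have hD : D2 (fun t u : M => RS WW φ (Fin.snoc (fun i : Fin n => ap t (num i)) u)) := by
      refine ⟨(def_RS φ (fun _ => WW) (Fin.snoc (α := fun _ => (ℕ → M) → M) (fun (i : Fin n) g => ap (hd g) (num i)) (fun g => hd (tl g))) d1_WW.out ?_).congr fun g => ?_⟩
      · intro i
        refine Fin.lastCases ?_ (fun j => ?_) i
        · simp only [Fin.snoc_last]; infer_instance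
        · simp only [Fin.snoc_castSucc]; infer_instance
      · have : (Fin.snoc (fun i : Fin n => ap (hd g) (num i)) (hd (tl g)) : Fin _ → M) =
          fun i => (Fin.snoc (α := fun _ => (ℕ → M) → M) (fun (i : Fin n) g => ap (hd g) (num i)) (fun g => hd (tl g)) : Fin _ → _) i g := by
          funext i
          refine Fin.lastCases ?_ (fun j => ?_) i <;> simp
        rw [this]
    let Q : M → M → Prop := fun t u => RS WW φ (Fin.snoc (fun i : Fin n => ap t (num i)) u)
    have hQ : D2 Q := hD
    let R : M → M → Prop := fun t y => ∃ u, WW u ∧ y = adj t (op (num n) u) ∧ ¬ Q t u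
    have hR : D2 R := ⟨inferInstance⟩
    obtain ⟨b0, hb0⟩ := coll (R := R) (hR := hR.out) (a := sep a (fun t => ∃ y, R t y)) (fun x hx => (mem_sep.1 hx).2)
    obtain ⟨a', ha', hs', -⟩ := WW_bound (b := sep b0 WW) (fun x hx => (mem_sep.1 hx).2)
    obtain ⟨b', hb', hba', h1⟩ := ih a' ha'
    obtain ⟨d, hd, h2⟩ := op0 (p := emp) ha' hb'
    obtain ⟨e, he, h3⟩ := op1 (p := num n) ha (WW_num n) hd
    obtain ⟨f, hf, h4⟩ := op0 (p := emp) ha he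
    refine ⟨f, hf, fun z hz => ((h4 z).1 hz).1, fun v hv => ?_⟩
    rw [h4, h3]
    simp only [h2]
    refine and_congr_right fun hva => ?_
    have hap : (fun i : Fin n => ap (tup v) (num i)) = v := funext fun i => ap_tup v i
    constructor
    · intro hn u hu
      by_contra hc
      have hRv : R (tup v) (adj (tup v) (op (num n) u)) := ⟨u, hu, rfl, by
        show ¬ RS WW φ (Fin.snoc (fun i : Fin n => ap (tup v) (num i)) u)
        rw [hap]; exact hc⟩
      obtain ⟨y, hy, u', hu', rfl, hq⟩ := hb0 (tup v) (mem_sep.2 ⟨hva, _, hRv⟩)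
      have hq' : ¬ RS WW φ (Fin.snoc v u') := by
        have hq2 : ¬ RS WW φ (Fin.snoc (fun i : Fin n => ap (tup v) (num i)) u') := hq
        rw [hap] at hq2; exact hq2
      have hya : adj (tup v) (op (num n) u') ∈ₘ a' := hs' _ (mem_sep.2 ⟨hy, WW_adj (WW_tup v hv) (WW_pair (WW_num n) hu')⟩)
      refine hn ⟨hva, u', hya, fun hb => hq' ?_⟩
      rw [← tup_snoc] at hb
      exact ((h1 _ (by
        intro i; refine Fin.lastCases ?_ (fun j => ?_) i
        · simpa using hu'
        · simpa using hv j)).1 hb).2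
    · rintro hall ⟨-, u, hu1, hu2⟩
      have hu : WW u := WW_adj_inv ha' hu1
      apply hu2
      rw [← tup_snoc] at hu1 ⊢
      exact (h1 _ (by
        intro i; refine Fin.lastCases ?_ (fun j => ?_) i
        · simpa using hu
        · simpa using hv j)).2 ⟨hu1, hall u hu⟩

theorem WW_axsep (k : ℕ) (φ : SetFormula (k + 1)) (p : Fin k → M) (a : M) (hp : ∀ i, WW (p i)) (ha : WW a) :
    ∃ s, WW s ∧ ∀ z, WW z → (z ∈ₘ s ↔ (z ∈ₘ a ∧ RS WW φ (Fin.cons z p))) := by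
  let φ' := φ.ren (Fin.cons (Fin.last k) (fun i => i.castSucc) : Fin (k+1) → Fin (k+1))
  obtain ⟨a', ha', hs, -⟩ := WW_bound (b := img a (fun z => adj (tup p) (op (num k) z))) (by
    intro x hx
    obtain ⟨z, hz, rfl⟩ := mem_img.1 hx
    exact WW_adj (WW_tup p hp) (WW_pair (WW_num k) (WW_trans ha hz)))
  obtain ⟨b', hb', -, h⟩ := WW_sep φ' a' ha'
  obtain ⟨s, hs1, hs2⟩ := op4 ha (WW_tup p hp) (WW_num k) hb'
  refine ⟨s, hs1, fun z hz => (hs2 z).trans (and_congr_right fun hza => ?_)⟩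
  have hv : ∀ i, WW ((Fin.snoc p z : Fin (k+1) → M) i) := by
    intro i; refine Fin.lastCases ?_ (fun j => ?_) i
    · simpa using hz
    · simpa using hp j
  rw [← tup_snoc, h _ hv, tup_snoc, RS_ren _ _ _ _ hv]
  have : (fun i => (Fin.snoc p z : Fin (k+1) → M) ((Fin.cons (Fin.last k) (fun i => i.castSucc) : Fin (k+1) → Fin (k+1)) i)) = (Fin.cons z p : Fin (k+1) → M) := by
    funext i
    refine Fin.cases ?_ (fun i => ?_) i <;> simp
  rw [this]
  exact ⟨fun h => h.2, fun h2 => ⟨hs _ (mem_img.2 ⟨z, hza, rfl⟩), h2⟩⟩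

theorem WW_zfc : IsZFCE (ES (WW (M := M))) := by
  have hun : ∀ a : M, WW a → WW (Un a) := by
    intro a ha
    obtain ⟨a', ha', hs, -⟩ := WW_bound (b := Un a) (fun x hx => by
      obtain ⟨y, hy, h⟩ := mem_Un.1 hx
      exact WW_trans (WW_trans ha hy) h)
    obtain ⟨b, hb, h⟩ := op8 ha' ha
    have : Un a = b := ext fun z => by
      rw [h, mem_Un]
      exact ⟨fun h => ⟨hs z (mem_Un.2 h), h⟩, fun h => h.2⟩
    rw [this]; exact hb
  refine zfc_of (fun x y => WW_trans) (WW_od _ om_od) (fun a b => WW_upair) hun ?_ ?_ WW_axsep ?_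
  · intro a ha
    obtain ⟨a', ha', hs, -⟩ := WW_bound (b := sep (pw a) WW) (fun x hx => (mem_sep.1 hx).2)
    obtain ⟨b, hb, h⟩ := op7 ha' ha
    refine ⟨b, hb, fun z hz => (h z).trans ⟨fun h => h.2, fun h => ⟨hs z (mem_sep.2 ⟨mem_pw.2 h, hz⟩), h⟩⟩⟩
  · intro a ha h1 h2
    obtain ⟨c, α, hc, hα, h3, h4⟩ := op5 (hun a ha) ha
    refine ⟨c, hc, fun x hx => ?_⟩
    obtain ⟨w, hw⟩ := h1 x hx
    obtain ⟨β, hβ, rfl⟩ := h3 w (mem_Un.2 ⟨x, hx, hw⟩)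
    have hβo := od_mem hα hβ
    have hw' : ap (gr α FF) β ∈ₘ x := by rw [ap_gr hβ]; exact hw
    obtain ⟨h5, h6, h7⟩ := lst_spec (P := fun ζ => ap (gr α FF) ζ ∈ₘ x) hβo hw'
    have h8 := lst_le (P := fun ζ => ap (gr α FF) ζ ∈ₘ x) hβo hw'
    generalize lst (fun ζ => ap (gr α FF) ζ ∈ₘ x) = ζ at *
    refine ⟨ap (gr α FF) ζ, (h4 _).2 ⟨mem_Un.2 ⟨x, hx, h6⟩, x, hx, h6, ζ, h5, rfl, h7⟩, h6, fun z' h9 h10 => ?_⟩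
    obtain ⟨-, x', hx', hz', ζ', ho, rfl, h11⟩ := (h4 z').1 h9
    have hxx : x' = x := by
      by_contra hne
      exact h2 x' x hx' hx hne ⟨_, hz', h10⟩
    subst hxx
    rcases od_tri ho h5 with h | h | h
    · exact absurd h10 (h7 _ h)
    · rw [h]
    · exact absurd h6 (h11 _ h)
  · intro f hf a ha h
    obtain ⟨b, hb, hs, -⟩ := WW_bound (b := img a f) (fun x hx => by
      obtain ⟨z, hz, rfl⟩ := mem_img.1 hx
      exact h z hz)
    exact ⟨b, hb, fun x hx => hs _ (mem_img.2 ⟨x, hx, rfl⟩)⟩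

end InnerZfc
end Paper


namespace Paper
set_option linter.unusedSectionVars false
set_option linter.unusedVariables false
set_option linter.unusedSimpArgs false


section BFinal
variable {M : Type} [SetModel M]

set_option synthInstance.maxSize 1000
set_option synthInstance.maxHeartbeats 400000

instance wModel : SetModel {x : M // WW x} := ⟨ES WW, WW_zfc⟩

theorem w_mem {a b : {x : M // WW x}} : a ∈ₘ b ↔ a.1 ∈ₘ b.1 := Iff.rfl

theorem w_ext {a : {x : M // WW x}} {b : M} (h : ∀ z : {x : M // WW x}, z ∈ₘ a ↔ z.1 ∈ₘ b) (hb : ∀ z, z ∈ₘ b → WW z) :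
    a.1 = b :=
  ext fun z => ⟨fun hz => (h ⟨z, WW_trans a.2 hz⟩).1 hz, fun hz => (h ⟨z, hb z hz⟩).2 hz⟩

theorem w_upair (a b : {x : M // WW x}) : (upair a b).1 = upair a.1 b.1 := by
  refine w_ext (fun z => ?_) (fun z hz => ?_)
  · rw [mem_upair, mem_upair, Subtype.ext_iff, Subtype.ext_iff]
  · rcases mem_upair.1 hz with rfl | rfl
    · exact a.2
    · exact b.2

theorem w_op (a b : {x : M // WW x}) : (op a b).1 = op a.1 b.1 := by
  unfold op sing
  rw [w_upair, w_upair, w_upair]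

theorem w_inter (a b : {x : M // WW x}) : (inter a b).1 = inter a.1 b.1 := by
  refine w_ext (fun z => ?_) (fun z hz => ?_)
  · rw [mem_inter, mem_inter]; rfl
  · exact WW_trans a.2 (mem_inter.1 hz).1

theorem w_od (a : {x : M // WW x}) : Od a ↔ Od a.1 := sub_od (fun _ _ => WW_trans) a

theorem w_lm {a : {x : M // WW x}} (h : Lm a.1) : Lm a := by
  refine ⟨(w_od a).2 h.1, ?_, ?_⟩
  · obtain ⟨w, hw⟩ := h.2.1
    exact ⟨⟨w, WW_trans a.2 hw⟩, hw⟩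
  · intro x hx
    obtain ⟨b, hb, h1⟩ := h.2.2 x.1 hx
    exact ⟨⟨b, WW_trans a.2 hb⟩, hb, h1⟩

theorem w_good {s ξ θ : {x : M // WW x}} (h : Good s ξ θ) : Good s.1 ξ.1 θ.1 := by
  obtain ⟨h1, h2, h3⟩ := h
  refine ⟨fun α hα hξ hl => ?_, fun α A hA => ?_, fun α β A B h4 h5 h6 h7 h8 h9 h10 he => ?_⟩
  · obtain ⟨A, hA⟩ := h1 ⟨α, WW_trans θ.2 hα⟩ hα hξ (w_lm hl)
    refine ⟨A.1, ?_⟩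
    rw [w_mem, w_op] at hA; exact hA
  · obtain ⟨ha, hA'⟩ := WW_of_op (WW_trans s.2 hA)
    have := h2 ⟨α, ha⟩ ⟨A, hA'⟩ (by rw [w_mem, w_op]; exact hA)
    exact fun z hz => this ⟨z, WW_trans hA' hz⟩ hz
  · obtain ⟨hb, hA'⟩ := WW_of_op (WW_trans s.2 h9)
    obtain ⟨ha, hB'⟩ := WW_of_op (WW_trans s.2 h10)
    refine h3 ⟨α, ha⟩ ⟨β, hb⟩ ⟨A, hA'⟩ ⟨B, hB'⟩ h4 h5 h6 (w_lm h7) (w_lm h8) (by rw [w_mem, w_op]; exact h9)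
      (by rw [w_mem, w_op]; exact h10) (Subtype.ext ?_)
    rw [w_inter]; exact he

theorem faint_D2 (hf : OrdFaintDefE (SetModel.E (M := M))) (R : M → M → Prop) [hR : D2 R] : FaintForE SetModel.E R := by
  obtain ⟨k, φ, p, h⟩ := hR.out.two
  have := hf k φ p
  have e : (fun α A => Realize SetModel.E φ (Fin.cons α (Fin.cons A p))) = R := by
    funext z w; exact propext (h z w).symm
  rwa [e] at this

theorem B_aux (hf : OrdFaintDefE (SetModel.E (M := M))) {ξ : M} (hξ : Od ξ) (hξo : sb om ξ)
    (hgood : ∀ θ : M, Od θ → ∃ s, WW s ∧ Good s ξ θ) (T : M → M → Prop) [D2 T] (C : M → Prop) [D1 C] :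
    SubtleForE SetModel.E T C := by
  intro hT hC
  obtain ⟨hC1, hC2, hC3⟩ := hC
  by_contra hno
  let th : M → M := fun l => lst (fun e => C e ∧ l ∈ₘ e)
  have hth : F1 th := ⟨inferInstance⟩
  let sq : M → M := fun l => FF (lst (fun ζ => Good (FF ζ) ξ (th l)))
  have hsq : F1 sq := ⟨(inferInstance : Tm (fun g : ℕ → M => FF (lst (fun ζ => Good (FF ζ) ξ (th (hd g))))))⟩
  let lab : M → M := fun α => Un (sep α C)
  have hlab : F1 lab := ⟨(inferInstance : Tm (fun g : ℕ → M => Un (sep (hd g) (fun x => C x))))⟩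
  let Sf : M → M → M → Prop := fun l α A => op α A ∈ₘ sq l
  have hSf : D3 Sf := ⟨inferInstance⟩
  have hth2 : ∀ l, Od l → C (th l) ∧ l ∈ₘ th l := by
    intro l hl
    obtain ⟨e, he, hle⟩ := hC2 l hl
    exact (lst_spec (P := fun e => C e ∧ l ∈ₘ e) (hC1 e he) ⟨he, hle⟩).2.1
  have hsq2 : ∀ l, Od l → Good (sq l) ξ (th l) := by
    intro l hl
    obtain ⟨s, ⟨ζ, hζ, rfl⟩, hs⟩ := hgood (th l) (hC1 _ (hth2 l hl).1)
    exact (lst_spec (P := fun ζ => Good (FF ζ) ξ (th l)) hζ hs).2.1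
  have hlab2 : ∀ α, Lm α → ¬ C α → lab α ∈ₘ α ∧ Od (lab α) ∧ α ∈ₘ th (lab α) := by
    intro α hα hn
    obtain ⟨h1, h2⟩ := club_lab (C := C) hα hC1 (hC3 α hα.1 ⟨_, lm_emp hα⟩) hn
    have h3 := od_mem hα.1 h1
    exact ⟨h1, h3, h2 _ (hth2 _ h3).1 (hth2 _ h3).2⟩
  let R : M → M → Prop := fun α B => (ξ ∈ₘ α ∧ Lm α ∧ comb C lab T Sf α B) ∨
    (ξ ∈ₘ α ∧ ¬ Lm α ∧ ∃ b, α = suc b ∧ B = upair emp b) ∨ (¬ ξ ∈ₘ α ∧ B = emp)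
  have hR : D2 R := ⟨inferInstance⟩
  have hform : ∀ α B, Lm α → ξ ∈ₘ α → comb C lab T Sf α B → ∃ A L, B = code A L ∧ sb A α ∧ sb L α := by
    intro α B hα hξα h
    refine comb_form hα (fun _ => (hT α hα.1).2) (fun hn => ?_) h
    obtain ⟨h1, h2, h3⟩ := hlab2 α hα hn
    exact ⟨h1, fun A hA => (hsq2 _ h2).2.1 α A hA⟩
  obtain ⟨α, β, A, B, hα, hβ, hξα, hαβ, hA, hB, hB'⟩ := faint_D2 hf R (by
    intro α hα
    by_cases hξα : ξ ∈ₘ α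
    · by_cases hl : Lm α
      · constructor
        · by_cases hCα : C α
          · obtain ⟨A, hA⟩ := (hT α hα).1
            exact ⟨_, Or.inl ⟨hξα, hl, Or.inl ⟨hCα, A, hA, rfl⟩⟩⟩
          · obtain ⟨h1, h2, h3⟩ := hlab2 α hl hCα
            obtain ⟨A, hA⟩ := (hsq2 _ h2).1 α h3 hξα hl
            exact ⟨_, Or.inl ⟨hξα, hl, Or.inr ⟨hCα, A, hA, rfl⟩⟩⟩
        · rintro A (⟨_, _, h⟩ | ⟨_, h, _⟩ | ⟨h, _⟩)
          · obtain ⟨A, L, rfl, h1, h2⟩ := hform α A hl hξα h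
            exact code_sb hl h1 h2
          · exact absurd hl h
          · exact absurd hξα h
      · obtain ⟨b, hb, rfl⟩ : ∃ b, Od b ∧ α = suc b := by
          rcases od_cases hα with rfl | h | h
          · exact absurd hξα mem_emp
          · exact h
          · exact absurd h hl
        constructor
        · exact ⟨_, Or.inr (Or.inl ⟨hξα, hl, b, rfl, rfl⟩)⟩
        · rintro A (⟨_, h, _⟩ | ⟨_, h, b', hb', rfl⟩ | ⟨h, _⟩)
          · exact absurd h hl
          · rw [← suc_inj hb']
            intro z hz
            rcases mem_upair.1 hz with rfl | rfl
            · exact emp_lt hα hξα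
            · exact self_suc _
          · exact absurd hξα h
    · constructor
      · exact ⟨emp, Or.inr (Or.inr ⟨hξα, rfl⟩)⟩
      · rintro A (⟨h, _⟩ | ⟨h, _⟩ | ⟨_, rfl⟩)
        · exact absurd h hξα
        · exact absurd h hξα
        · exact emp_sb _) ξ hξ
  rw [inter_spec] at hB
  have hξβ : ξ ∈ₘ β := od_tr hβ hαβ hξα
  rcases hB' with ⟨-, hlα, hBc⟩ | ⟨-, hlα, a, rfl, hBc⟩ | ⟨h, _⟩
  · rcases hA with ⟨-, hlβ, hAc⟩ | ⟨-, hlβ, b, rfl, hAc⟩ | ⟨h, _⟩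
    · refine comb_no hlα hlβ hαβ ?_ ?_ ?_ ?_ hAc hBc hB
      · rintro γ hγ hU A hA
        have hγo : Od γ := by rcases hγ with rfl | rfl <;> assumption
        exact (hT γ hγo).2 A hA
      · rintro γ hγ hU
        have hγo : Lm γ := by rcases hγ with rfl | rfl <;> assumption
        obtain ⟨h1, h2, h3⟩ := hlab2 γ hγo hU
        exact ⟨h1, fun A hA => (hsq2 _ h2).2.1 γ A hA⟩
      · intro hUα hUβ A B hA hB he
        exact hno ⟨α, β, A, B, hUα, hUβ, hαβ, hA, inter_spec.2 he, hB⟩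
      · intro hUα hUβ hl A B hA hB
        obtain ⟨h1, h2, h3⟩ := hlab2 α hlα hUα
        obtain ⟨h4, h5, h6⟩ := hlab2 β hlβ hUβ
        rw [← hl] at h6
        exact (hsq2 _ h2).2.2 α β A B hαβ h6 hξα hlα hlβ hA hB
    · obtain ⟨A', L, h1, h2, h3⟩ := hform α B hlα hξα hBc
      have : emp ∈ₘ B := by
        rw [hB, hAc, mem_inter]
        exact ⟨mem_upair.2 (Or.inl rfl), lm_emp hlα⟩
      rw [h1] at this
      exact code_zero hα h2 h3 this
    · exact h hξβ
  · have hem : emp ∈ₘ A := by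
      have h1 : emp ∈ₘ B := by rw [hBc]; exact mem_upair.2 (Or.inl rfl)
      rw [hB] at h1
      exact (mem_inter.1 h1).1
    rcases hA with ⟨-, hlβ, hAc⟩ | ⟨-, hlβ, b, rfl, hAc⟩ | ⟨h, _⟩
    · obtain ⟨A', L, h1, h2, h3⟩ := hform β A hlβ hξβ hAc
      rw [h1] at hem
      exact code_zero hβ h2 h3 hem
    · have h1 : a ∈ₘ B := by rw [hBc]; exact mem_upair.2 (Or.inr rfl)
      rw [hB, hAc] at h1
      rcases mem_upair.1 (mem_inter.1 h1).1 with rfl | rfl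
      · rcases mem_suc.1 hξα with h | rfl
        · exact mem_emp h
        · exact mem_emp (hξo _ (lm_emp om_lm))
      · exact mem_irr _ hαβ
    · exact h hξβ
  · exact h hξα

theorem B_main (hf : OrdFaintDefE (SetModel.E (M := M))) (hs : ¬ OrdSubtleDefE (SetModel.E (M := M))) :
    ProperClassSubtleE (ES (WW (M := M))) := by
  intro ξ hξ
  by_contra hno
  apply hs
  have hξo : Od ξ.1 := (w_od ξ).1 hξ
  have ho := od_un hξo (om_od (M := M))
  have hgood : ∀ θ : M, Od θ → ∃ s, WW s ∧ Good s (un ξ.1 om) θ := by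
    intro θ hθ
    obtain ⟨s, h⟩ := good_ex (M := {x : M // WW x}) (ξ := ⟨_, WW_od _ ho⟩) ((w_od _).2 ho) (fun κ hκ hS => by
      refine hno ⟨κ, hS, ?_⟩
      have hκo : Od κ.1 := (w_od κ).1 hS.1.1.1
      exact od_lt_of_le_of_lt hκo hξo (fun z hz => mem_un.2 (Or.inl hz)) hκ) ⟨θ, WW_od θ hθ⟩ ((w_od _).2 hθ)
    exact ⟨s.1, s.2, w_good h⟩
  intro k k' φ p ψ q
  have := D2.of_realize φ p
  have := D1.of_realize ψ q
  exact B_aux hf ho (fun z hz => mem_un.2 (Or.inr hz)) hgood _ _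

end BFinal
end Paper


namespace Paper
set_option linter.unusedSectionVars false
set_option linter.unusedVariables false
set_option linter.unusedSimpArgs false


section GU1
variable {M : Type} [SetModel M]

set_option synthInstance.maxSize 1000
set_option synthInstance.maxHeartbeats 400000

/-- Grothendieck universes -/
def GU (m : M) : Prop :=
  TransE SetModel.E m ∧ (∀ x, x ∈ₘ m → ∃ p, p ∈ₘ m ∧ ∀ z, sb z x → z ∈ₘ p) ∧ (∃ w, w ∈ₘ m ∧ Lm w) ∧
  (∀ x, x ∈ₘ m → ∃ u, u ∈ₘ m ∧ ∀ y, y ∈ₘ x → ∀ z, z ∈ₘ y → z ∈ₘ u) ∧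
  (∀ a b, a ∈ₘ m → b ∈ₘ m → ∃ c, c ∈ₘ m ∧ a ∈ₘ c ∧ b ∈ₘ c) ∧
  (∀ x, x ∈ₘ m → ∀ f, (∀ y z z', op y z ∈ₘ f → op y z' ∈ₘ f → z = z') →
    (∀ y, y ∈ₘ x → ∀ z, op y z ∈ₘ f → z ∈ₘ m) → ∃ b, b ∈ₘ m ∧ ∀ y, y ∈ₘ x → ∀ z, op y z ∈ₘ f → z ∈ₘ b)

instance d1_GU : D1 (M := M) GU := ⟨by unfold GU; infer_instance⟩

theorem gu_sub {m x y : M} (h : GU m) (hx : x ∈ₘ m) (hy : sb y x) : y ∈ₘ m := by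
  obtain ⟨p, hp, h1⟩ := h.2.1 x hx
  exact h.1 p hp y (h1 y hy)

theorem gu_upair {m a b : M} (h : GU m) (ha : a ∈ₘ m) (hb : b ∈ₘ m) : upair a b ∈ₘ m := by
  obtain ⟨c, hc, h1, h2⟩ := h.2.2.2.2.1 a b ha hb
  refine gu_sub h hc fun z hz => ?_
  rcases mem_upair.1 hz with rfl | rfl
  · exact h1
  · exact h2

theorem gu_Un {m a : M} (h : GU m) (ha : a ∈ₘ m) : Un a ∈ₘ m := by
  obtain ⟨c, hc, h1⟩ := h.2.2.2.1 a ha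
  refine gu_sub h hc fun z hz => ?_
  obtain ⟨y, hy, hz⟩ := mem_Un.1 hz
  exact h1 y hy z hz

theorem gu_pw {m a : M} (h : GU m) (ha : a ∈ₘ m) : pw a ∈ₘ m := by
  obtain ⟨c, hc, h1⟩ := h.2.1 a ha
  exact gu_sub h hc fun z hz => h1 z (mem_pw.1 hz)

theorem gu_un {m a b : M} (h : GU m) (ha : a ∈ₘ m) (hb : b ∈ₘ m) : un a b ∈ₘ m := gu_Un h (gu_upair h ha hb)

theorem gu_prd {m a b : M} (h : GU m) (ha : a ∈ₘ m) (hb : b ∈ₘ m) : prd a b ∈ₘ m := by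
  refine gu_sub h (gu_pw h (gu_pw h (gu_un h ha hb))) fun z hz => ?_
  obtain ⟨x, y, hx, hy, rfl⟩ := mem_prd.1 hz
  refine mem_pw.2 fun w hw => mem_pw.2 fun u hu => mem_un.2 ?_
  unfold op sing at hw
  rcases mem_upair.1 hw with rfl | rfl
  · rcases mem_upair.1 hu with rfl | rfl <;> exact Or.inl hx
  · rcases mem_upair.1 hu with rfl | rfl
    · exact Or.inl hx
    · exact Or.inr hy

theorem gu_zfc {m : M} (h : GU m) : IsZFCE (ES (fun x => x ∈ₘ m)) := by
  have hD : D1 (fun x => x ∈ₘ m) := ⟨inferInstance⟩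
  refine zfc_of (fun x y hx hy => h.1 x hx y hy) ?_ (fun a b => gu_upair h) (fun a => gu_Un h)
    (fun a ha => ⟨pw a, gu_pw h ha, fun z _ => mem_pw⟩) ?_ ?_ ?_
  · obtain ⟨w, hw, hl⟩ := h.2.2.1
    exact gu_sub h hw (om_le_lm hl)
  · intro a ha h1 h2
    obtain ⟨c, hc⟩ := (SetModel.zfc (M := M)).2.2.2 a h1 h2
    refine ⟨inter (Un a) c, gu_sub h (gu_Un h ha) (fun z hz => (mem_inter.1 hz).1), fun x hx => ?_⟩
    obtain ⟨z, h3, h4, h5⟩ := hc x hx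
    exact ⟨z, mem_inter.2 ⟨mem_Un.2 ⟨x, hx, h4⟩, h3⟩, h4, fun z' h6 h7 => h5 z' (mem_inter.1 h6).2 h7⟩
  · intro k φ p a hp ha
    have hDef : Def (fun g : ℕ → M => RS (fun x => x ∈ₘ m) φ (Fin.cons (hd g) p)) := by
      refine (def_RS φ (fun _ x => x ∈ₘ m) (Fin.cons (α := fun _ => (ℕ → M) → M) hd (fun i _ => p i)) inferInstance ?_).congr ?_
      · intro i
        refine Fin.cases ?_ (fun i => ?_) i
        · exact tmHd'
        · exact tmConst
      · intro g
        have : (Fin.cons (hd g) p : Fin (k+1) → M) =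
          fun i => (Fin.cons (α := fun _ => (ℕ → M) → M) hd (fun i _ => p i) : Fin (k+1) → _) i g := by
          funext i
          exact Fin.cases rfl (fun _ => rfl) i
        rw [this]
    refine ⟨sep a (fun z => RS (fun x => x ∈ₘ m) φ (Fin.cons z p)), gu_sub h ha sep_sb, fun z _ => mem_sep⟩
  · intro f hf a ha hfa
    obtain ⟨b, hb, h1⟩ := h.2.2.2.2.2 a ha (gr a f) (fun y z z' h1 h2 => by
      rw [op_mem_gr] at h1 h2
      rw [h1.2, h2.2]) (fun y hy z hz => by
      rw [op_mem_gr] at hz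
      rw [hz.2]; exact hfa y hy)
    exact ⟨b, hb, fun x hx => h1 x hx _ (op_mem_gr.2 ⟨hx, rfl⟩)⟩

variable {N : Type} [SetModel N]

theorem j_RS {j : N → M} (hj : ∀ a b, a ∈ₘ b ↔ j a ∈ₘ j b) (hi : Function.Injective j) (m : M)
    (hr : ∀ x, x ∈ₘ m ↔ ∃ a, j a = x) (htr : TransE SetModel.E m) (m' : N) {n : ℕ} (φ : SetFormula n) :
    ∀ v : Fin n → N, RS (fun x => x ∈ₘ m') φ v ↔ RS (fun x => x ∈ₘ j m') φ (fun i => j (v i)) := by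
  induction φ with
  | mem a b => intro v; exact hj _ _
  | eq a b => intro v; exact hi.eq_iff.symm
  | fal => intro v; rfl
  | imp φ ψ h1 h2 => intro v; simp only [RS, h1, h2]
  | all φ ih =>
    intro v
    simp only [RS, ih]
    have : ∀ a : N, (fun i => j ((Fin.snoc v a : Fin _ → N) i)) =
        (Fin.snoc (fun i => j (v i)) (j a) : Fin _ → M) := by
      intro a
      funext i
      refine Fin.lastCases ?_ (fun j => ?_) i <;> simp
    simp only [this]
    refine ⟨fun h a ha => ?_, fun h a ha => h (j a) ((hj _ _).1 ha)⟩
    obtain ⟨b, rfl⟩ := (hr a).1 (htr (j m') ((hr _).2 ⟨m', rfl⟩) a ha)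
    exact h b ((hj _ _).2 ha)

theorem j_GU {j : N → M} (hj : ∀ a b, a ∈ₘ b ↔ j a ∈ₘ j b) (hi : Function.Injective j) {m : M}
    (hr : ∀ x, x ∈ₘ m ↔ ∃ a, j a = x) (hm : GU m) {m' : N} (h : GU m') : GU (j m') := by
  have hjm : ∀ a, j a ∈ₘ m := fun a => (hr _).2 ⟨a, rfl⟩
  have pull : ∀ {x : M} {b : N}, x ∈ₘ j b → ∃ a, j a = x ∧ a ∈ₘ b := by
    intro x b hx
    obtain ⟨a, rfl⟩ := (hr x).1 (hm.1 _ (hjm b) x hx)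
    exact ⟨a, rfl, (hj _ _).2 hx⟩
  have hsb : ∀ {x : M} {b : N}, sb x (j b) → ∃ a, j a = x ∧ sb a b := by
    intro x b hx
    obtain ⟨a, rfl⟩ := (hr x).1 (gu_sub hm (hjm b) hx)
    exact ⟨a, rfl, fun z hz => (hj _ _).2 (hx _ ((hj _ _).1 hz))⟩
  have hup : ∀ a b : N, j (upair a b) = upair (j a) (j b) := by
    intro a b
    refine ext fun z => ⟨fun hz => ?_, fun hz => ?_⟩
    · obtain ⟨c, rfl, hc⟩ := pull hz
      rcases mem_upair.1 hc with rfl | rfl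
      · exact mem_upair.2 (Or.inl rfl)
      · exact mem_upair.2 (Or.inr rfl)
    · rcases mem_upair.1 hz with rfl | rfl
      · exact (hj _ _).1 (mem_upair.2 (Or.inl rfl))
      · exact (hj _ _).1 (mem_upair.2 (Or.inr rfl))
  have hop : ∀ a b : N, j (op a b) = op (j a) (j b) := by
    intro a b
    unfold op sing
    rw [hup, hup, hup]
  have ht : ∀ a : N, TransE SetModel.E a → TransE SetModel.E (j a) := by
    intro a h y hy z hz
    obtain ⟨y, rfl, hy2⟩ := pull hy
    replace hy := hy2
    obtain ⟨z, rfl, hz2⟩ := pull hz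
    replace hz := hz2
    exact (hj _ _).1 (h y hy z hz)
  refine ⟨ht _ h.1, ?_, ?_, ?_, ?_, ?_⟩
  · intro x hx
    obtain ⟨x, rfl, hx2⟩ := pull hx
    replace hx := hx2
    obtain ⟨p, hp, h1⟩ := h.2.1 x hx
    refine ⟨j p, (hj _ _).1 hp, fun z hz => ?_⟩
    obtain ⟨z, rfl, hz2⟩ := hsb hz
    replace hz := hz2
    exact (hj _ _).1 (h1 z hz)
  · obtain ⟨w, hw, h1⟩ := h.2.2.1
    refine ⟨j w, (hj _ _).1 hw, ⟨ht _ h1.1.1, fun y hy => ?_⟩, ?_, ?_⟩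
    · obtain ⟨y, rfl, hy2⟩ := pull hy
      replace hy := hy2
      exact ht y (h1.1.2 y hy)
    · obtain ⟨z, hz⟩ := h1.2.1
      exact ⟨_, (hj _ _).1 hz⟩
    · intro y hy
      obtain ⟨y, rfl, hy2⟩ := pull hy
      replace hy := hy2
      obtain ⟨z, hz, hyz⟩ := h1.2.2 y hy
      exact ⟨j z, (hj _ _).1 hz, (hj _ _).1 hyz⟩
  · intro x hx
    obtain ⟨x, rfl, hx2⟩ := pull hx
    replace hx := hx2
    obtain ⟨u, hu, h1⟩ := h.2.2.2.1 x hx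
    refine ⟨j u, (hj _ _).1 hu, fun y hy z hz => ?_⟩
    obtain ⟨y, rfl, hy2⟩ := pull hy
    replace hy := hy2
    obtain ⟨z, rfl, hz2⟩ := pull hz
    replace hz := hz2
    exact (hj _ _).1 (h1 y hy z hz)
  · intro a b ha hb
    obtain ⟨a, rfl, ha2⟩ := pull ha
    replace ha := ha2
    obtain ⟨b, rfl, hb2⟩ := pull hb
    replace hb := hb2
    obtain ⟨c, hc, h1, h2⟩ := h.2.2.2.2.1 a b ha hb
    exact ⟨j c, (hj _ _).1 hc, (hj _ _).1 h1, (hj _ _).1 h2⟩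
  · intro x hx f hf hfm
    obtain ⟨x, rfl, hx2⟩ := pull hx
    replace hx := hx2
    obtain ⟨f', hf'⟩ := (hr (inter (prd (j x) (j m')) f)).1
      (gu_sub hm (gu_prd hm (hjm x) (hjm m')) (fun z hz => (mem_inter.1 hz).1))
    have hff : ∀ y z : N, op y z ∈ₘ f' → op (j y) (j z) ∈ₘ f := by
      intro y z h
      rw [hj, hf', hop] at h
      exact (mem_inter.1 h).2
    have hff' : ∀ y z : N, y ∈ₘ x → op (j y) (j z) ∈ₘ f → op y z ∈ₘ f' := by
      intro y z hy h
      rw [hj, hf', hop]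
      have h1 := (hj _ _).1 hy
      exact mem_inter.2 ⟨op_mem_prd.2 ⟨h1, hfm _ h1 _ h⟩, h⟩
    obtain ⟨b, hb, h1⟩ := h.2.2.2.2.2 x hx f' (fun y z z' h1 h2 => hi (hf _ _ _ (hff _ _ h1) (hff _ _ h2)))
      (fun y hy z hz => (hj _ _).2 (hfm _ ((hj _ _).1 hy) _ (hff _ _ hz)))
    refine ⟨j b, (hj _ _).1 hb, fun y hy z hz => ?_⟩
    have hz' := hfm y hy z hz
    obtain ⟨y, rfl, hy2⟩ := pull hy
    replace hy := hy2
    obtain ⟨z, rfl, -⟩ := pull hz'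
    exact (hj _ _).1 (h1 y hy z (hff' y z hy hz))

end GU1
end Paper


namespace Paper
set_option linter.unusedSectionVars false
set_option linter.unusedVariables false
set_option linter.unusedSimpArgs false


section Refl
variable {M : Type} [SetModel M]

set_option synthInstance.maxSize 1000
set_option synthInstance.maxHeartbeats 400000

theorem Vf_lm {α x : M} (h : Lm α) (hx : x ∈ₘ Vf α) : ∃ β, β ∈ₘ α ∧ x ∈ₘ Vf β := by
  obtain ⟨β, hβ, h1⟩ := (mem_Vf h.1).1 hx
  exact ⟨suc β, lm_suc h hβ, (mem_Vf (od_suc (od_mem h.1 hβ))).2 ⟨β, self_suc β, h1⟩⟩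

theorem Vf_od : ∀ α : M, Od α → sb α (Vf α) := by
  refine od_ind (P := fun α : M => sb α (Vf α)) ?_
  intro α hα ih z hz
  exact (mem_Vf hα).2 ⟨z, hz, ih z hz⟩

theorem un_lt {α a b : M} (h : Od α) (ha : a ∈ₘ α) (hb : b ∈ₘ α) : un a b ∈ₘ α := by
  rcases od_max (od_mem h ha) (od_mem h hb) with h1 | h1 <;> rw [h1] <;> assumption

theorem Vf_lm2 {α x y : M} (h : Lm α) (hx : x ∈ₘ Vf α) (hy : y ∈ₘ Vf α) : ∃ β, β ∈ₘ α ∧ x ∈ₘ Vf β ∧ y ∈ₘ Vf β := by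
  obtain ⟨β, hβ, h1⟩ := Vf_lm h hx
  obtain ⟨γ, hγ, h2⟩ := Vf_lm h hy
  have h3 := un_lt h.1 hβ hγ
  have h4 := od_mem h.1 h3
  exact ⟨_, h3, Vf_mono h4 (od_mem h.1 hβ) (fun z hz => mem_un.2 (Or.inl hz)) _ h1,
    Vf_mono h4 (od_mem h.1 hγ) (fun z hz => mem_un.2 (Or.inr hz)) _ h2⟩

theorem Vf_upair {α x y : M} (h : Lm α) (hx : x ∈ₘ Vf α) (hy : y ∈ₘ Vf α) : upair x y ∈ₘ Vf α := by
  obtain ⟨β, hβ, h1, h2⟩ := Vf_lm2 h hx hy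
  refine (mem_Vf h.1).2 ⟨β, hβ, fun z hz => ?_⟩
  rcases mem_upair.1 hz with rfl | rfl <;> assumption

theorem Vf_Un {α x : M} (h : Lm α) (hx : x ∈ₘ Vf α) : Un x ∈ₘ Vf α := by
  obtain ⟨β, hβ, h1⟩ := (mem_Vf h.1).1 hx
  refine (mem_Vf h.1).2 ⟨β, hβ, fun z hz => ?_⟩
  obtain ⟨y, hy, hz⟩ := mem_Un.1 hz
  exact Vf_trans β (od_mem h.1 hβ) y (h1 y hy) z hz

theorem Vf_pw {α x : M} (h : Lm α) (hx : x ∈ₘ Vf α) : pw x ∈ₘ Vf α := by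
  obtain ⟨β, hβ, h1⟩ := (mem_Vf h.1).1 hx
  refine (mem_Vf h.1).2 ⟨suc β, lm_suc h hβ, fun z hz => ?_⟩
  exact (mem_Vf (od_suc (od_mem h.1 hβ))).2 ⟨β, self_suc β, fun w hw => h1 w (mem_pw.1 hz w hw)⟩

theorem Vf_un {α x y : M} (h : Lm α) (hx : x ∈ₘ Vf α) (hy : y ∈ₘ Vf α) : un x y ∈ₘ Vf α := Vf_Un h (Vf_upair h hx hy)
theorem Vf_op {α x y : M} (h : Lm α) (hx : x ∈ₘ Vf α) (hy : y ∈ₘ Vf α) : op x y ∈ₘ Vf α :=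
  Vf_upair h (Vf_upair h hx hx) (Vf_upair h hx hy)
theorem Vf_adj {α x y : M} (h : Lm α) (hx : x ∈ₘ Vf α) (hy : y ∈ₘ Vf α) : adj x y ∈ₘ Vf α :=
  Vf_un h hx (Vf_upair h hy hy)

theorem Vf_num {α : M} (h : Lm α) : ∀ n : ℕ, num n ∈ₘ Vf α
  | 0 => Vf_od α h.1 _ (lm_emp h)
  | n + 1 => Vf_upair h (Vf_num h n) (Vf_num h n)

theorem Vf_tup {α : M} (h : Lm α) : ∀ {n : ℕ} (v : Fin n → M), (∀ i, v i ∈ₘ Vf α) → tup v ∈ₘ Vf α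
  | 0, v, _ => Vf_od α h.1 _ (lm_emp h)
  | n + 1, v, hv => Vf_adj h (Vf_tup h _ fun i => hv _) (Vf_op h (Vf_num h n) (hv _))

theorem refl_ex {n : ℕ} (ψ : SetFormula n) : ∃ F : M → M, F1 F ∧ (∀ β, Od β → Od (F β)) ∧
    ∀ α, Lm α → (∀ β, β ∈ₘ α → F β ∈ₘ α) → ∀ v : Fin n → M, (∀ i, v i ∈ₘ Vf α) →
      (RS (fun x => x ∈ₘ Vf α) ψ v ↔ RS (fun _ => True) ψ v) := by
  induction ψ with
  | mem i j => exact ⟨fun x => x, ⟨inferInstance⟩, fun _ h => h, fun α _ _ v _ => Iff.rfl⟩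
  | eq i j => exact ⟨fun x => x, ⟨inferInstance⟩, fun _ h => h, fun α _ _ v _ => Iff.rfl⟩
  | fal => exact ⟨fun x => x, ⟨inferInstance⟩, fun _ h => h, fun α _ _ v _ => Iff.rfl⟩
  | imp φ ψ h1 h2 =>
    obtain ⟨F, hF, hFo, h1⟩ := h1
    obtain ⟨G, hG, hGo, h2⟩ := h2
    refine ⟨fun β => un (F β) (G β), ⟨inferInstance⟩, fun β hβ => od_un (hFo β hβ) (hGo β hβ), ?_⟩
    intro α hα hc v hv
    simp only [RS]
    rw [h1 α hα (fun β hβ => ?_) v hv, h2 α hα (fun β hβ => ?_) v hv]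
    · have hβo := od_mem hα.1 hβ
      exact od_lt_of_le_of_lt hα.1 (hGo β hβo) (fun z hz => mem_un.2 (Or.inr hz)) (hc β hβ)
    · have hβo := od_mem hα.1 hβ
      exact od_lt_of_le_of_lt hα.1 (hFo β hβo) (fun z hz => mem_un.2 (Or.inl hz)) (hc β hβ)
  | @all n ψ ih =>
    obtain ⟨F, hF, hFo, h1⟩ := ih
    obtain ⟨Q, hQ, hQe⟩ : ∃ Q : M → M → Prop, D2 Q ∧ ∀ t x, Q t x ↔
        ¬ RS (fun _ => True) ψ (Fin.snoc (fun i : Fin n => ap t (num i)) x) := by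
      have : Def (fun g : ℕ → M => RS (fun _ => True) ψ (Fin.snoc (fun i : Fin n => ap (hd g) (num i)) (hd (tl g)))) := by
        refine (def_RS ψ (fun _ _ => True) (Fin.snoc (α := fun _ => (ℕ → M) → M) (fun (i : Fin n) g => ap (hd g) (num i)) (fun g => hd (tl g))) defConst ?_).congr fun g => ?_
        · intro i
          refine Fin.lastCases ?_ (fun j => ?_) i
          · simp only [Fin.snoc_last]; infer_instance
          · simp only [Fin.snoc_castSucc]; infer_instance
        · have : (Fin.snoc (fun i : Fin n => ap (hd g) (num i)) (hd (tl g)) : Fin (n+1) → M) =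
            fun i => (Fin.snoc (α := fun _ => (ℕ → M) → M) (fun (i : Fin n) g => ap (hd g) (num i)) (fun g => hd (tl g)) : Fin (n+1) → _) i g := by
            funext i
            refine Fin.lastCases ?_ (fun j => ?_) i <;> simp
          rw [this]
      exact ⟨fun t x => ¬ RS (fun _ => True) ψ (Fin.snoc (fun i : Fin n => ap t (num i)) x), ⟨defNot⟩, fun _ _ => Iff.rfl⟩
    have hdd : ∀ β : M, Def (fun g : ℕ → M => ∀ t, t ∈ₘ Vf β → (∃ x, Q t x) → ∃ x, x ∈ₘ Vf (hd g) ∧ Q t x) := fun β => inferInstance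
    let G : M → M := fun β => lst (fun γ => ∀ t, t ∈ₘ Vf β → (∃ x, Q t x) → ∃ x, x ∈ₘ Vf γ ∧ Q t x)
    have hG : F1 G := ⟨(inferInstance : Tm (fun g : ℕ → M => lst (fun γ => ∀ t, t ∈ₘ Vf (hd g) → (∃ x, Q t x) → ∃ x, x ∈ₘ Vf γ ∧ Q t x)))⟩
    have hG2 : ∀ β, Od β → Od (G β) ∧ ∀ t, t ∈ₘ Vf β → (∃ x, Q t x) → ∃ x, x ∈ₘ Vf (G β) ∧ Q t x := by
      intro β hβ
      obtain ⟨b, hb⟩ := coll (R := Q) (a := sep (Vf β) (fun t => ∃ x, Q t x)) (fun t ht => (mem_sep.1 ht).2)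
      obtain ⟨γ, hγ, hbγ⟩ := Vf_all b
      have hdb := hdd β
      have := lst_spec (P := fun γ => ∀ t, t ∈ₘ Vf β → (∃ x, Q t x) → ∃ x, x ∈ₘ Vf γ ∧ Q t x) hγ (by
        intro t ht hx
        obtain ⟨y, hy, hq⟩ := hb t (mem_sep.2 ⟨ht, hx⟩)
        exact ⟨y, Vf_trans γ hγ b hbγ y hy, hq⟩)
      exact ⟨this.1, this.2.1⟩
    refine ⟨fun β => un (F β) (G β), ⟨inferInstance⟩, fun β hβ => od_un (hFo β hβ) (hG2 β hβ).1, ?_⟩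
    intro α hα hc v hv
    have hcF : ∀ β, β ∈ₘ α → F β ∈ₘ α := fun β hβ =>
      od_lt_of_le_of_lt hα.1 (hFo β (od_mem hα.1 hβ)) (fun z hz => mem_un.2 (Or.inl hz)) (hc β hβ)
    have hcG : ∀ β, β ∈ₘ α → G β ∈ₘ α := fun β hβ =>
      od_lt_of_le_of_lt hα.1 (hG2 β (od_mem hα.1 hβ)).1 (fun z hz => mem_un.2 (Or.inr hz)) (hc β hβ)
    have hsn : ∀ a, a ∈ₘ Vf α → (RS (fun x => x ∈ₘ Vf α) ψ (Fin.snoc v a) ↔ RS (fun _ => True) ψ (Fin.snoc v a)) := by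
      intro a ha
      refine h1 α hα hcF _ fun i => ?_
      refine Fin.lastCases ?_ (fun j => ?_) i
      · simpa using ha
      · simpa using hv j
    simp only [RS]
    constructor
    · intro h a _
      by_contra hn
      have hap : (fun i : Fin n => ap (tup v) (num i)) = v := funext fun i => ap_tup v i
      obtain ⟨β, hβ, htv⟩ := Vf_lm hα (Vf_tup hα v hv)
      obtain ⟨x, hx, hq⟩ := (hG2 β (od_mem hα.1 hβ)).2 (tup v) htv ⟨a, by
        rw [hQe, hap]; exact hn⟩
      have hq2 := (hQe _ _).1 hq
      rw [hap] at hq2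
      have hx2 := Vf_mono hα.1 (od_mem hα.1 (hcG β hβ)) (od_sb hα.1 (hcG β hβ)) _ hx
      exact hq2 ((hsn x hx2).1 (h x hx2))
    · intro h a ha
      exact (hsn a ha).2 (h a trivial)

theorem club_closure (F : M → M) [hF : F1 F] (hFo : ∀ β, Od β → Od (F β)) :
    ClubClassE SetModel.E (fun α => Lm α ∧ om ∈ₘ α ∧ ∀ β, β ∈ₘ α → F β ∈ₘ α) := by
  refine ⟨fun α h => h.1.1, ?_, ?_⟩
  · intro ξ hξ
    let H : M → M := fun x => suc (un x (ssup (img (suc x) F)))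
    have hH : F1 H := ⟨(inferInstance : Tm (fun g : ℕ → M => suc (un (hd g) (ssup (img (suc (hd g)) (fun y => F y))))))⟩
    have h1 : ∀ x, Od x → Od (H x) := fun x hx => od_suc (od_un hx (ssup_od _))
    have h2 : ∀ x, Od x → x ∈ₘ H x := fun x hx => (mem_suc_un hx (ssup_od _)).1
    have hb : Od (suc (un ξ om)) := od_suc (od_un hξ om_od)
    have ho := itr_od h1 hb om om_od
    have hlt : ∀ β, β ∈ₘ itr H (suc (un ξ om)) om → F β ∈ₘ itr H (suc (un ξ om)) om ∧ suc β ∈ₘ itr H (suc (un ξ om)) om := by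
      intro β hβ
      obtain ⟨b, hb', hz⟩ := itr_lm om_lm hβ
      have hbo := od_mem om_od hb'
      have hio := itr_od h1 hb b hbo
      have hF1 : F β ∈ₘ H (itr H (suc (un ξ om)) b) := by
        refine mem_suc.2 (Or.inl (mem_un.2 (Or.inr (mem_ssup (mem_img.2 ⟨β, ?_, rfl⟩) (hFo β (od_mem ho hβ))))))
        exact mem_suc.2 (Or.inl hz)
      have hF2 : suc β ∈ₘ H (itr H (suc (un ξ om)) b) := by
        refine od_lt_of_le_of_lt (h1 _ hio) (od_suc (od_mem ho hβ)) ?_ (h2 _ hio)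
        intro z hz'
        rcases mem_suc.1 hz' with h | rfl
        · exact od_tr hio hz h
        · exact hz
      exact ⟨itr_H om_od hb' _ hF1, itr_H om_od hb' _ hF2⟩
    have hm := mem_suc_un hξ om_od
    refine ⟨itr H (suc (un ξ om)) om, ⟨lm_of ho (itr_base om_od _ hm.1) (fun a ha => (hlt a ha).2),
      itr_base om_od _ hm.2, fun β hβ => (hlt β hβ).1⟩, itr_base om_od _ hm.1⟩
  · rintro l hl ⟨w, hw⟩ h
    refine ⟨lm_of hl hw fun a ha => ?_, ?_, fun a ha => ?_⟩
    · obtain ⟨β, ⟨h1, _⟩, h2, h3⟩ := h a ha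
      exact od_tr hl h3 (lm_suc h1 h2)
    · obtain ⟨β, ⟨_, h1, _⟩, h2, h3⟩ := h w hw
      exact od_tr hl h3 h1
    · obtain ⟨β, ⟨_, _, h1⟩, h2, h3⟩ := h a ha
      exact od_tr hl h3 (h1 a h2)

end Refl
end Paper


namespace Paper
set_option linter.unusedSectionVars false
set_option linter.unusedVariables false
set_option linter.unusedSimpArgs false


section Uni

set_option synthInstance.maxSize 4000
set_option synthInstance.maxHeartbeats 1000000

def uh {M : Type} (g : ℕ → M) : M := g 0
def ut {M : Type} (g : ℕ → M) : ℕ → M := fun n => g (n + 1)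
def up {M : Type} (a : M) (g : ℕ → M) : ℕ → M := fun n => Nat.casesOn n a g

/-- predicates uniformly definable without parameters -/
class UD (P : ∀ M : Type, (M → M → Prop) → (ℕ → M) → Prop) : Prop where
  out : ∃ (n : ℕ) (φ : SetFormula n) (ts : Fin n → ℕ), ∀ M E g, P M E g ↔ Realize E φ (fun i => g (ts i))

theorem UD.congr {P Q : ∀ M : Type, (M → M → Prop) → (ℕ → M) → Prop} (hP : UD P) (h : ∀ M E g, Q M E g ↔ P M E g) : UD Q := by
  have : Q = P := funext fun M => funext fun E => funext fun g => propext (h M E g)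
  rw [this]; exact hP

instance udImp {P Q : ∀ M : Type, (M → M → Prop) → (ℕ → M) → Prop} [hP : UD P] [hQ : UD Q] :
    UD (fun M E g => P M E g → Q M E g) := by
  obtain ⟨n, φ, ts, h⟩ := hP.out
  obtain ⟨m, ψ, us, k⟩ := hQ.out
  refine ⟨n + m, .imp (φ.ren (Fin.castAdd m)) (ψ.ren (Fin.natAdd n)), Fin.append ts us, fun M E g => ?_⟩
  simp only [Realize, realize_ren, Fin.append_left, Fin.append_right, h, k]

instance udFalse : UD (fun _ _ _ => False) := ⟨0, .fal, Fin.elim0, fun M E g => by simp [Realize]⟩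

instance udNot {P : ∀ M : Type, (M → M → Prop) → (ℕ → M) → Prop} [UD P] : UD (fun M E g => ¬ P M E g) :=
  (inferInstance : UD (fun M E g => P M E g → False))

instance udAnd {P Q : ∀ M : Type, (M → M → Prop) → (ℕ → M) → Prop} [UD P] [UD Q] :
    UD (fun M E g => P M E g ∧ Q M E g) :=
  (inferInstance : UD (fun M E g => ¬ (P M E g → ¬ Q M E g))).congr fun M E g => by tauto

instance udOr {P Q : ∀ M : Type, (M → M → Prop) → (ℕ → M) → Prop} [UD P] [UD Q] :
    UD (fun M E g => P M E g ∨ Q M E g) :=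
  (inferInstance : UD (fun M E g => ¬ P M E g → Q M E g)).congr fun M E g => by tauto

instance udIff {P Q : ∀ M : Type, (M → M → Prop) → (ℕ → M) → Prop} [UD P] [UD Q] :
    UD (fun M E g => P M E g ↔ Q M E g) :=
  (inferInstance : UD (fun M E g => (P M E g → Q M E g) ∧ (Q M E g → P M E g))).congr fun M E g => by tauto

theorem udAll' {P : ∀ M : Type, (M → M → Prop) → (ℕ → M) → Prop} (h : UD P) :
    UD (fun M E g => ∀ a, P M E (up a g)) := by
  obtain ⟨n, φ, ts, h⟩ := h.out
  let f : Fin n → Fin (n + 1) := fun i => if ts i = 0 then Fin.last n else i.castSucc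
  let us : Fin n → ℕ := fun i => ts i - 1
  refine ⟨n, .all (φ.ren f), us, fun M E g => ?_⟩
  simp only [Realize, realize_ren, h]
  refine forall_congr' fun a => ?_
  have : (fun i => up a g (ts i)) = fun i => (Fin.snoc (fun i => g (us i)) a : Fin (n+1) → M) (f i) := by
    funext i
    by_cases hi : ts i = 0
    · simp [f, hi, up]
    · simp only [f, hi, if_false, Fin.snoc_castSucc, us]
      obtain ⟨k, hk⟩ := Nat.exists_eq_succ_of_ne_zero hi
      simp [hk, up]
  rw [this]

instance udAll {P : ∀ M : Type, (M → M → Prop) → (ℕ → M) → M → Prop} [h : UD (fun M E g => P M E (ut g) (uh g))] :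
    UD (fun M E g => ∀ a, P M E g a) := udAll' h

instance udEx {P : ∀ M : Type, (M → M → Prop) → (ℕ → M) → M → Prop} [h : UD (fun M E g => P M E (ut g) (uh g))] :
    UD (fun M E g => ∃ a, P M E g a) :=
  (inferInstance : UD (fun M E g => ¬ ∀ a, ¬ P M E g a)).congr fun M E g => by push Not; rfl

class UV (v : ∀ M : Type, (ℕ → M) → (ℕ → M)) : Prop where
  out : ∃ k, ∀ M g n, v M g n = g (n + k)

instance uvId : UV (fun M g => g) := ⟨0, fun _ _ _ => rfl⟩
instance uvTl {v : ∀ M : Type, (ℕ → M) → (ℕ → M)} [h : UV v] : UV (fun M g => ut (v M g)) := by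
  obtain ⟨k, h⟩ := h.out
  exact ⟨k + 1, fun M g n => by simp only [ut, h]; congr 1; omega⟩

instance udMem {v w : ∀ M : Type, (ℕ → M) → (ℕ → M)} [hv : UV v] [hw : UV w] :
    UD (fun M E g => E (uh (v M g)) (uh (w M g))) := by
  obtain ⟨k, hk⟩ := hv.out
  obtain ⟨l, hl⟩ := hw.out
  refine ⟨2, .mem 0 1, ![k, l], fun M E g => ?_⟩
  simp [Realize, uh, hk, hl]

instance udEq {v w : ∀ M : Type, (ℕ → M) → (ℕ → M)} [hv : UV v] [hw : UV w] :
    UD (fun M E g => uh (v M g) = uh (w M g)) := by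
  obtain ⟨k, hk⟩ := hv.out
  obtain ⟨l, hl⟩ := hw.out
  refine ⟨2, .eq 0 1, ![k, l], fun M E g => ?_⟩
  simp [Realize, uh, hk, hl]

instance uvTl0 : UV (fun M => ut) := uvTl (v := fun M g => g)

theorem ud_pcs : UD (fun M E _ => ProperClassSubtleE E) := by
  unfold ProperClassSubtleE SubtleE InfCardE CardE BijE SurjE InjE InfiniteOrdE SeqSpecE ClubInE UnboundedInE ClosedInE
  unfold OmegaSpecE LeE InterSpecE LimitE OrdE IsFuncE PairMemE OPairE UPairE TransE SubE
  infer_instance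

theorem pcs_sentence : ∃ φ : SetFormula 0, ∀ (M : Type) (E : M → M → Prop), Nonempty M →
    (Realize E φ ![] ↔ ProperClassSubtleE E) := by
  obtain ⟨n, φ, ts, h⟩ := ud_pcs.out
  refine ⟨.all (φ.ren (fun _ => Fin.last 0)), fun M E ⟨a⟩ => ?_⟩
  simp only [Realize, realize_ren, Fin.snoc_last]
  exact ⟨fun h1 => (h M E (fun _ => a)).2 (h1 a), fun h1 b => (h M E (fun _ => b)).1 h1⟩

end Uni
end Paper


namespace Paper
set_option linter.unusedSectionVars false
set_option linter.unusedVariables false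
set_option linter.unusedSimpArgs false


section CFinal
variable {M : Type} [SetModel M]

set_option synthInstance.maxSize 1000
set_option synthInstance.maxHeartbeats 400000

/-- a cofinal map from an ordinal below -/
def Cof (α δ f : M) : Prop :=
  emp ∈ₘ δ ∧ ap f emp = δ ∧ (∀ ζ, ζ ∈ₘ δ → ap f ζ ∈ₘ α) ∧ ∀ β, β ∈ₘ α → ∃ ζ, ζ ∈ₘ δ ∧ β ∈ₘ ap f ζ
instance d3_Cof : D3 (M := M) Cof := ⟨by unfold Cof; infer_instance⟩

/-- ordinals onto ranks -/
noncomputable def Wb (β : M) : M := suc (lst (fun δ => ∃ f, ∀ x, x ∈ₘ Vf β → ∃ ζ, ζ ∈ₘ δ ∧ ap f ζ = x))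
instance f1_Wb : F1 (M := M) Wb := ⟨by unfold Wb; infer_instance⟩

theorem Wb_spec (β : M) : Od (Wb β) ∧ ∃ f, ∀ x, x ∈ₘ Vf β → ∃ ζ, ζ ∈ₘ Wb β ∧ ap f ζ = x := by
  obtain ⟨δ, f, hδ, hf⟩ := wo (Vf β)
  have h := lst_spec (P := fun δ => ∃ f, ∀ x, x ∈ₘ Vf β → ∃ ζ, ζ ∈ₘ δ ∧ ap f ζ = x) hδ ⟨f, hf⟩
  refine ⟨od_suc h.1, ?_⟩
  obtain ⟨f, hf⟩ := h.2.1
  refine ⟨f, fun x hx => ?_⟩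
  obtain ⟨ζ, h1, h2⟩ := hf x hx
  exact ⟨ζ, mem_suc.2 (Or.inl h1), h2⟩

noncomputable def Jb (β : M) : M := ssup (Un (img β (fun x => img β (fun y => J x y))))
instance f1_Jb : F1 (M := M) Jb := ⟨by unfold Jb; infer_instance⟩

theorem Jb_spec {β x y : M} (h : Od β) (hx : x ∈ₘ β) (hy : y ∈ₘ β) : J x y ∈ₘ Jb β :=
  mem_ssup (mem_Un.2 ⟨_, mem_img.2 ⟨x, hx, rfl⟩, mem_img.2 ⟨y, hy, rfl⟩⟩) (J_od (od_mem h hx) (od_mem h hy))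

open Classical in
theorem gu_or {α : M} (hα : Lm α) (hom : om ∈ₘ α) (hW : ∀ β, β ∈ₘ α → Wb β ∈ₘ α)
    (hn : ¬ ∃ δ f, δ ∈ₘ α ∧ Cof α δ f) : GU (Vf α) := by
  refine ⟨Vf_trans α hα.1, fun x hx => ⟨pw x, Vf_pw hα hx, fun z hz => mem_pw.2 hz⟩,
    ⟨om, Vf_od α hα.1 _ hom, om_lm⟩, fun x hx => ⟨Un x, Vf_Un hα hx, fun y hy z hz => mem_Un.2 ⟨y, hy, hz⟩⟩,
    fun a b ha hb => ⟨_, Vf_upair hα ha hb, mem_upair.2 (Or.inl rfl), mem_upair.2 (Or.inr rfl)⟩, ?_⟩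
  intro x hx f hf hfm
  obtain ⟨β, hβ, hxβ⟩ := (mem_Vf hα.1).1 hx
  obtain ⟨hδo, e, he⟩ := Wb_spec β
  have hδ := hW β hβ
  have he0 : emp ∈ₘ Wb β := by
    rcases od_emp_le hδo with h' | h'
    · exact h'
    · unfold Wb at h'
      exact absurd (h' ▸ self_suc _) mem_emp
  let val : M → M := fun ζ => lst (fun γ => ∀ z, z ∈ₘ Vf α → op (ap e ζ) z ∈ₘ f → z ∈ₘ Vf γ)
  have hval : F1 val := ⟨(inferInstance : Tm (fun g : ℕ → M => lst (fun γ => ∀ z, z ∈ₘ Vf α → op (ap e (hd g)) z ∈ₘ f → z ∈ₘ Vf γ)))⟩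
  have hval2 : ∀ ζ, val ζ ∈ₘ α ∧ ∀ z, z ∈ₘ Vf α → op (ap e ζ) z ∈ₘ f → z ∈ₘ Vf (val ζ) := by
    intro ζ
    have : ∃ γ, γ ∈ₘ α ∧ ∀ z, z ∈ₘ Vf α → op (ap e ζ) z ∈ₘ f → z ∈ₘ Vf γ := by
      by_cases hz : ∃ z, z ∈ₘ Vf α ∧ op (ap e ζ) z ∈ₘ f
      · obtain ⟨z, hz, hzf⟩ := hz
        obtain ⟨γ, hγ, h1⟩ := Vf_lm hα hz
        refine ⟨γ, hγ, fun z' _ h2 => ?_⟩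
        rw [hf _ _ _ h2 hzf]; exact h1
      · exact ⟨emp, lm_emp hα, fun z h1 h2 => absurd ⟨z, h1, h2⟩ hz⟩
    obtain ⟨γ, hγ, h1⟩ := this
    have hs := lst_spec (P := fun γ => ∀ z, z ∈ₘ Vf α → op (ap e ζ) z ∈ₘ f → z ∈ₘ Vf γ) (od_mem hα.1 hγ) h1
    have hl := lst_le (P := fun γ => ∀ z, z ∈ₘ Vf α → op (ap e ζ) z ∈ₘ f → z ∈ₘ Vf γ) (od_mem hα.1 hγ) h1
    exact ⟨od_lt_of_le_of_lt hα.1 hs.1 hl hγ, hs.2.1⟩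
  let F : M → M := fun ζ => if ζ = emp then Wb β else val ζ
  have hF : Tm (fun g => F (hd g)) := (inferInstance : Tm (fun g : ℕ → M => if hd g = emp then Wb β else val (hd g)))
  have hb : ∃ b, b ∈ₘ α ∧ ∀ ζ, ζ ∈ₘ Wb β → ¬ b ∈ₘ F ζ := by
    by_contra hc
    push Not at hc
    refine hn ⟨Wb β, gr (Wb β) F, hδ, he0, ?_, ?_, ?_⟩
    · rw [ap_gr he0]; simp [F]
    · intro ζ hζ
      rw [ap_gr hζ]
      by_cases h : ζ = emp
      · simpa [F, h] using hδ
      · simpa [F, h] using (hval2 ζ).1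
    · intro b hb
      obtain ⟨ζ, hζ, h⟩ := hc b hb
      exact ⟨ζ, hζ, by rw [ap_gr hζ]; exact h⟩
  obtain ⟨b, hbα, hb⟩ := hb
  have hu := un_lt hα.1 hbα (hval2 emp).1
  have huo := od_mem hα.1 hu
  refine ⟨Vf (un b (val emp)), (mem_Vf hα.1).2 ⟨_, hu, sb_refl _⟩, fun y hy z hz => ?_⟩
  have hzα := hfm y hy z hz
  obtain ⟨ζ, hζ, rfl⟩ := he y (hxβ y hy)
  have hzv := (hval2 ζ).2 z hzα hz
  refine Vf_mono huo (od_mem hα.1 (hval2 ζ).1) (fun w hw => mem_un.2 ?_) z hzv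
  by_cases h : ζ = emp
  · rw [h] at hw; exact Or.inr hw
  · have h1 := hb ζ hζ
    have h2 : F ζ = val ζ := by simp [F, h]
    rw [h2] at h1
    exact Or.inl ((od_not_lt (od_mem hα.1 hbα) (od_mem hα.1 (hval2 ζ).1)).1 h1 w hw)

theorem subtle_D (hs : OrdSubtleDefE (SetModel.E (M := M))) (T : M → M → Prop) [hT : D2 T] (C : M → Prop) [hC : D1 C] :
    SubtleForE SetModel.E T C := by
  obtain ⟨k, φ, p, h⟩ := hT.out.two
  obtain ⟨k', ψ, q, h'⟩ := hC.out.one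
  have := hs k k' φ p ψ q
  have e : (fun α A => Realize SetModel.E φ (Fin.cons α (Fin.cons A p))) = T := by
    funext z w; exact propext (h z w).symm
  have e' : (fun x => Realize SetModel.E ψ (Fin.cons x q)) = C := by
    funext z; exact propext (h' z).symm
  rwa [e, e'] at this

theorem gu_of_subtle (hs : OrdSubtleDefE (SetModel.E (M := M))) (φ : SetFormula 0) (hφ : Realize (SetModel.E (M := M)) φ ![]) :
    ∃ m : M, GU m ∧ RS (fun x => x ∈ₘ m) φ ![] := by
  by_contra hno
  push Not at hno
  obtain ⟨F0, hF0, hFo0, hrefl⟩ := refl_ex (M := M) φ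
  let F : M → M := fun β => un (F0 β) (un (Wb β) (Jb β))
  have hF : F1 F := ⟨(inferInstance : Tm (fun g : ℕ → M => un (F0 (hd g)) (un (Wb (hd g)) (Jb (hd g)))))⟩
  have hFo : ∀ β, Od β → Od (F β) := fun β hβ => od_un (hFo0 β hβ) (od_un (Wb_spec β).1 (ssup_od _))
  have hclub := club_closure F hFo
  obtain ⟨C, hCD, hCe⟩ : ∃ C : M → Prop, D1 C ∧ C = fun α => Lm α ∧ om ∈ₘ α ∧ ∀ β, β ∈ₘ α → F β ∈ₘ α :=
    ⟨_, ⟨(inferInstance : Def (fun g : ℕ → M => Lm (hd g) ∧ om ∈ₘ (hd g) ∧ ∀ β, β ∈ₘ (hd g) → F β ∈ₘ (hd g)))⟩, rfl⟩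
  rw [← hCe] at hclub
  have hC1 : ∀ α, C α → Lm α ∧ (∃ δ f, δ ∈ₘ α ∧ Cof α δ f) ∧ ∀ x y, x ∈ₘ α → y ∈ₘ α → J x y ∈ₘ α := by
    intro α h
    rw [hCe] at h
    obtain ⟨hl, hom, hc⟩ := h
    have hc0 : ∀ β, β ∈ₘ α → F0 β ∈ₘ α := fun β hβ =>
      od_lt_of_le_of_lt hl.1 (hFo0 β (od_mem hl.1 hβ)) (fun z hz => mem_un.2 (Or.inl hz)) (hc β hβ)
    have hc1 : ∀ β, β ∈ₘ α → Wb β ∈ₘ α := fun β hβ =>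
      od_lt_of_le_of_lt hl.1 (Wb_spec β).1 (fun z hz => mem_un.2 (Or.inr (mem_un.2 (Or.inl hz)))) (hc β hβ)
    have hc2 : ∀ β, β ∈ₘ α → Jb β ∈ₘ α := fun β hβ =>
      od_lt_of_le_of_lt hl.1 (ssup_od _) (fun z hz => mem_un.2 (Or.inr (mem_un.2 (Or.inr hz)))) (hc β hβ)
    refine ⟨hl, ?_, fun x y hx hy => ?_⟩
    · by_contra hn
      refine hno _ (gu_or hl hom hc1 hn) ?_
      rw [hrefl α hl hc0 _ (fun i => i.elim0), RS_top]
      exact hφ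
    · have h1 := lm_suc hl (un_lt hl.1 hx hy)
      have h2 := mem_suc_un (od_mem hl.1 hx) (od_mem hl.1 hy)
      exact od_tr hl.1 (hc2 _ h1) (Jb_spec (od_mem hl.1 h1) h2.1 h2.2)
  let T : M → M → Prop := fun α A => (C α ∧ ∃ δ f, δ ∈ₘ α ∧ Cof α δ f ∧ A = img δ (fun ζ => J ζ (ap f ζ))) ∨ (¬ C α ∧ A = emp)
  have hT : D2 T := ⟨inferInstance⟩
  obtain ⟨α, β, A, B, hα, hβ, hαβ, hA, hB, hB'⟩ := subtle_D hs T C (by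
    intro α hα
    by_cases h : C α
    · obtain ⟨hl, ⟨δ, f, hδ, hc⟩, hJ⟩ := hC1 α h
      refine ⟨⟨_, Or.inl ⟨h, δ, f, hδ, hc, rfl⟩⟩, ?_⟩
      rintro A (⟨_, δ, f, hδ, hc, rfl⟩ | ⟨h', _⟩)
      · intro z hz
        obtain ⟨ζ, hζ, rfl⟩ := mem_img.1 hz
        exact hJ _ _ (od_tr hl.1 hδ hζ) (hc.2.2.1 ζ hζ)
      · exact absurd h h'
    · refine ⟨⟨emp, Or.inr ⟨h, rfl⟩⟩, ?_⟩
      rintro A (⟨h', _⟩ | ⟨_, rfl⟩)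
      · exact absurd h' h
      · exact emp_sb _) hclub
  obtain ⟨_, δ, f, hδ, hc, rfl⟩ | ⟨h', _⟩ := hA
  swap
  · exact h' hβ
  obtain ⟨_, δ', f', hδ', hc', rfl⟩ | ⟨h', _⟩ := hB'
  swap
  · exact h' hα
  have hαl := (hC1 α hα).1
  have hβl := (hC1 β hβ).1
  rw [inter_spec] at hB
  have key : ∀ ζ, ζ ∈ₘ δ' → ζ ∈ₘ δ ∧ ap f' ζ = ap f ζ := by
    intro ζ hζ
    have h1 : J ζ (ap f' ζ) ∈ₘ img δ' (fun ζ => J ζ (ap f' ζ)) := mem_img.2 ⟨ζ, hζ, rfl⟩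
    rw [hB] at h1
    obtain ⟨ζ', hζ', h2⟩ := mem_img.1 (mem_inter.1 h1).1
    have h3 := J_inj (od_mem (od_mem hαl.1 hδ') hζ) (od_mem hαl.1 (hc'.2.2.1 ζ hζ))
      (od_mem (od_mem hβl.1 hδ) hζ') (od_mem hβl.1 (hc.2.2.1 ζ' hζ')) h2
    obtain ⟨rfl, h4⟩ := h3
    exact ⟨hζ', h4⟩
  have hδδ : δ' = δ := by rw [← hc'.2.1, ← hc.2.1]; exact (key emp hc'.1).2
  obtain ⟨ζ, hζ, h1⟩ := hc.2.2.2 α hαβ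
  rw [← hδδ] at hζ
  have h2 := hc'.2.2.1 ζ hζ
  rw [(key ζ hζ).2] at h2
  exact mem_asymm h1 h2

end CFinal
end Paper


namespace Paper
set_option linter.unusedSectionVars false
set_option linter.unusedVariables false
set_option linter.unusedSimpArgs false


theorem c_neg {M : Type} (E : M → M → Prop) (hE : IsZFCE E) (φ : SetFormula 0) (hφ : Realize E φ ![]) :
    ∃ (N : Type) (E' : N → N → Prop), IsZFCE E' ∧ Realize E' φ ![] ∧ ¬ OrdSubtleDefE E' := by
  letI : SetModel M := ⟨E, hE⟩
  by_cases hT : ∃ m : M, GU m ∧ RS (fun x => x ∈ₘ m) φ ![]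
  · obtain ⟨m, hm, hmφ, hmin⟩ : ∃ m : M, GU m ∧ RS (fun x => x ∈ₘ m) φ ![] ∧
        ∀ m', m' ∈ₘ m → ¬ (GU m' ∧ RS (fun x => x ∈ₘ m') φ ![]) := by
      by_contra hc
      push Not at hc
      obtain ⟨m, hm, hmφ⟩ := hT
      have hRS : Def (fun g : ℕ → M => RS (fun x => x ∈ₘ hd g) φ ![]) := by
        have := def_RS (M := M) φ (fun g x => x ∈ₘ hd g) Fin.elim0 inferInstance (fun i => i.elim0)
        have e : ∀ g : ℕ → M, (fun i : Fin 0 => (Fin.elim0 i : (ℕ → M) → M) g) = ![] := fun g => funext fun i => i.elim0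
        simpa only [e] using this
      have hD : Def (fun g : ℕ → M => ¬ (GU (hd g) ∧ RS (fun x => x ∈ₘ hd g) φ ![])) := inferInstance
      refine set_ind (P := fun a : M => ¬ (GU a ∧ RS (fun x => x ∈ₘ a) φ ![])) ?_ m ⟨hm, hmφ⟩
      rintro a ih ⟨h1, h2⟩
      obtain ⟨b, hb, h3⟩ := hc a h1 h2
      exact ih b hb h3
    have hz := gu_zfc hm
    have hr : Realize (ES (fun x => x ∈ₘ m)) φ ![] := by
      rw [RS_realize]
      convert hmφ using 1
    refine ⟨{x : M // x ∈ₘ m}, ES (fun x => x ∈ₘ m), hz, hr, fun hs => ?_⟩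
    letI : SetModel {x : M // x ∈ₘ m} := ⟨ES (fun x => x ∈ₘ m), hz⟩
    obtain ⟨m', h1, h2⟩ := gu_of_subtle (M := {x : M // x ∈ₘ m}) hs φ hr
    have hj : ∀ a b : {x : M // x ∈ₘ m}, a ∈ₘ b ↔ a.1 ∈ₘ b.1 := fun a b => Iff.rfl
    have hrg : ∀ x : M, x ∈ₘ m ↔ ∃ a : {x : M // x ∈ₘ m}, a.1 = x :=
      fun x => ⟨fun h => ⟨⟨x, h⟩, rfl⟩, fun ⟨a, h⟩ => h ▸ a.2⟩
    refine hmin m'.1 m'.2 ⟨j_GU (j := Subtype.val) hj Subtype.val_injective hrg hm h1, ?_⟩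
    rw [j_RS (j := Subtype.val) hj Subtype.val_injective m hrg hm.1] at h2
    convert h2 using 1
  · exact ⟨M, E, hE, hφ, fun hs => hT (gu_of_subtle (M := M) hs φ hφ)⟩

theorem step12 (h : ¬ ∀ (M : Type) (E : M → M → Prop), IsZFCE E → OrdFaintDefE E → OrdSubtleDefE E) :
    ∃ (M : Type) (E : M → M → Prop), IsZFCE E ∧ ProperClassSubtleE E := by
  push Not at h
  obtain ⟨M, E, hE, hf, hs⟩ := h
  letI : SetModel M := ⟨E, hE⟩
  exact ⟨_, _, WW_zfc (M := M), B_main (M := M) hf hs⟩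

theorem step23 (h : ∃ (M : Type) (E : M → M → Prop), IsZFCE E ∧ ProperClassSubtleE E) :
    ∃ φ : SetFormula 0, (∃ (M : Type) (E : M → M → Prop), IsZFCE E ∧ Realize E φ ![]) ∧
        ∀ (M : Type) (E : M → M → Prop), IsZFCE E → Realize E φ ![] → OrdFaintDefE E := by
  obtain ⟨φ, hφ⟩ := pcs_sentence
  obtain ⟨M, E, hE, hp⟩ := h
  refine ⟨φ, ⟨M, E, hE, (hφ M E hE.1).2 hp⟩, fun N E' hN hr => ?_⟩
  letI : SetModel N := ⟨E', hN⟩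
  intro k ψ p
  have := D2.of_realize (M := N) ψ p
  exact faint_of_pcs (M := N) ((hφ N E' hN.1).1 hr) _

theorem step31 (h : ∃ φ : SetFormula 0, (∃ (M : Type) (E : M → M → Prop), IsZFCE E ∧ Realize E φ ![]) ∧
        ∀ (M : Type) (E : M → M → Prop), IsZFCE E → Realize E φ ![] → OrdFaintDefE E) :
    ¬ ∀ (M : Type) (E : M → M → Prop), IsZFCE E → OrdFaintDefE E → OrdSubtleDefE E := by
  obtain ⟨φ, ⟨M, E, hE, hφ⟩, hf⟩ := h
  intro hall
  obtain ⟨N, E', h1, h2, h3⟩ := c_neg E hE φ hφ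
  exact h3 (hall N E' h1 (hf N E' h1 h2))

end Paper


namespace Paper

/-- **Theorem 1.9.** The following statements are equivalent:
(1) `ZFC + "Ord is essentially faint"` does not prove the scheme
    "`Ord` is essentially subtle";
(2) there is a sentence `φ` of the language of set theory such that `ZFC + φ` is
    consistent and `ZFC + φ` proves the scheme "`Ord` is essentially faint";
(3) the theory `ZFC + "there is a proper class of subtle cardinals"` is consistent.
(By the Gödel completeness theorem, consistency is rendered as the existence of a
model and provability as truth in all models.) -/
theorem separate_faint_from_subtle_iff :
    ((¬ ∀ (M : Type) (E : M → M → Prop), IsZFCE E → OrdFaintDefE E →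
        OrdSubtleDefE E) ↔
      (∃ φ : SetFormula 0,
        (∃ (M : Type) (E : M → M → Prop), IsZFCE E ∧ Realize E φ ![]) ∧
        ∀ (M : Type) (E : M → M → Prop), IsZFCE E → Realize E φ ![] →
          OrdFaintDefE E)) ∧
    ((∃ φ : SetFormula 0,
        (∃ (M : Type) (E : M → M → Prop), IsZFCE E ∧ Realize E φ ![]) ∧
        ∀ (M : Type) (E : M → M → Prop), IsZFCE E → Realize E φ ![] →
          OrdFaintDefE E) ↔
      ∃ (M : Type) (E : M → M → Prop), IsZFCE E ∧ ProperClassSubtleE E) := by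
  exact ⟨⟨fun h => step23 (step12 h), step31⟩, ⟨fun h => step12 (step31 h), step23⟩⟩

end Paper
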